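/- arXiv:2007.06264 — 2 statements merged into one kernel-verified Lean document; each statement's English description precedes it below -/
import Mathlib

section
/- Fix τ > 0, s ∈ ℂ with Re(s) > 1/2, ζ₊ > 0, ζ₋ < 0, and N ∈ ℤ_{≥1}. For q ∈ (0,1) set t := q^τ, α := −i q^{s}, β := i q^{conj(s)}, γ := −i, δ := i. For all q sufficiently close to 1 the quadruple (α,β,γ,δ) is of principal series, so the hypergeometric measure M_N^{q,t;α,β,γ,δ} is a well-defined probability measure on Ω_N. Then, as q → 1⁻, the pushforward of M_N^{q,t;α,β,γ,δ} under the map sending a configuration X ∈ Ω_N to the vector of its N points listed in decreasing order converges weakly, as a family of Borel probability measures on ℝ^N, to the s-measure P_N^{τ;s}. -/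
/-- The infinite q-Pochhammer symbol `(u; q)_∞` (complex version). -/
noncomputable def qPochC (q : ℝ) (u : ℂ) : ℂ := ∏' n : ℕ, (1 - u * (q : ℂ) ^ n)

/-- The infinite q-Pochhammer symbol `(u; q)_∞` (real version). -/
noncomputable def qPochR (q u : ℝ) : ℝ := ∏' n : ℕ, (1 - u * q ^ n)

/-- The weight function `W(x; q; a,b,c,d) = (1-q)|x| (ax;q)_∞(bx;q)_∞ / ((cx;q)_∞(dx;q)_∞)`. -/
noncomputable def Wc (q : ℝ) (a b c d : ℂ) (x : ℝ) : ℂ :=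
  (((1 - q) * |x| : ℝ) : ℂ) * (qPochC q (a * x) * qPochC q (b * x)) /
    (qPochC q (c * x) * qPochC q (d * x))

/-- The theta function `θ_q(v) = (v;q)_∞ (q v⁻¹;q)_∞`. -/
noncomputable def thetaQ (q v : ℝ) : ℝ := qPochR q v * qPochR q (q * v⁻¹)

/-- `ψ_τ(u) = (-u)^{2τ-1} θ_q(tu)/θ_q(t u⁻¹)` with `τ = log_q t`. -/
noncomputable def psiQ (q t u : ℝ) : ℝ :=
  (-u) ^ (2 * Real.logb q t - 1) * thetaQ q (t * u) / thetaQ q (t * u⁻¹)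

/-- A (finite or countably infinite) particle configuration: a countable set of nonzero
reals, whose points can be enumerated from the outside toward 0 on each side, whose
outermost positive (resp. negative) point lies on `ζ₊ q^ℤ` (resp. `ζ₋ q^ℤ`), and in which
any two consecutive points of the same sign have ratio in `t q^{ℤ≥0}`. -/
def IsConfig (q t ζp ζm : ℝ) (X : Set ℝ) : Prop :=
  X.Countable ∧ (0 : ℝ) ∉ X ∧
  (∀ x ∈ X, 0 < x → {y ∈ X | x < y}.Finite) ∧
  (∀ x ∈ X, x < 0 → {y ∈ X | y < x}.Finite) ∧
  (∀ x ∈ X, 0 < x → (∀ y ∈ X, 0 < y → y ≤ x) → ∃ n : ℤ, x = ζp * q ^ n) ∧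
  (∀ x ∈ X, x < 0 → (∀ y ∈ X, y < 0 → x ≤ y) → ∃ n : ℤ, x = ζm * q ^ n) ∧
  (∀ x ∈ X, ∀ y ∈ X, 0 < y → y < x → (∀ z ∈ X, z ≤ y ∨ x ≤ z) → ∃ k : ℕ, y = x * t * q ^ k) ∧
  (∀ x ∈ X, ∀ y ∈ X, y < x → x < 0 → (∀ z ∈ X, z ≤ y ∨ x ≤ z) → ∃ k : ℕ, x = y * t * q ^ k)

/-- The set `Ω_N` of N-particle configurations, realized as finsets of reals. -/
def OmegaN (q t ζp ζm : ℝ) (N : ℕ) : Set (Finset ℝ) :=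
  {X | X.card = N ∧ IsConfig q t ζp ζm ↑X}

/-- The (q,t)-interaction `V_{q,t}(X)`. -/
noncomputable def Vqt (q t : ℝ) (X : Finset ℝ) : ℝ :=
  (∏ x ∈ X, ∏ y ∈ X, if y < x then (x - y) else 1) *
  (∏ x ∈ X, ∏ y ∈ X, if 0 < x ∧ y < x then
      x ^ (2 * Real.logb q t - 1) * qPochR q (q * t⁻¹ * y * x⁻¹) / qPochR q (t * y * x⁻¹)
    else 1) *
  (∏ x ∈ X, ∏ y ∈ X, if x < 0 ∧ y < x then
      |y| ^ (2 * Real.logb q t - 1) * qPochR q (q * t⁻¹ * x * y⁻¹) / qPochR q (t * x * y⁻¹)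
    else 1)

/-- The constant `C_N(k) = ∏_{1≤i<j≤N, i≤k} ψ_τ(ζ₋ζ₊⁻¹ t^{N-i-j+1})`. -/
noncomputable def CNconst (q t ζp ζm : ℝ) (N k : ℕ) : ℝ :=
  ∏ i ∈ Finset.Icc 1 N, ∏ j ∈ Finset.Icc 1 N,
    if i < j ∧ i ≤ k then psiQ q t (ζm * ζp⁻¹ * t ^ ((N : ℤ) - (i : ℤ) - (j : ℤ) + 1)) else 1

/-- The unnormalized N-particle weight
`M̃_N(X) = C_N(|X⁺|) V_{q,t}(X) ∏_{x∈X} W(x; q; a,b,c,d)`. -/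
noncomputable def Mtilde (q t ζp ζm : ℝ) (N : ℕ) (a b c d : ℂ) (X : Finset ℝ) : ℂ :=
  ((CNconst q t ζp ζm N (X.filter (fun x => 0 < x)).card * Vqt q t X : ℝ) : ℂ) *
    ∏ x ∈ X, Wc q a b c d x

/-- The density of the s-measure `P_N^{τ;s}` on the chamber
`D_N = {u₁ > ⋯ > u_N}` (unnormalized). -/
noncomputable def sDensity (τ : ℝ) (s : ℂ) (N : ℕ) (u : Fin N → ℝ) : ℝ :=
  if ∀ i j : Fin N, i < j → u j < u i then
    (∏ k : Fin N,
      (((1 : ℂ) + (u k : ℂ) * Complex.I) ^ (-s - ((N : ℂ) - 1) * (τ : ℂ)) *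
        ((1 : ℂ) - (u k : ℂ) * Complex.I) ^
          (-(starRingEnd ℂ) s - ((N : ℂ) - 1) * (τ : ℂ))).re) *
    ∏ k : Fin N, ∏ l : Fin N, if k < l then (u k - u l) ^ (2 * τ) else 1
  else 0

open MeasureTheory in
/-- The s-measure `P_N^{τ;s}`: the normalized Borel probability measure on `ℝ^N` with
density proportional to `sDensity τ s N`. -/
noncomputable def sMeasure (τ : ℝ) (s : ℂ) (N : ℕ) : Measure (Fin N → ℝ) :=
  (ENNReal.ofReal (∫ u, sDensity τ s N u))⁻¹ •
    volume.withDensity (fun u => ENNReal.ofReal (sDensity τ s N u))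

/-- Principal series of parameters. -/
def PrincipalSeries (q : ℝ) (α β γ δ : ℂ) : Prop :=
  α = (starRingEnd ℂ) β ∧ α.im ≠ 0 ∧ γ = (starRingEnd ℂ) δ ∧ γ.im ≠ 0 ∧
    (α * β).re < (γ * δ).re * q

/-- The vector of points of an N-point finset listed in decreasing order. -/
noncomputable def decVec (N : ℕ) (X : Finset ℝ) : Fin N → ℝ :=
  if h : X.card = N then fun i => ((X.orderIsoOfFin h) i.rev : ℝ) else fun _ => 0

lemma summable_norm_qfactor {q : ℝ} (h0 : 0 < q) (h1 : q < 1) (u : ℂ) :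
    Summable fun n : ℕ => ‖-(u * (q : ℂ) ^ n)‖ := by
  have : Summable fun n : ℕ => ‖u‖ * q ^ n :=
    (summable_geometric_of_lt_one h0.le h1).mul_left _
  refine this.congr fun n => ?_
  rw [norm_neg, norm_mul, norm_pow, Complex.norm_real, Real.norm_of_nonneg h0.le]

lemma multipliable_qPochC {q : ℝ} (h0 : 0 < q) (h1 : q < 1) (u : ℂ) :
    Multipliable fun n : ℕ => 1 - u * (q : ℂ) ^ n := by
  simpa only [sub_eq_add_neg] using
    multipliable_one_add_of_summable (summable_norm_qfactor h0 h1 u)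

lemma multipliable_qPochR {q : ℝ} (h0 : 0 < q) (h1 : q < 1) (u : ℝ) :
    Multipliable fun n : ℕ => 1 - u * q ^ n := by
  have : Summable fun n : ℕ => ‖-(u * q ^ n)‖ := by
    have := summable_norm_qfactor h0 h1 (u : ℂ)
    refine this.congr fun n => ?_
    rw [← Complex.norm_real]; push_cast; rfl
  simpa only [sub_eq_add_neg] using multipliable_one_add_of_summable this

lemma tendsto_prod_qPochC {q : ℝ} (h0 : 0 < q) (h1 : q < 1) (u : ℂ) :
    Filter.Tendsto (fun M : ℕ => ∏ n ∈ Finset.range M, (1 - u * (q : ℂ) ^ n)) Filter.atTop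
      (nhds (qPochC q u)) :=
  (multipliable_qPochC h0 h1 u).hasProd.tendsto_prod_nat

lemma tendsto_prod_qPochR {q : ℝ} (h0 : 0 < q) (h1 : q < 1) (u : ℝ) :
    Filter.Tendsto (fun M : ℕ => ∏ n ∈ Finset.range M, (1 - u * q ^ n)) Filter.atTop
      (nhds (qPochR q u)) :=
  (multipliable_qPochR h0 h1 u).hasProd.tendsto_prod_nat

lemma ofReal_qPochR {q : ℝ} (h0 : 0 < q) (h1 : q < 1) (u : ℝ) :
    ((qPochR q u : ℝ) : ℂ) = qPochC q u := by
  refine tendsto_nhds_unique ((Complex.continuous_ofReal.tendsto _).comp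
    (tendsto_prod_qPochR h0 h1 u)) ((tendsto_prod_qPochC h0 h1 u).congr fun M => ?_)
  simp

lemma qPochC_conj {q : ℝ} (h0 : 0 < q) (h1 : q < 1) (u : ℂ) :
    qPochC q ((starRingEnd ℂ) u) = (starRingEnd ℂ) (qPochC q u) := by
  refine tendsto_nhds_unique (tendsto_prod_qPochC h0 h1 _)
    (((Complex.continuous_conj.tendsto _).comp (tendsto_prod_qPochC h0 h1 u)).congr fun M => ?_)
  simp

lemma re_one_sub_mul_pos {u : ℂ} (hu : u.re < 1) {r : ℝ} (hr0 : 0 < r) (hr1 : r ≤ 1) :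
    0 < (1 - u * (r : ℂ)).re := by
  simp only [Complex.sub_re, Complex.one_re, Complex.re_mul_ofReal]
  nlinarith

lemma qPochC_ne_zero {q : ℝ} (h0 : 0 < q) (h1 : q < 1) {u : ℂ} (hu : u.re < 1) :
    qPochC q u ≠ 0 := by
  unfold qPochC
  simp only [sub_eq_add_neg]
  refine tprod_one_add_ne_zero_of_summable (fun n h => ?_) (summable_norm_qfactor h0 h1 u)
  have := re_one_sub_mul_pos hu (pow_pos h0 n) (pow_le_one₀ h0.le h1.le)
  push_cast at this
  rw [sub_eq_add_neg, h] at this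
  simp at this

/-- `1 - q ^ S = S (1 - q) + O((1 - q) ^ 2)` as `q → 1`. -/
lemma exists_one_sub_cpow_bound (S : ℂ) :
    ∃ C : ℝ, 0 ≤ C ∧ ∃ q₀ < 1, 0 < q₀ ∧ ∀ q : ℝ, q₀ < q → q < 1 →
      ‖1 - (q : ℂ) ^ S - S * (1 - q)‖ ≤ C * (1 - q) ^ 2 := by
  set B := ‖S‖ with hB
  have hB0 : 0 ≤ B := norm_nonneg S
  refine ⟨4 * B ^ 2 + 2 * B, by positivity, 1 - 1 / (2 * (B + 1)), ?_, ?_, ?_⟩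
  · have : 0 < 1 / (2 * (B + 1)) := by positivity
    linarith
  · have : 1 / (2 * (B + 1)) ≤ 1 / 2 := by
      apply one_div_le_one_div_of_le <;> linarith
    linarith
  intro q hq hq1
  set δ := 1 - q with hδ
  have hδ0 : 0 < δ := by linarith
  have hδ1 : δ * (2 * (B + 1)) ≤ 1 := by
    have : δ ≤ 1 / (2 * (B + 1)) := by linarith
    rwa [le_div_iff₀ (by positivity)] at this
  have hδ2 : δ ≤ 1 / 2 := by nlinarith
  have hq0 : 0 < q := by linarith
  set l := Real.log q with hl
  have hl2 : |l + δ| ≤ 2 * δ ^ 2 := by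
    rw [abs_le]
    constructor
    · have h1 : 1 - q⁻¹ ≤ l := Real.one_sub_inv_le_log_of_pos hq0
      have h2 : q⁻¹ ≤ 1 + δ + 2 * δ ^ 2 := by
        rw [inv_le_iff_one_le_mul₀ hq0]
        have : q = 1 - δ := by linarith
        rw [this]; nlinarith [mul_nonneg hδ0.le (mul_nonneg hδ0.le hδ0.le)]
      linarith
    · have : l ≤ q - 1 := Real.log_le_sub_one_of_pos hq0
      nlinarith
  have hl3 : |l| ≤ 2 * δ := by
    rw [abs_le] at hl2 ⊢
    constructor <;> nlinarith
  have hSl : ‖S * (l : ℂ)‖ ≤ 2 * B * δ := by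
    rw [norm_mul, Complex.norm_real, Real.norm_eq_abs]
    nlinarith
  have hexp := Complex.norm_exp_sub_one_sub_id_le (x := S * (l : ℂ)) (by nlinarith)
  have hq : (q : ℂ) ^ S = Complex.exp (S * l) := by
    rw [Complex.cpow_def_of_ne_zero (by exact_mod_cast hq0.ne'), hl, Complex.ofReal_log hq0.le,
      mul_comm]
  have hdecomp : 1 - (q : ℂ) ^ S - S * (1 - q) =
      -(Complex.exp (S * l) - 1 - S * l) - S * ((l + δ : ℝ) : ℂ) := by
    rw [hq, hδ]; push_cast; ring
  rw [hdecomp]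
  refine (norm_sub_le _ _).trans ?_
  rw [norm_neg, norm_mul, Complex.norm_real, Real.norm_eq_abs]
  have h1 : ‖S * (l : ℂ)‖ ^ 2 ≤ (2 * B * δ) ^ 2 := by gcongr
  nlinarith [mul_le_mul_of_nonneg_left hl2 hB0]

/-- The telescoping increment of `log (1 - w)` along the `q`-lattice. -/
lemma log_one_sub_sub_log_one_sub_mul {w : ℂ} {q : ℝ} (hw : w.re < 1)
    (hd : ‖w / (1 - w) * (1 - q)‖ ≤ 1 / 2) :
    Complex.log (1 - w) - Complex.log (1 - w * q) =
      -Complex.log (1 + w / (1 - w) * (1 - q)) := by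
  have h1 : 0 < (1 - w).re := by simpa using hw
  have hne : 1 - w ≠ 0 := fun h => by rw [h] at h1; simp at h1
  have h2 : 0 < (1 + w / (1 - w) * (1 - q)).re := by
    have := (abs_le.1 ((Complex.abs_re_le_norm _).trans hd)).1
    rw [Complex.add_re, Complex.one_re]
    linarith
  have hne2 : 1 + w / (1 - w) * (1 - q) ≠ 0 := fun h => by rw [h] at h2; simp at h2
  have hmul : 1 - w * q = (1 - w) * (1 + w / (1 - w) * (1 - q)) := by field_simp; ring
  have a1 := abs_lt.1 (Complex.abs_arg_lt_pi_div_two_iff.2 (Or.inl h1))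
  have a2 := abs_lt.1 (Complex.abs_arg_lt_pi_div_two_iff.2 (Or.inl h2))
  rw [hmul, Complex.log_mul hne hne2 ⟨by linarith, by linarith⟩]
  ring

set_option maxHeartbeats 800000 in
lemma exists_qfactor_bound (S : ℂ) {c : ℝ} (hc : 0 < c) (hc1 : c ≤ 1) :
    ∃ C : ℝ, 0 ≤ C ∧ ∃ q₀ < 1, 0 < q₀ ∧ ∀ q : ℝ, q₀ < q → q < 1 → ∀ w : ℂ, w.re < 1 →
      c * (1 + ‖w‖) ≤ ‖1 - w‖ →
      ‖(1 - (q : ℂ) ^ S * w) / (1 - w) *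
          Complex.exp (S * (Complex.log (1 - w) - Complex.log (1 - w * q))) - 1‖ ≤
        C * (1 - q) ^ 2 * (‖w‖ / (1 + ‖w‖)) := by
  obtain ⟨C₁, hC₁, q₁, hq₁, hq₁0, h₁⟩ := exists_one_sub_cpow_bound S
  set B := ‖S‖ with hB
  have hB0 : 0 ≤ B := norm_nonneg S
  refine ⟨C₁ / c + (4 * B ^ 2 + B) / c ^ 2 + (B + C₁) * (2 * B + 4 * B ^ 2) / c ^ 2,
    by positivity, max q₁ (1 - c / (2 * (B + 1))), ?_, lt_max_of_lt_left hq₁0, ?_⟩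
  · have : 0 < c / (2 * (B + 1)) := by positivity
    exact max_lt hq₁ (by linarith)
  intro q hq hq1 w hw hcw
  have h₁ := h₁ q ((le_max_left _ _).trans_lt hq) hq1
  have hq2 := (le_max_right _ _).trans_lt hq
  set δ := 1 - q with hδ
  have hδ0 : 0 < δ := by linarith
  have hδ1 : δ * (2 * (B + 1)) ≤ c := by
    have : δ ≤ c / (2 * (B + 1)) := by linarith
    rwa [le_div_iff₀ (by positivity)] at this
  have hδ2 : δ ≤ c / 2 := by nlinarith
  have hδc : (1 - (q : ℂ)) = (δ : ℂ) := by rw [hδ]; push_cast; rfl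
  set P := ‖w‖ / (1 + ‖w‖) with hP
  have hw0 := norm_nonneg w
  have hP0 : 0 ≤ P := by positivity
  have hP1 : P ≤ 1 := by rw [hP, div_le_one (by positivity)]; linarith
  have hnorm : 0 < ‖1 - w‖ := lt_of_lt_of_le (by positivity) hcw
  have hne : 1 - w ≠ 0 := norm_pos_iff.1 hnorm
  set p := w / (1 - w) with hp
  have hpP : ‖p‖ ≤ P / c := by
    rw [hp, norm_div, hP, div_div]
    gcongr
    linarith
  have hpc : ‖p‖ ≤ 1 / c := hpP.trans (by gcongr)
  set z := p * (δ : ℂ) with hz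
  have hznorm : ‖z‖ = ‖p‖ * δ := by
    rw [hz, norm_mul, Complex.norm_real, Real.norm_of_nonneg hδ0.le]
  have hzc : ‖z‖ * c ≤ δ := by
    rw [hznorm]; rw [le_div_iff₀ hc] at hpc; nlinarith
  have hz2 : ‖z‖ ≤ 1 / 2 := by nlinarith
  have hl := log_one_sub_sub_log_one_sub_mul (q := q) hw (by rw [hδc]; exact hz2)
  rw [hδc, ← hp, ← hz] at hl
  set ℓ := Complex.log (1 - w) - Complex.log (1 - w * q) with hℓ
  have hlz : ‖ℓ + z‖ ≤ ‖z‖ ^ 2 := by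
    rw [hl, neg_add_eq_sub, norm_sub_rev]
    refine (Complex.norm_log_one_add_sub_self_le (by linarith)).trans ?_
    have : (1 - ‖z‖)⁻¹ ≤ 2 := by rw [inv_le_comm₀ (by linarith) two_pos]; linarith
    nlinarith [sq_nonneg ‖z‖]
  have hl2 : ‖ℓ‖ ≤ 2 * ‖z‖ := by
    have : ℓ = (ℓ + z) - z := by ring
    rw [this]
    refine (norm_sub_le _ _).trans ?_
    nlinarith [norm_nonneg z]
  have hSl : ‖S * ℓ‖ ≤ 2 * B * ‖z‖ := by
    rw [norm_mul, mul_comm 2, mul_assoc]; exact mul_le_mul_of_nonneg_left hl2 hB0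
  have hzB : 2 * B * ‖z‖ ≤ 1 := by
    have : (2 * B * ‖z‖) * c ≤ 1 * c := by
      have := mul_le_mul_of_nonneg_left hzc hB0
      linarith
    exact le_of_mul_le_mul_right this hc
  have hexp := Complex.norm_exp_sub_one_sub_id_le (x := S * ℓ) (hSl.trans hzB)
  set b := Complex.exp (S * ℓ) - 1 with hb
  set a := 1 - (q : ℂ) ^ S with ha
  rw [hδc] at h₁
  have hb1 : ‖b + S * z‖ ≤ (4 * B ^ 2 + B) * ‖z‖ ^ 2 := by
    have : b + S * z = (b - S * ℓ) + S * (ℓ + z) := by ring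
    rw [this]
    refine (norm_add_le _ _).trans ?_
    rw [norm_mul S (ℓ + z)]
    have h1 : ‖S * ℓ‖ ^ 2 ≤ (2 * B * ‖z‖) ^ 2 := by gcongr
    linarith [mul_le_mul_of_nonneg_left hlz hB0]
  have hb2 : ‖b‖ ≤ (2 * B + 4 * B ^ 2) * ‖z‖ := by
    have : b = (b + S * z) - S * z := by ring
    rw [this]
    refine (norm_sub_le _ _).trans ?_
    rw [norm_mul S z]
    have : ‖z‖ ^ 2 ≤ ‖z‖ := by nlinarith [norm_nonneg z]
    linarith [mul_le_mul_of_nonneg_left this (by positivity : 0 ≤ 4 * B ^ 2 + B)]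
  have ha2 : ‖a‖ ≤ (B + C₁) * δ := by
    have : a = (a - S * δ) + S * δ := by ring
    rw [this]
    refine (norm_add_le _ _).trans ?_
    rw [norm_mul S, Complex.norm_real, Real.norm_of_nonneg hδ0.le]
    have : δ ^ 2 ≤ δ := by nlinarith
    linarith [mul_le_mul_of_nonneg_left this hC₁]
  have hA : (1 - (q : ℂ) ^ S * w) / (1 - w) = 1 + p * a := by
    rw [hp, ha]; field_simp; ring
  have hdecomp : (1 - (q : ℂ) ^ S * w) / (1 - w) * Complex.exp (S * ℓ) - 1 =
      p * (a - S * δ) + (b + S * z) + p * a * b := by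
    rw [hA, hz, hb]; ring
  rw [hdecomp]
  refine (norm_add₃_le).trans ?_
  rw [norm_mul p, norm_mul, norm_mul]
  have hzP : ‖z‖ ≤ P / c * δ := by rw [hznorm]; gcongr
  have hPsq : (P / c) ^ 2 ≤ P / c ^ 2 := by
    rw [div_pow]; gcongr; nlinarith
  calc ‖p‖ * ‖a - S * δ‖ + ‖b + S * z‖ + ‖p‖ * ‖a‖ * ‖b‖
      ≤ P / c * (C₁ * δ ^ 2) + (4 * B ^ 2 + B) * (P / c * δ) ^ 2 +
          P / c * ((B + C₁) * δ) * ((2 * B + 4 * B ^ 2) * (P / c * δ)) := by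
        gcongr
        · exact hb1.trans (by gcongr)
        · exact hb2.trans (by gcongr)
    _ = P / c * (C₁ * δ ^ 2) + ((4 * B ^ 2 + B) +
          (B + C₁) * (2 * B + 4 * B ^ 2)) * δ ^ 2 * (P / c) ^ 2 := by ring
    _ ≤ P / c * (C₁ * δ ^ 2) + ((4 * B ^ 2 + B) +
          (B + C₁) * (2 * B + 4 * B ^ 2)) * δ ^ 2 * (P / c ^ 2) := by gcongr
    _ = _ := by ring

lemma one_sub_mul_div_le_log_sub_log {q r : ℝ} (h0 : 0 < q) (hr : 0 ≤ r) :
    (1 - q) * (r / (1 + r)) ≤ Real.log (1 + r) - Real.log (1 + r * q) := by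
  have h1 : 0 < 1 + r := by linarith
  have h2 : 0 < 1 + r * q := by positivity
  rw [← Real.log_div h1.ne' h2.ne']
  refine le_trans (le_of_eq ?_) (Real.one_sub_inv_le_log_of_pos (by positivity))
  field_simp
  ring

/-- Quantitative `q`-binomial limit: `(q ^ S u; q)_∞ / (u; q)_∞ → (1 - u) ^ (-S)`. -/
lemma exists_qPochC_ratio_bound (S : ℂ) {c : ℝ} (hc : 0 < c) (hc1 : c ≤ 1) :
    ∃ C : ℝ, 0 ≤ C ∧ ∃ q₀ < 1, 0 < q₀ ∧ ∀ q : ℝ, q₀ < q → q < 1 → ∀ u : ℂ, u.re < 1 →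
      (∀ r : ℝ, 0 < r → r ≤ 1 → c * (1 + ‖u‖ * r) ≤ ‖1 - u * r‖) →
      ‖qPochC q ((q : ℂ) ^ S * u) / qPochC q u * Complex.exp (S * Complex.log (1 - u)) - 1‖ ≤
        Real.exp (C * (1 - q) * Real.log (1 + ‖u‖)) - 1 := by
  obtain ⟨C, hC, q₀, hq₀, hq₀0, H⟩ := exists_qfactor_bound S hc hc1
  refine ⟨C, hC, q₀, hq₀, hq₀0, fun q hq hq1 u hu hcone => ?_⟩
  have hq0 : 0 < q := hq₀0.trans hq
  have hlim : Filter.Tendsto (fun M : ℕ =>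
      (∏ n ∈ Finset.range M, (1 - (q : ℂ) ^ S * u * (q : ℂ) ^ n)) /
        (∏ n ∈ Finset.range M, (1 - u * (q : ℂ) ^ n)) *
        Complex.exp (S * (Complex.log (1 - u) - Complex.log (1 - u * (q : ℂ) ^ M)))) Filter.atTop
      (nhds (qPochC q ((q : ℂ) ^ S * u) / qPochC q u *
        Complex.exp (S * (Complex.log (1 - u) - Complex.log (1 - u * 0))))) := by
    refine ((tendsto_prod_qPochC hq0 hq1 _).div (tendsto_prod_qPochC hq0 hq1 u)
      (qPochC_ne_zero hq0 hq1 hu)).mul ?_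
    have hpow : Filter.Tendsto (fun M : ℕ => (q : ℂ) ^ M) Filter.atTop (nhds 0) :=
      tendsto_pow_atTop_nhds_zero_of_norm_lt_one
        (by rwa [Complex.norm_real, Real.norm_of_nonneg hq0.le])
    have hlog : Filter.Tendsto (fun M : ℕ => Complex.log (1 - u * (q : ℂ) ^ M)) Filter.atTop
        (nhds (Complex.log (1 - u * 0))) :=
      ((hpow.const_mul u).const_sub 1).clog (by simp)
    exact (Complex.continuous_exp.tendsto _).comp ((hlog.const_sub _).const_mul S)
  simp only [mul_zero, sub_zero, Complex.log_one] at hlim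
  refine le_of_tendsto (hlim.sub_const 1).norm (Filter.Eventually.of_forall fun M => ?_)
  set e : ℕ → ℂ := fun n => (1 - (q : ℂ) ^ S * (u * (q : ℂ) ^ n)) / (1 - u * (q : ℂ) ^ n) *
    Complex.exp (S * (Complex.log (1 - u * (q : ℂ) ^ n) -
      Complex.log (1 - u * (q : ℂ) ^ n * q))) with he
  have hprod : (∏ n ∈ Finset.range M, (1 - (q : ℂ) ^ S * u * (q : ℂ) ^ n)) /
        (∏ n ∈ Finset.range M, (1 - u * (q : ℂ) ^ n)) *
        Complex.exp (S * (Complex.log (1 - u) - Complex.log (1 - u * (q : ℂ) ^ M))) =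
      ∏ n ∈ Finset.range M, (1 + (e n - 1)) := by
    have htel := Finset.sum_range_sub' (fun n => Complex.log (1 - u * (q : ℂ) ^ n)) M
    simp only [pow_zero, mul_one] at htel
    rw [← htel, Finset.mul_sum, Complex.exp_sum, ← Finset.prod_div_distrib,
      ← Finset.prod_mul_distrib]
    refine Finset.prod_congr rfl fun n _ => ?_
    simp only [he, pow_succ]
    ring_nf
  rw [hprod]
  refine (Finset.norm_prod_one_add_sub_one_le _ _).trans ?_
  gcongr
  have hterm : ∀ n : ℕ, ‖e n - 1‖ ≤ C * (1 - q) *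
      (Real.log (1 + ‖u‖ * q ^ n) - Real.log (1 + ‖u‖ * q ^ (n + 1))) := by
    intro n
    have hn0 : 0 < q ^ n := pow_pos hq0 n
    have hn1 : q ^ n ≤ 1 := pow_le_one₀ hq0.le hq1.le
    have hnorm : ‖u * (q : ℂ) ^ n‖ = ‖u‖ * q ^ n := by
      rw [norm_mul, norm_pow, Complex.norm_real, Real.norm_of_nonneg hq0.le]
    have h1 := H q hq hq1 (u * (q : ℂ) ^ n)
      (by have := re_one_sub_mul_pos hu hn0 hn1
          push_cast at this
          rw [Complex.sub_re, Complex.one_re] at this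
          linarith)
      (by have := hcone _ hn0 hn1
          push_cast at this
          rwa [hnorm])
    refine h1.trans ?_
    have h2 := one_sub_mul_div_le_log_sub_log (r := ‖u‖ * q ^ n) hq0 (by positivity)
    rw [hnorm, pow_succ q n, ← mul_assoc ‖u‖]
    have h3 : 0 ≤ C * (1 - q) := mul_nonneg hC (by linarith)
    calc C * (1 - q) ^ 2 * (‖u‖ * q ^ n / (1 + ‖u‖ * q ^ n))
        = C * (1 - q) * ((1 - q) * (‖u‖ * q ^ n / (1 + ‖u‖ * q ^ n))) := by ring
      _ ≤ _ := mul_le_mul_of_nonneg_left h2 h3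
  refine (Finset.sum_le_sum fun n _ => hterm n).trans ?_
  rw [← Finset.mul_sum, Finset.sum_range_sub' (fun n => Real.log (1 + ‖u‖ * q ^ n))]
  refine mul_le_mul_of_nonneg_left ?_ (mul_nonneg hC (by linarith))
  simp only [pow_zero, mul_one, sub_le_self_iff]
  refine Real.log_nonneg ?_
  have : 0 ≤ ‖u‖ * q ^ M := by positivity
  linarith

/-- The filter `q → 1⁻` inside `(0, 1)`. -/
abbrev qFilter : Filter ℝ := nhdsWithin 1 (Set.Ioo (0 : ℝ) 1)

lemma eventually_qFilter {P : ℝ → Prop} {q₀ : ℝ} (h : q₀ < 1)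
    (H : ∀ q : ℝ, q₀ < q → 0 < q → q < 1 → P q) : ∀ᶠ q in qFilter, P q := by
  have h1 : ∀ᶠ q in qFilter, q ∈ Set.Ioo (0 : ℝ) 1 := eventually_mem_nhdsWithin
  have h2 : ∀ᶠ q in qFilter, q₀ < q :=
    (nhdsWithin_le_nhds : qFilter ≤ nhds 1) (lt_mem_nhds h)
  filter_upwards [h1, h2] with q a b using H q b a.1 a.2

instance : qFilter.NeBot := by
  refine mem_closure_iff_nhdsWithin_neBot.1 ?_
  rw [closure_Ioo zero_ne_one]
  exact ⟨zero_le_one, le_rfl⟩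

lemma tendsto_id_qFilter : Filter.Tendsto (fun q : ℝ => q) qFilter (nhds 1) :=
  Filter.tendsto_id.mono_left nhdsWithin_le_nhds

lemma tendsto_rpow_qFilter (a : ℝ) :
    Filter.Tendsto (fun q : ℝ => q ^ a) qFilter (nhds 1) := by
  have := tendsto_id_qFilter.rpow_const (p := a) (Or.inl one_ne_zero)
  rwa [Real.one_rpow] at this

/-- The `q`-binomial limit along a convergent family of arguments. -/
lemma tendsto_qPochC_ratio (S : ℂ) {c : ℝ} (hc : 0 < c) (hc1 : c ≤ 1) {u : ℝ → ℂ} {u₀ : ℂ}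
    (hu : Filter.Tendsto u qFilter (nhds u₀)) (hu₀ : u₀.re < 1)
    (hcone : ∀ᶠ q in qFilter, ∀ r : ℝ, 0 < r → r ≤ 1 → c * (1 + ‖u q‖ * r) ≤ ‖1 - u q * r‖) :
    Filter.Tendsto (fun q : ℝ => qPochC q ((q : ℂ) ^ S * u q) / qPochC q (u q)) qFilter
      (nhds (Complex.exp (-(S * Complex.log (1 - u₀))))) := by
  obtain ⟨C, hC, q₀, hq₀, hq₀0, H⟩ := exists_qPochC_ratio_bound S hc hc1
  have hre : ∀ᶠ q in qFilter, (u q).re < 1 :=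
    ((Complex.continuous_re.tendsto _).comp hu).eventually (gt_mem_nhds hu₀)
  have hE : Filter.Tendsto (fun q => Complex.exp (S * Complex.log (1 - u q))) qFilter
      (nhds (Complex.exp (S * Complex.log (1 - u₀)))) := by
    refine (Complex.continuous_exp.tendsto _).comp (Filter.Tendsto.const_mul S ?_)
    refine (hu.const_sub 1).clog (Or.inl ?_)
    simpa using hu₀
  have h1 : Filter.Tendsto (fun q => qPochC q ((q : ℂ) ^ S * u q) / qPochC q (u q) *
      Complex.exp (S * Complex.log (1 - u q))) qFilter (nhds 1) := by
    rw [tendsto_iff_norm_sub_tendsto_zero]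
    have hz : Filter.Tendsto (fun q : ℝ => Real.exp (C * (1 - q) * Real.log (1 + ‖u q‖)) - 1)
        qFilter (nhds 0) := by
      have hl : Filter.Tendsto (fun q : ℝ => Real.log (1 + ‖u q‖)) qFilter
          (nhds (Real.log (1 + ‖u₀‖))) :=
        (hu.norm.const_add 1).log (by positivity)
      have := ((tendsto_id_qFilter.const_sub 1).const_mul C).mul hl
      have := ((Real.continuous_exp.tendsto _).comp this).sub_const 1
      simpa using this
    refine squeeze_zero' (Filter.Eventually.of_forall fun _ => norm_nonneg _) ?_ hz
    filter_upwards [hre, hcone, eventually_qFilter hq₀ fun q h _ h1 => H q h h1] with q a b h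
    exact h _ a b
  have h2 := h1.div hE (Complex.exp_ne_zero _)
  rw [Complex.exp_neg]
  rw [one_div] at h2
  refine h2.congr fun q => ?_
  simp [Complex.exp_ne_zero]

lemma cone_of_neg_I_mul (y r : ℝ) (hr : 0 < r) :
    1 / 2 * (1 + ‖-Complex.I * (y : ℂ)‖ * r) ≤ ‖1 - -Complex.I * (y : ℂ) * r‖ := by
  have h1 : ‖-Complex.I * (y : ℂ)‖ = |y| := by simp
  rw [h1]
  have a := Complex.abs_re_le_norm (1 - -Complex.I * (y : ℂ) * r)
  have b := Complex.abs_im_le_norm (1 - -Complex.I * (y : ℂ) * r)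
  simp [abs_mul, abs_of_pos hr] at a b
  simp only [neg_mul]
  simp only [sub_neg_eq_add]
  linarith

/-- `|(q^S u; q)_∞ / (u; q)_∞|²` on the imaginary axis, at `u = -i y`. -/
noncomputable def qWeight (q : ℝ) (S : ℂ) (y : ℝ) : ℝ :=
  ‖qPochC q ((q : ℂ) ^ S * (-Complex.I * y)) / qPochC q (-Complex.I * y)‖ ^ 2

lemma tendsto_qWeight (S : ℂ) {y : ℝ → ℝ} {y₀ : ℝ} (hy : Filter.Tendsto y qFilter (nhds y₀)) :
    Filter.Tendsto (fun q => qWeight q S (y q)) qFilter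
      (nhds (‖Complex.exp (-(S * Complex.log (1 + y₀ * Complex.I)))‖ ^ 2)) := by
  have hu : Filter.Tendsto (fun q => -Complex.I * (y q : ℂ)) qFilter
      (nhds (-Complex.I * (y₀ : ℂ))) :=
    ((Complex.continuous_ofReal.tendsto _).comp hy).const_mul _
  have := tendsto_qPochC_ratio S (c := 1 / 2) (by norm_num) (by norm_num) hu (by simp)
    (Filter.Eventually.of_forall fun q r hr _ => cone_of_neg_I_mul _ r hr)
  have h := (this.norm).pow 2
  rwa [show (1 : ℂ) - -Complex.I * y₀ = 1 + y₀ * Complex.I by ring] at h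

lemma exists_qWeight_bound (S : ℂ) {ρ : ℝ} (hρ : ρ < S.re) :
    ∃ C : ℝ, 0 < C ∧ ∀ᶠ q in qFilter, ∀ y : ℝ, qWeight q S y ≤ C * (1 + y ^ 2) ^ (-ρ) := by
  obtain ⟨C, hC, q₀, hq₀, hq₀0, H⟩ :=
    exists_qPochC_ratio_bound S (c := 1 / 2) (by norm_num) (by norm_num)
  refine ⟨Real.exp ((S.re - ρ) * Real.log 2 + 2 * (|S.im| * Real.pi)), Real.exp_pos _, ?_⟩
  have hε : ∀ᶠ q in qFilter, C * (1 - q) ≤ S.re - ρ := by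
    have := (tendsto_id_qFilter.const_sub 1).const_mul C
    simp only [sub_self, mul_zero] at this
    exact (this.eventually (gt_mem_nhds (show 0 < S.re - ρ by linarith))).mono fun q h => h.le
  filter_upwards [hε, eventually_qFilter hq₀ fun q h h0 h1 => And.intro h1 (H q h h1)]
    with q hε ⟨hq1, H⟩ y
  have h := H (-Complex.I * y) (by simp) (fun r hr _ => cone_of_neg_I_mul _ r hr)
  set ε := C * (1 - q) with hεdef
  have hε0 : 0 ≤ ε := mul_nonneg hC (by linarith)
  unfold qWeight
  set R := qPochC q ((q : ℂ) ^ S * (-Complex.I * y)) / qPochC q (-Complex.I * y) with hR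
  have hnorm : ‖-Complex.I * (y : ℂ)‖ = |y| := by simp
  rw [hnorm] at h
  have h2 : ‖R * Complex.exp (S * Complex.log (1 - -Complex.I * y))‖ ≤
      Real.exp (ε * Real.log (1 + |y|)) := by
    have := norm_sub_norm_le (R * Complex.exp (S * Complex.log (1 - -Complex.I * y))) 1
    rw [norm_one] at this
    linarith
  rw [norm_mul, Complex.norm_exp] at h2
  set v : ℂ := 1 - -Complex.I * y with hv
  set Λ := Real.log (1 + y ^ 2) with hΛ
  have hy1 : 0 < 1 + y ^ 2 := by positivity
  have hlogv : (Complex.log v).re = Λ / 2 := by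
    rw [Complex.log_re, hΛ]
    have : ‖v‖ ^ 2 = 1 + y ^ 2 := by
      rw [← Complex.normSq_eq_norm_sq, Complex.normSq_apply, hv]
      simp; ring
    rw [← this, Real.log_pow]; push_cast; ring
  have hΛ0 : 0 ≤ Λ := Real.log_nonneg (by nlinarith)
  have hlog : Real.log (1 + |y|) ≤ (Real.log 2 + Λ) / 2 := by
    have h3 : (1 + |y|) ^ 2 ≤ 2 * (1 + y ^ 2) := by
      nlinarith [sq_nonneg (1 - |y|), sq_abs y]
    have h4 := Real.log_le_log (by positivity) h3
    rw [Real.log_pow, Real.log_mul two_ne_zero hy1.ne'] at h4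
    push_cast at h4
    linarith
  have hre : S.re * (Λ / 2) - |S.im| * Real.pi ≤ (S * Complex.log v).re := by
    rw [Complex.mul_re, hlogv]
    have := Complex.abs_arg_le_pi v
    rw [← Complex.log_im] at this
    have h5 : S.im * (Complex.log v).im ≤ |S.im| * Real.pi := by
      refine (le_abs_self _).trans ?_
      rw [abs_mul]; gcongr
    linarith
  have h6 : ‖R‖ ≤ Real.exp (ε * Real.log (1 + |y|) - (S * Complex.log v).re) := by
    rw [Real.exp_sub, le_div_iff₀ (Real.exp_pos _)]; exact h2
  have h7 : ‖R‖ ^ 2 ≤ Real.exp (2 * (ε * Real.log (1 + |y|) - (S * Complex.log v).re)) := by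
    rw [two_mul, Real.exp_add, ← sq]
    gcongr
  refine h7.trans ?_
  rw [Real.rpow_def_of_pos hy1, ← Real.exp_add, ← hΛ]
  gcongr
  have h8 : ε * Real.log (1 + |y|) ≤ (S.re - ρ) * ((Real.log 2 + Λ) / 2) := by
    have : 0 ≤ Real.log 2 := Real.log_nonneg one_le_two
    calc ε * Real.log (1 + |y|) ≤ ε * ((Real.log 2 + Λ) / 2) := by gcongr
      _ ≤ _ := by gcongr
  linarith

/-- `(q^{1-τ} z; q)_∞ / (q^τ z; q)_∞`. -/
noncomputable def qRatio (q τ z : ℝ) : ℝ :=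
  qPochR q (q ^ (1 - τ) * z) / qPochR q (q ^ τ * z)

lemma cone_of_real {v m : ℝ} (hv : v ≤ m) (hm0 : 0 ≤ m) (hm : m < 1) {r : ℝ} (hr : 0 < r)
    (hr1 : r ≤ 1) :
    (1 - m) / 2 * (1 + ‖(v : ℂ)‖ * r) ≤ ‖1 - (v : ℂ) * r‖ := by
  have h1 : ‖1 - (v : ℂ) * r‖ = |1 - v * r| := by
    rw [← Real.norm_eq_abs, ← Complex.norm_real]
    push_cast
    rfl
  rw [h1, Complex.norm_real, Real.norm_eq_abs]
  rcases le_total v 0 with h | h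
  · rw [abs_of_nonpos h]
    refine le_trans ?_ (le_abs_self _)
    have : 0 ≤ -v * r := by nlinarith
    nlinarith
  · rw [abs_of_nonneg h]
    refine le_trans ?_ (le_abs_self _)
    have h2 : v * r ≤ m := by nlinarith
    have h3 : 0 ≤ v * r := by positivity
    nlinarith

lemma tendsto_qRatio (τ : ℝ) {z : ℝ → ℝ} {z₀ : ℝ} (hz : Filter.Tendsto z qFilter (nhds z₀))
    (hz₀ : z₀ < 1) :
    Filter.Tendsto (fun q => qRatio q τ (z q)) qFilter (nhds ((1 - z₀) ^ (2 * τ - 1))) := by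
  have hu : Filter.Tendsto (fun q => q ^ τ * z q) qFilter (nhds z₀) := by
    simpa using (tendsto_rpow_qFilter τ).mul hz
  set m := (1 + max z₀ 0) / 2 with hm
  have hmax : max z₀ 0 < 1 := max_lt hz₀ one_pos
  have hmax0 : 0 ≤ max z₀ 0 := le_max_right _ _
  have hm0 : 0 ≤ m := by linarith
  have hm1 : m < 1 := by linarith
  have hzm : z₀ < m := by linarith [le_max_left z₀ 0]
  have hlt : ∀ᶠ q in qFilter, q ^ τ * z q < m := hu.eventually (gt_mem_nhds hzm)
  have huc : Filter.Tendsto (fun q => ((q ^ τ * z q : ℝ) : ℂ)) qFilter (nhds (z₀ : ℂ)) :=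
    (Complex.continuous_ofReal.tendsto _).comp hu
  have key := tendsto_qPochC_ratio ((1 - 2 * τ : ℝ) : ℂ) (c := (1 - m) / 2) (by linarith)
    (by linarith) huc (by simpa using hz₀)
    (hlt.mono fun q h r hr hr1 => cone_of_real h.le hm0 hm1 hr hr1)
  have key2 := (Complex.continuous_re.tendsto _).comp key
  have hval : (Complex.exp (-(((1 - 2 * τ : ℝ) : ℂ) * Complex.log (1 - (z₀ : ℂ))))).re =
      (1 - z₀) ^ (2 * τ - 1) := by
    have h1 : 0 < 1 - z₀ := by linarith
    have h2 : Complex.log (1 - (z₀ : ℂ)) = ((Real.log (1 - z₀) : ℝ) : ℂ) := by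
      rw [Complex.ofReal_log h1.le]; push_cast; rfl
    rw [h2, Real.rpow_def_of_pos h1]
    rw [show -(((1 - 2 * τ : ℝ) : ℂ) * ((Real.log (1 - z₀) : ℝ) : ℂ)) =
      ((Real.log (1 - z₀) * (2 * τ - 1) : ℝ) : ℂ) by push_cast; ring]
    rw [← Complex.ofReal_exp, Complex.ofReal_re]
  rw [hval] at key2
  refine key2.congr' ?_
  refine eventually_qFilter zero_lt_one fun q _ h0 h1 => ?_
  simp only [Function.comp_apply, qRatio]
  have h2 : (q : ℂ) ^ (((1 - 2 * τ : ℝ) : ℂ)) * ((q ^ τ * z q : ℝ) : ℂ) =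
      ((q ^ (1 - τ) * z q : ℝ) : ℂ) := by
    rw [← Complex.ofReal_cpow h0.le, ← Complex.ofReal_mul, ← mul_assoc, ← Real.rpow_add h0]
    ring_nf
  rw [h2, ← ofReal_qPochR h0 h1, ← ofReal_qPochR h0 h1, ← Complex.ofReal_div, Complex.ofReal_re]

lemma qPochR_eq_mul {q : ℝ} (h0 : 0 < q) (h1 : q < 1) (u : ℝ) :
    qPochR q u = (1 - u) * qPochR q (q * u) := by
  refine tendsto_nhds_unique ((Filter.tendsto_add_atTop_iff_nat 1).2 (tendsto_prod_qPochR h0 h1 u))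
    (((tendsto_prod_qPochR h0 h1 (q * u)).const_mul (1 - u)).congr fun M => ?_)
  rw [Finset.prod_range_succ', mul_comm]
  simp only [pow_zero, mul_one, pow_succ]
  congr 1
  exact Finset.prod_congr rfl fun n _ => by ring

lemma one_sub_mul_pow_nonneg {q u : ℝ} (h0 : 0 < q) (h1 : q < 1) (hu : u ≤ 1) (n : ℕ) :
    0 ≤ 1 - u * q ^ n := by
  have a := pow_pos h0 n
  have b := pow_le_one₀ (n := n) h0.le h1.le
  nlinarith

lemma qPochR_nonneg {q u : ℝ} (h0 : 0 < q) (h1 : q < 1) (hu : u ≤ 1) : 0 ≤ qPochR q u :=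
  ge_of_tendsto' (tendsto_prod_qPochR h0 h1 u) fun _ =>
    Finset.prod_nonneg fun n _ => one_sub_mul_pow_nonneg h0 h1 hu n

lemma qPochR_pos {q u : ℝ} (h0 : 0 < q) (h1 : q < 1) (hu : u < 1) : 0 < qPochR q u := by
  refine (qPochR_nonneg h0 h1 hu.le).lt_of_ne' fun h => ?_
  have := qPochC_ne_zero h0 h1 (u := (u : ℂ)) (by simpa using hu)
  rw [← ofReal_qPochR h0 h1, h] at this
  simp at this

lemma qPochR_anti {q u v : ℝ} (h0 : 0 < q) (h1 : q < 1) (huv : u ≤ v) (hv : v ≤ 1) :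
    qPochR q v ≤ qPochR q u := by
  refine le_of_tendsto_of_tendsto' (tendsto_prod_qPochR h0 h1 v) (tendsto_prod_qPochR h0 h1 u)
    fun M => Finset.prod_le_prod (fun n _ => one_sub_mul_pow_nonneg h0 h1 hv n) fun n _ => ?_
  have := pow_pos h0 n
  nlinarith

lemma one_sub_mul_qRatio_of_pos {q τ z : ℝ} (h0 : 0 < q) (h1 : q < 1) (hτ : 0 < τ)
    (hz0 : 0 < z) (hz : z ≤ q ^ τ) : |(1 - z) * qRatio q τ z| ≤ 1 := by
  have hqτ : 0 < q ^ τ := Real.rpow_pos_of_pos h0 _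
  have hqτ1 : q ^ τ < 1 := Real.rpow_lt_one h0.le h1 hτ
  have ha : q ^ (1 - τ) * z ≤ q := by
    calc q ^ (1 - τ) * z ≤ q ^ (1 - τ) * q ^ τ := by gcongr
      _ = q := by rw [← Real.rpow_add h0]; simp
  have hb : q * (q ^ τ * z) ≤ q ^ (1 - τ) * z := by
    rw [← mul_assoc]
    gcongr
    calc q * q ^ τ = q ^ (1 + τ) := by rw [Real.rpow_add h0, Real.rpow_one]
      _ ≤ q ^ (1 - τ) := Real.rpow_le_rpow_of_exponent_ge h0 h1.le (by linarith)
  have hc := qPochR_anti h0 h1 hb (ha.trans h1.le)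
  have hd := qPochR_nonneg h0 h1 (ha.trans h1.le)
  have he := qPochR_pos h0 h1 (hb.trans_lt (ha.trans_lt h1))
  have hf : q ^ τ * z < 1 := by nlinarith
  unfold qRatio
  rw [qPochR_eq_mul h0 h1 (q ^ τ * z), abs_of_nonneg, ← mul_div_assoc, div_le_one]
  · have : 1 - z ≤ 1 - q ^ τ * z := by nlinarith
    exact mul_le_mul this hc hd (by linarith)
  · exact mul_pos (by linarith) he
  · exact mul_nonneg (by linarith) (div_nonneg hd (mul_pos (by linarith) he).le)

/-- Log-convexity of `x ↦ 1 + v e^x`. -/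
lemma one_add_div_le_rpow {q v a : ℝ} (h0 : 0 < q) (hv : 0 ≤ v) (ha : 0 < a) :
    (1 + v) / (1 + q ^ a * v) ≤ ((1 + v / q) / (1 + v)) ^ a := by
  have hqa : 0 < q ^ a := Real.rpow_pos_of_pos h0 _
  set A := v / q with hA
  set B := q ^ a * v with hB
  have hA0 : 0 ≤ A := by positivity
  have hB0 : 0 ≤ B := by positivity
  have ha1 : 0 < a + 1 := by linarith
  set θ := a / (a + 1) with hθ
  set η := 1 / (a + 1) with hη
  have hθη : θ + η = 1 := by rw [hθ, hη]; field_simp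
  have hθ0 : 0 ≤ θ := by positivity
  have hη0 : 0 ≤ η := by positivity
  have g1 := Real.geom_mean_le_arith_mean2_weighted hθ0 hη0
    (by positivity : 0 ≤ 1 / (1 + A)) (by positivity : 0 ≤ 1 / (1 + B)) hθη
  have g2 := Real.geom_mean_le_arith_mean2_weighted hθ0 hη0
    (by positivity : 0 ≤ A / (1 + A)) (by positivity : 0 ≤ B / (1 + B)) hθη
  have hsum : θ * (1 / (1 + A)) + η * (1 / (1 + B)) + (θ * (A / (1 + A)) + η * (B / (1 + B))) = 1 := by
    rw [← hθη]; field_simp; ring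
  have hAB : A ^ θ * B ^ η = v := by
    rw [hA, hB, Real.div_rpow hv h0.le, Real.mul_rpow hqa.le hv, ← Real.rpow_mul h0.le]
    have : a * η = θ := by rw [hη, hθ]; ring
    rw [this]
    have hq : 0 < q ^ θ := Real.rpow_pos_of_pos h0 _
    field_simp
    rcases hv.eq_or_lt with h | h
    · rw [← h, Real.zero_rpow (by positivity)]; simp
    · rw [← Real.rpow_add h, hθη, Real.rpow_one]
  have hD : 0 < (1 + A) ^ θ * (1 + B) ^ η := by positivity
  have hmain : 1 + v ≤ (1 + A) ^ θ * (1 + B) ^ η := by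
    rw [Real.div_rpow (by positivity) (by positivity), Real.div_rpow (by positivity) (by positivity),
      Real.one_rpow, Real.one_rpow] at g1
    rw [Real.div_rpow hA0 (by positivity), Real.div_rpow hB0 (by positivity)] at g2
    have : (1 + v) / ((1 + A) ^ θ * (1 + B) ^ η) ≤ 1 := by
      refine le_trans ?_ hsum.le
      refine le_trans (le_of_eq ?_) (add_le_add g1 g2)
      rw [add_div]
      nth_rewrite 1 [← hAB]
      field_simp
    rwa [div_le_one hD] at this
  have hpow : (1 + v) ^ (a + 1) ≤ (1 + A) ^ a * (1 + B) := by
    calc (1 + v) ^ (a + 1) ≤ ((1 + A) ^ θ * (1 + B) ^ η) ^ (a + 1) := by gcongr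
      _ = (1 + A) ^ a * (1 + B) := by
        rw [Real.mul_rpow (by positivity) (by positivity), ← Real.rpow_mul (by positivity),
          ← Real.rpow_mul (by positivity)]
        have e1 : θ * (a + 1) = a := by rw [hθ]; field_simp
        have e2 : η * (a + 1) = 1 := by rw [hη]; field_simp
        rw [e1, e2, Real.rpow_one]
  rw [Real.div_rpow (by positivity) (by positivity), div_le_div_iff₀ (by positivity) (by positivity)]
  rw [Real.rpow_add (by positivity), Real.rpow_one] at hpow
  linarith

lemma qPochR_ratio_neg_le {q v a : ℝ} (h0 : 0 < q) (h1 : q < 1) (hv : 0 ≤ v) (ha : 0 < a) :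
    qPochR q (-v) / qPochR q (-(q ^ a * v)) ≤ (1 + v / q) ^ a := by
  have hqa : 0 < q ^ a := Real.rpow_pos_of_pos h0 _
  have hpos : 0 < qPochR q (-(q ^ a * v)) :=
    qPochR_pos h0 h1 (by have : 0 ≤ q ^ a * v := by positivity
                         linarith)
  refine le_of_tendsto' ((tendsto_prod_qPochR h0 h1 (-v)).div
    (tendsto_prod_qPochR h0 h1 (-(q ^ a * v))) hpos.ne') fun M => ?_
  rw [Pi.div_apply, ← Finset.prod_div_distrib]
  have hterm : ∀ n : ℕ, (1 - -v * q ^ n) / (1 - -(q ^ a * v) * q ^ n) ≤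
      ((1 + v * q ^ n / q) / (1 + v * q ^ n)) ^ a := fun n => by
    have hn := pow_pos h0 n
    refine le_trans (le_of_eq ?_) (one_add_div_le_rpow (v := v * q ^ n) h0 (by positivity) ha)
    congr 1 <;> ring
  refine (Finset.prod_le_prod (fun n _ => ?_) fun n _ => hterm n).trans ?_
  · have hn := pow_pos h0 n
    rw [neg_mul, neg_mul, sub_neg_eq_add, sub_neg_eq_add]; positivity
  · rw [Real.finsetProd_rpow _ _ fun n _ => by have hn := pow_pos h0 n; positivity]
    have htel : ∏ n ∈ Finset.range M, ((1 + v * q ^ n / q) / (1 + v * q ^ n)) =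
        (1 + v / q) / (1 + v * q ^ M / q) := by
      induction M with
      | zero => simp; rw [div_self]; positivity
      | succ M ih =>
        have hn := pow_pos h0 M
        rw [Finset.prod_range_succ, ih, pow_succ]
        field_simp
    rw [htel]
    have hn := pow_pos h0 M
    gcongr
    refine div_le_self (by positivity) ?_
    have : 0 ≤ v * q ^ M / q := by positivity
    linarith

lemma one_sub_mul_qRatio_of_neg {q τ z : ℝ} (h0 : 0 < q) (h1 : q < 1) (hτ : 0 < τ)
    (hz : z ≤ 0) :
    |(1 - z) * qRatio q τ z| ≤ q ^ (-τ) * (1 + q ^ (-τ) * (-z)) ^ (2 * τ) := by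
  have hqτ : 0 < q ^ τ := Real.rpow_pos_of_pos h0 _
  have hqτ1 : q ^ τ < 1 := Real.rpow_lt_one h0.le h1 hτ
  have hqτ' : 0 < q ^ (1 - τ) := Real.rpow_pos_of_pos h0 _
  set v := q ^ (1 - τ) * (-z) with hv
  have hv0 : 0 ≤ v := mul_nonneg hqτ'.le (by linarith)
  have key := qPochR_ratio_neg_le h0 h1 hv0 (show 0 < 2 * τ by linarith)
  have e1 : -v = q ^ (1 - τ) * z := by rw [hv]; ring
  have e2 : -(q ^ (2 * τ) * v) = q * (q ^ τ * z) := by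
    rw [hv, ← mul_assoc, ← mul_assoc, ← Real.rpow_add h0,
      show 2 * τ + (1 - τ) = 1 + τ by ring, Real.rpow_add h0, Real.rpow_one]; ring
  have e3 : v / q = q ^ (-τ) * (-z) := by
    rw [hv, show 1 - τ = -τ + 1 by ring, Real.rpow_add h0, Real.rpow_one]; field_simp
  rw [e1, e2, e3] at key
  have hn1 := qPochR_nonneg h0 h1 (u := q ^ (1 - τ) * z) (by nlinarith)
  have hn2 := qPochR_pos h0 h1 (u := q * (q ^ τ * z))
    (by have : 0 ≤ q * (q ^ τ * -z) := mul_nonneg h0.le (mul_nonneg hqτ.le (by linarith))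
        linarith)
  have hd : 0 < 1 - q ^ τ * z := by nlinarith
  have h2 : (1 - z) / (1 - q ^ τ * z) ≤ q ^ (-τ) := by
    rw [div_le_iff₀ hd, Real.rpow_neg h0.le, mul_sub, ← mul_assoc, inv_mul_cancel₀ hqτ.ne']
    have : 1 ≤ (q ^ τ)⁻¹ := (one_le_inv₀ hqτ).2 hqτ1.le
    linarith
  have hsplit : (1 - z) * qRatio q τ z = (1 - z) / (1 - q ^ τ * z) *
      (qPochR q (q ^ (1 - τ) * z) / qPochR q (q * (q ^ τ * z))) := by
    unfold qRatio
    rw [qPochR_eq_mul h0 h1 (q ^ τ * z)]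
    field_simp
  rw [hsplit, abs_of_nonneg (mul_nonneg (div_nonneg (by linarith) hd.le) (div_nonneg hn1 hn2.le))]
  exact mul_le_mul h2 key (div_nonneg hn1 hn2.le) (Real.rpow_nonneg h0.le _)

/-- The interaction of two particles `y < x`. -/
noncomputable def qKer (q t x y : ℝ) : ℝ :=
  (x - y) *
  (if 0 < x then
    x ^ (2 * Real.logb q t - 1) * qPochR q (q * t⁻¹ * y * x⁻¹) / qPochR q (t * y * x⁻¹) else 1) *
  (if x < 0 then
    |y| ^ (2 * Real.logb q t - 1) * qPochR q (q * t⁻¹ * x * y⁻¹) / qPochR q (t * x * y⁻¹) else 1)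

lemma logb_rpow_self {q : ℝ} (h0 : 0 < q) (h1 : q < 1) (τ : ℝ) : Real.logb q (q ^ τ) = τ :=
  Real.logb_rpow h0 h1.ne

lemma mul_inv_rpow_self {q : ℝ} (h0 : 0 < q) (τ : ℝ) : q * (q ^ τ)⁻¹ = q ^ (1 - τ) := by
  rw [Real.rpow_sub h0, Real.rpow_one, div_eq_mul_inv]

lemma qKer_of_pos {q τ x y : ℝ} (h0 : 0 < q) (h1 : q < 1) (hx : 0 < x) :
    qKer q (q ^ τ) x y = x ^ (2 * τ) * ((1 - y / x) * qRatio q τ (y / x)) := by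
  unfold qKer qRatio
  rw [if_pos hx, if_neg hx.not_gt, logb_rpow_self h0 h1, mul_inv_rpow_self h0, mul_one,
    mul_assoc (q ^ (1 - τ)), mul_assoc (q ^ τ), ← div_eq_mul_inv y x, Real.rpow_sub_one hx.ne']
  field_simp

lemma qKer_of_neg {q τ x y : ℝ} (h0 : 0 < q) (h1 : q < 1) (hx : x < 0) (hy : y < 0) :
    qKer q (q ^ τ) x y = (-y) ^ (2 * τ) * ((1 - x / y) * qRatio q τ (x / y)) := by
  unfold qKer qRatio
  rw [if_neg hx.not_gt, if_pos hx, logb_rpow_self h0 h1, mul_inv_rpow_self h0, mul_one,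
    mul_assoc (q ^ (1 - τ)), mul_assoc (q ^ τ), ← div_eq_mul_inv x y, abs_of_neg hy,
    Real.rpow_sub_one (by linarith)]
  have := hy.ne
  field_simp
  ring

lemma tendsto_qKer {τ : ℝ} {x y : ℝ → ℝ} {x₀ y₀ : ℝ} (hx : Filter.Tendsto x qFilter (nhds x₀))
    (hy : Filter.Tendsto y qFilter (nhds y₀)) (hx₀ : x₀ ≠ 0) (hxy : y₀ < x₀) (hτ : 0 < τ) :
    Filter.Tendsto (fun q => qKer q (q ^ τ) (x q) (y q)) qFilter
      (nhds ((x₀ - y₀) ^ (2 * τ))) := by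
  rcases lt_or_gt_of_ne hx₀ with h | h
  · have hy₀ : y₀ < 0 := hxy.trans h
    have hz : x₀ / y₀ < 1 := by rw [div_lt_one_of_neg hy₀]; exact hxy
    have e1 := hx.div hy hy₀.ne
    have e2 := (hy.neg.rpow_const (p := 2 * τ) (Or.inr (by linarith))).mul
      ((e1.const_sub 1).mul (tendsto_qRatio τ e1 hz))
    have hval : (-y₀) ^ (2 * τ) * ((1 - x₀ / y₀) * (1 - x₀ / y₀) ^ (2 * τ - 1)) =
        (x₀ - y₀) ^ (2 * τ) := by
      have h1 : 0 < 1 - x₀ / y₀ := by linarith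
      rw [Real.rpow_sub_one h1.ne', mul_div_cancel₀ _ h1.ne', ← Real.mul_rpow (by linarith) h1.le]
      congr 1
      have := hy₀.ne
      field_simp
      ring
    rw [hval] at e2
    refine e2.congr' ?_
    filter_upwards [hx.eventually (gt_mem_nhds h), hy.eventually (gt_mem_nhds hy₀),
      eventually_qFilter zero_lt_one fun q _ h0 h1 => And.intro h0 h1] with q a b c
    exact (qKer_of_neg c.1 c.2 a b).symm
  · have hz : y₀ / x₀ < 1 := by rwa [div_lt_one h]
    have e1 := hy.div hx h.ne'
    have e2 := (hx.rpow_const (p := 2 * τ) (Or.inr (by linarith))).mul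
      ((e1.const_sub 1).mul (tendsto_qRatio τ e1 hz))
    have hval : x₀ ^ (2 * τ) * ((1 - y₀ / x₀) * (1 - y₀ / x₀) ^ (2 * τ - 1)) =
        (x₀ - y₀) ^ (2 * τ) := by
      have h1 : 0 < 1 - y₀ / x₀ := by linarith
      rw [Real.rpow_sub_one h1.ne', mul_div_cancel₀ _ h1.ne', ← Real.mul_rpow h.le h1.le]
      congr 1
      field_simp
    rw [hval] at e2
    refine e2.congr' ?_
    filter_upwards [hx.eventually (lt_mem_nhds h),
      eventually_qFilter zero_lt_one fun q _ h0 h1 => And.intro h0 h1] with q a c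
    exact (qKer_of_pos c.1 c.2 a).symm

lemma exists_qKer_bound {τ : ℝ} (hτ : 0 < τ) :
    ∃ C : ℝ, 1 ≤ C ∧ ∀ᶠ q in qFilter, ∀ x y : ℝ, x ≠ 0 → y < x → (0 < y → y ≤ x * q ^ τ) →
      (x < 0 → -x ≤ -y * q ^ τ) →
      |qKer q (q ^ τ) x y| ≤ C * ((1 + x ^ 2) ^ τ * (1 + y ^ 2) ^ τ) := by
  have hT : Filter.Tendsto (fun q : ℝ => q ^ (-τ)) qFilter (nhds 1) := tendsto_rpow_qFilter _
  refine ⟨2 * (8 : ℝ) ^ τ, ?_, ?_⟩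
  · have : (1 : ℝ) ≤ 8 ^ τ := Real.one_le_rpow (by norm_num) hτ.le
    linarith
  have hsq : ∀ w : ℝ, 0 ≤ w → w ^ (2 * τ) ≤ (1 + w ^ 2) ^ τ := fun w hw => by
    rw [Real.rpow_mul hw, Real.rpow_two]
    gcongr
    linarith
  have hC : (1 : ℝ) ≤ 2 * (8 : ℝ) ^ τ := by
    have : (1 : ℝ) ≤ 8 ^ τ := Real.one_le_rpow (by norm_num) hτ.le
    linarith
  have hge : ∀ w : ℝ, (1 : ℝ) ≤ (1 + w ^ 2) ^ τ := fun w =>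
    Real.one_le_rpow (by nlinarith [sq_nonneg w]) hτ.le
  filter_upwards [hT.eventually (gt_mem_nhds (show (1 : ℝ) < 2 by norm_num)),
    eventually_qFilter zero_lt_one fun q _ h0 h1 => And.intro h0 h1] with q hq2 ⟨h0, h1⟩ x y hx
    hxy hpos hneg
  have ax := hge x
  have ay := hge y
  rcases lt_or_gt_of_ne hx with h | h
  · have hy : y < 0 := hxy.trans h
    rw [qKer_of_neg h0 h1 h hy, abs_mul, abs_of_nonneg (Real.rpow_nonneg (by linarith) _)]
    have hz : x / y ≤ q ^ τ := by
      rw [div_le_iff_of_neg hy]; linarith [hneg h]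
    have h2 := one_sub_mul_qRatio_of_pos h0 h1 hτ (div_pos_of_neg_of_neg h hy) hz
    have h3 := hsq (-y) (by linarith)
    rw [neg_sq] at h3
    calc (-y) ^ (2 * τ) * |(1 - x / y) * qRatio q τ (x / y)| ≤ (1 + y ^ 2) ^ τ * 1 := by gcongr
      _ ≤ 1 * ((1 + x ^ 2) ^ τ * (1 + y ^ 2) ^ τ) := by nlinarith
      _ ≤ _ := by gcongr
  · rw [qKer_of_pos h0 h1 h, abs_mul, abs_of_nonneg (Real.rpow_nonneg h.le _)]
    rcases le_or_gt y 0 with hy | hy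
    · have h2 := one_sub_mul_qRatio_of_neg h0 h1 hτ (div_nonpos_of_nonpos_of_nonneg hy h.le)
      have hq1 : 0 < q ^ (-τ) := Real.rpow_pos_of_pos h0 _
      have hyx : 0 ≤ -(y / x) := by
        rw [← neg_div]; exact div_nonneg (by linarith) h.le
      have h3 : x ^ (2 * τ) * (1 + q ^ (-τ) * -(y / x)) ^ (2 * τ) ≤
          (8 : ℝ) ^ τ * ((1 + x ^ 2) ^ τ * (1 + y ^ 2) ^ τ) := by
        rw [← Real.mul_rpow h.le (by positivity), ← Real.mul_rpow (by positivity) (by positivity),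
          ← Real.mul_rpow (by positivity) (by positivity), Real.rpow_mul (by positivity),
          Real.rpow_two]
        gcongr
        have e : x * (1 + q ^ (-τ) * -(y / x)) = x + q ^ (-τ) * (-y) := by field_simp
        rw [e]
        have h4 : x + q ^ (-τ) * (-y) ≤ x + 2 * (-y) := by nlinarith
        have h5 : 0 ≤ x + q ^ (-τ) * (-y) := by nlinarith
        calc (x + q ^ (-τ) * (-y)) ^ 2 ≤ (x + 2 * (-y)) ^ 2 := by gcongr
          _ ≤ 8 * ((1 + x ^ 2) * (1 + y ^ 2)) := by
            nlinarith [sq_nonneg (x + 2 * y), sq_nonneg (x * y)]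
      calc x ^ (2 * τ) * |(1 - y / x) * qRatio q τ (y / x)|
          ≤ x ^ (2 * τ) * (q ^ (-τ) * (1 + q ^ (-τ) * -(y / x)) ^ (2 * τ)) := by gcongr
        _ = q ^ (-τ) * (x ^ (2 * τ) * (1 + q ^ (-τ) * -(y / x)) ^ (2 * τ)) := by ring
        _ ≤ 2 * ((8 : ℝ) ^ τ * ((1 + x ^ 2) ^ τ * (1 + y ^ 2) ^ τ)) := by gcongr
        _ = _ := by ring
    · have hz : y / x ≤ q ^ τ := by
        rw [div_le_iff₀ h]; linarith [hpos hy]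
      have h2 := one_sub_mul_qRatio_of_pos h0 h1 hτ (div_pos hy h) hz
      have h3 := hsq x h.le
      calc x ^ (2 * τ) * |(1 - y / x) * qRatio q τ (y / x)| ≤ (1 + x ^ 2) ^ τ * 1 := by gcongr
        _ ≤ 1 * ((1 + x ^ 2) ^ τ * (1 + y ^ 2) ^ τ) := by nlinarith
        _ ≤ _ := by gcongr

lemma psiQ_eq {q τ u : ℝ} (h0 : 0 < q) (h1 : q < 1) :
    psiQ q (q ^ τ) u = (-u) ^ (2 * τ - 1) * (qRatio q τ u⁻¹ / qRatio q τ u) := by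
  have hq : 0 < q ^ τ := Real.rpow_pos_of_pos h0 _
  unfold psiQ thetaQ qRatio
  rw [logb_rpow_self h0 h1, ← mul_inv_rpow_self h0, mul_inv, mul_inv, inv_inv, ← mul_assoc,
    ← mul_assoc q]
  rw [div_div_div_eq, ← mul_assoc q]
  ring

lemma tendsto_psiQ {τ : ℝ} {u : ℝ → ℝ} {u₀ : ℝ} (hu : Filter.Tendsto u qFilter (nhds u₀))
    (hu₀ : u₀ < 0) : Filter.Tendsto (fun q => psiQ q (q ^ τ) (u q)) qFilter (nhds 1) := by
  have h1 : 0 < 1 - u₀ := by linarith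
  have hinv : u₀⁻¹ < 0 := inv_lt_zero.2 hu₀
  have e := (hu.neg.rpow_const (p := 2 * τ - 1) (Or.inl (by linarith))).mul
    ((tendsto_qRatio τ (hu.inv₀ hu₀.ne) (by linarith)).div
      (tendsto_qRatio τ hu (by linarith)) (Real.rpow_pos_of_pos h1 _).ne')
  have hval : (-u₀) ^ (2 * τ - 1) * ((1 - u₀⁻¹) ^ (2 * τ - 1) / (1 - u₀) ^ (2 * τ - 1)) = 1 := by
    rw [← Real.div_rpow (by linarith) h1.le, ← Real.mul_rpow (by linarith)
      (div_nonneg (by linarith) h1.le)]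
    have : -u₀ * ((1 - u₀⁻¹) / (1 - u₀)) = 1 := by
      have := hu₀.ne
      field_simp
      ring
    rw [this, Real.one_rpow]
  rw [hval] at e
  refine e.congr' (eventually_qFilter zero_lt_one fun q _ h0 h1 => (psiQ_eq h0 h1).symm)

lemma tendsto_CNconst {τ ζp ζm : ℝ} (hζp : 0 < ζp) (hζm : ζm < 0) (N k : ℕ) :
    Filter.Tendsto (fun q => CNconst q (q ^ τ) ζp ζm N k) qFilter (nhds 1) := by
  have key : Filter.Tendsto (fun q => CNconst q (q ^ τ) ζp ζm N k) qFilter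
      (nhds (∏ _i ∈ Finset.Icc 1 N, ∏ _j ∈ Finset.Icc 1 N, (1 : ℝ))) := by
    refine tendsto_finsetProd _ fun i _ => tendsto_finsetProd _ fun j _ => ?_
    split_ifs
    · refine tendsto_psiQ (u₀ := ζm * ζp⁻¹) ?_ (mul_neg_of_neg_of_pos hζm (inv_pos.2 hζp))
      have := ((tendsto_rpow_qFilter τ).zpow₀ ((N : ℤ) - i - j + 1) (Or.inl one_ne_zero)).const_mul
        (ζm * ζp⁻¹)
      simpa using this
    · exact tendsto_const_nhds
  simpa using key

/-- The point of the lattice through which the `i`-th largest particle moves, when `k` of the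
`N` particles are positive. -/
noncomputable def latticeBase (ζp ζm t : ℝ) {N : ℕ} (k : ℕ) (i : Fin N) : ℝ :=
  if (i : ℕ) < k then ζp * t ^ (i : ℕ) else ζm * t ^ (N - 1 - (i : ℕ))

/-- The positions of the particles with lattice coordinates `n`. -/
noncomputable def latticePt (q t ζp ζm : ℝ) {N : ℕ} (k : ℕ) (n : Fin N → ℤ) (i : Fin N) : ℝ :=
  latticeBase ζp ζm t k i * q ^ n i

/-- The lattice coordinates of configurations with `k` positive particles. -/
def Admissible {N : ℕ} (k : ℕ) (n : Fin N → ℤ) : Prop :=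
  ∀ i j : Fin N, i < j → ((j : ℕ) < k → n i ≤ n j) ∧ (k ≤ (i : ℕ) → n j ≤ n i)

section Lattice

variable {q t ζp ζm : ℝ} {N k : ℕ}

lemma latticeBase_pos (hζp : 0 < ζp) (ht : 0 < t) {i : Fin N} (hi : (i : ℕ) < k) :
    0 < latticeBase ζp ζm t k i := by
  rw [latticeBase, if_pos hi]; positivity

lemma latticeBase_neg (hζm : ζm < 0) (ht : 0 < t) {i : Fin N} (hi : k ≤ (i : ℕ)) :
    latticeBase ζp ζm t k i < 0 := by
  rw [latticeBase, if_neg (not_lt.2 hi)]; exact mul_neg_of_neg_of_pos hζm (by positivity)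

lemma latticeBase_ne_zero (hζp : 0 < ζp) (hζm : ζm < 0) (ht : 0 < t) (i : Fin N) :
    latticeBase ζp ζm t k i ≠ 0 := by
  rcases lt_or_ge (i : ℕ) k with h | h
  · exact (latticeBase_pos hζp ht h).ne'
  · exact (latticeBase_neg hζm ht h).ne

lemma latticePt_pos_iff (hζp : 0 < ζp) (hζm : ζm < 0) (hq : 0 < q) (ht : 0 < t)
    {n : Fin N → ℤ} {i : Fin N} : 0 < latticePt q t ζp ζm k n i ↔ (i : ℕ) < k := by
  have h := zpow_pos hq (n i)
  rcases lt_or_ge (i : ℕ) k with hi | hi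
  · exact iff_of_true (mul_pos (latticeBase_pos hζp ht hi) h) hi
  · exact iff_of_false (not_lt.2 (mul_neg_of_neg_of_pos (latticeBase_neg hζm ht hi) h).le)
      (not_lt.2 hi)

lemma latticePt_neg (hζm : ζm < 0) (hq : 0 < q) (ht : 0 < t)
    {n : Fin N → ℤ} {i : Fin N} (hi : k ≤ (i : ℕ)) : latticePt q t ζp ζm k n i < 0 :=
  mul_neg_of_neg_of_pos (latticeBase_neg hζm ht hi) (zpow_pos hq _)

lemma latticePt_ne_zero (hζp : 0 < ζp) (hζm : ζm < 0) (hq : 0 < q) (ht : 0 < t)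
    (n : Fin N → ℤ) (i : Fin N) : latticePt q t ζp ζm k n i ≠ 0 :=
  mul_ne_zero (latticeBase_ne_zero hζp hζm ht i) (ne_of_gt (zpow_pos hq _))

/-- Consecutive positive particles are separated by at least a factor `t`. -/
lemma latticePt_pos_eq (hq : 0 < q) {n : Fin N → ℤ} {i j : Fin N} (hij : i < j)
    (hj : (j : ℕ) < k) (hn : n i ≤ n j) :
    ∃ m : ℕ, latticePt q t ζp ζm k n j =
      latticePt q t ζp ζm k n i * t ^ ((j : ℕ) - i) * q ^ m := by
  obtain ⟨m, hm⟩ := Int.le.dest hn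
  refine ⟨m, ?_⟩
  have hi : (i : ℕ) < k := lt_trans hij hj
  have e : t ^ (j : ℕ) = t ^ (i : ℕ) * t ^ ((j : ℕ) - i) := by
    rw [← pow_add]; congr 1; have : (i : ℕ) < j := hij; omega
  rw [latticePt, latticePt, latticeBase, latticeBase, if_pos hi, if_pos hj, ← hm,
    zpow_add₀ hq.ne', zpow_natCast, e]
  ring

lemma latticePt_neg_eq (hq : 0 < q) {n : Fin N → ℤ} {i j : Fin N} (hij : i < j)
    (hi : k ≤ (i : ℕ)) (hn : n j ≤ n i) :
    ∃ m : ℕ, latticePt q t ζp ζm k n i =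
      latticePt q t ζp ζm k n j * t ^ ((j : ℕ) - i) * q ^ m := by
  obtain ⟨m, hm⟩ := Int.le.dest hn
  refine ⟨m, ?_⟩
  have hij' : (i : ℕ) < j := hij
  have hj : k ≤ (j : ℕ) := by omega
  have e : t ^ (N - 1 - (i : ℕ)) = t ^ (N - 1 - (j : ℕ)) * t ^ ((j : ℕ) - i) := by
    rw [← pow_add]; congr 1; omega
  rw [latticePt, latticePt, latticeBase, latticeBase, if_neg (not_lt.2 hi), if_neg (not_lt.2 hj),
    ← hm, zpow_add₀ hq.ne', zpow_natCast, e]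
  ring

lemma latticePt_le_mul (hζp : 0 < ζp) (hζm : ζm < 0) (h0 : 0 < q) (h1 : q < 1) (ht : 0 < t)
    (ht1 : t < 1) {n : Fin N → ℤ} (hn : Admissible k n) {i j : Fin N} (hij : i < j)
    (hj : (j : ℕ) < k) : latticePt q t ζp ζm k n j ≤ latticePt q t ζp ζm k n i * t := by
  have hij' : (i : ℕ) < j := hij
  obtain ⟨m, hm⟩ := latticePt_pos_eq (t := t) (ζp := ζp) (ζm := ζm) h0 hij hj ((hn i j hij).1 hj)
  have hp : 0 < latticePt q t ζp ζm k n i :=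
    (latticePt_pos_iff hζp hζm h0 ht).2 (lt_trans hij' hj)
  rw [hm, mul_assoc]
  refine mul_le_mul_of_nonneg_left ?_ hp.le
  calc t ^ ((j : ℕ) - i) * q ^ m ≤ t ^ 1 * 1 :=
        mul_le_mul (pow_le_pow_of_le_one ht.le ht1.le (by omega)) (pow_le_one₀ h0.le h1.le)
          (by positivity) (by positivity)
    _ = t := by ring

lemma neg_latticePt_le_mul (hζm : ζm < 0) (h0 : 0 < q) (h1 : q < 1) (ht : 0 < t)
    (ht1 : t < 1) {n : Fin N → ℤ} (hn : Admissible k n) {i j : Fin N} (hij : i < j)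
    (hi : k ≤ (i : ℕ)) : -latticePt q t ζp ζm k n i ≤ -latticePt q t ζp ζm k n j * t := by
  have hij' : (i : ℕ) < j := hij
  obtain ⟨m, hm⟩ := latticePt_neg_eq (t := t) (ζp := ζp) (ζm := ζm) h0 hij hi ((hn i j hij).2 hi)
  have hp : 0 < -latticePt q t ζp ζm k n j := by
    have := latticePt_neg (q := q) (ζp := ζp) (n := n) hζm h0 ht (hi.trans hij'.le)
    linarith
  rw [hm, mul_assoc, ← neg_mul]
  refine mul_le_mul_of_nonneg_left ?_ hp.le
  calc t ^ ((j : ℕ) - i) * q ^ m ≤ t ^ 1 * 1 :=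
        mul_le_mul (pow_le_pow_of_le_one ht.le ht1.le (by omega)) (pow_le_one₀ h0.le h1.le)
          (by positivity) (by positivity)
    _ = t := by ring

lemma latticePt_strictAnti (hζp : 0 < ζp) (hζm : ζm < 0) (h0 : 0 < q) (h1 : q < 1) (ht : 0 < t)
    (ht1 : t < 1) {n : Fin N → ℤ} (hn : Admissible k n) :
    StrictAnti (latticePt q t ζp ζm k n) := by
  intro i j hij
  have hij' : (i : ℕ) < j := hij
  rcases lt_or_ge (j : ℕ) k with hj | hj
  · have h := latticePt_le_mul hζp hζm h0 h1 ht ht1 hn hij hj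
    have hp : 0 < latticePt q t ζp ζm k n i :=
      (latticePt_pos_iff hζp hζm h0 ht).2 (lt_trans hij' hj)
    nlinarith
  · have hnj := latticePt_neg (q := q) (ζp := ζp) (n := n) hζm h0 ht hj
    rcases lt_or_ge (i : ℕ) k with hi | hi
    · exact hnj.trans ((latticePt_pos_iff hζp hζm h0 ht).2 hi)
    · have h := neg_latticePt_le_mul (ζp := ζp) hζm h0 h1 ht ht1 hn hij hi
      nlinarith

/-- The configuration with lattice coordinates `n`. -/
noncomputable def latticeConfig (q t ζp ζm : ℝ) {N : ℕ} (k : ℕ) (n : Fin N → ℤ) : Finset ℝ :=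
  Finset.univ.image (latticePt q t ζp ζm k n)

lemma latticeConfig_mem_OmegaN (hζp : 0 < ζp) (hζm : ζm < 0) (h0 : 0 < q) (h1 : q < 1)
    (ht : 0 < t) (ht1 : t < 1) {n : Fin N → ℤ} (hn : Admissible k n) :
    latticeConfig q t ζp ζm k n ∈ OmegaN q t ζp ζm N := by
  have hanti := latticePt_strictAnti hζp hζm h0 h1 ht ht1 hn
  have hmem : ∀ x, x ∈ ((latticeConfig q t ζp ζm k n : Finset ℝ) : Set ℝ) ↔
      ∃ i, latticePt q t ζp ζm k n i = x := by simp [latticeConfig]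
  have hsucc : ∀ i j : Fin N, i < j →
      (∀ z ∈ ((latticeConfig q t ζp ζm k n : Finset ℝ) : Set ℝ),
        z ≤ latticePt q t ζp ζm k n j ∨ latticePt q t ζp ζm k n i ≤ z) →
      (j : ℕ) - i = 1 := by
    intro i j hij h
    have hij' : (i : ℕ) < j := hij
    by_contra hne
    have hl : (i : ℕ) + 1 < N := by have := j.2; omega
    rcases h _ ((hmem _).2 ⟨⟨i + 1, hl⟩, rfl⟩) with h | h
    · have := hanti.le_iff_ge.1 h
      have : (j : ℕ) ≤ i + 1 := this
      omega
    · have := hanti.le_iff_ge.1 h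
      have : (i : ℕ) + 1 ≤ i := this
      omega
  refine ⟨?_, ?_, ?_, ?_, ?_, ?_, ?_, ?_, ?_⟩
  · rw [latticeConfig, Finset.card_image_of_injective _ hanti.injective, Finset.card_univ,
      Fintype.card_fin]
  · exact Finset.countable_toSet _
  · rw [hmem]
    rintro ⟨i, hi⟩
    exact latticePt_ne_zero hζp hζm h0 ht n i hi
  · exact fun x _ _ => (Finset.finite_toSet _).subset fun y hy => hy.1
  · exact fun x _ _ => (Finset.finite_toSet _).subset fun y hy => hy.1
  · intro x hx hx0 h
    obtain ⟨i, rfl⟩ := (hmem _).1 hx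
    have hi := (latticePt_pos_iff hζp hζm h0 ht).1 hx0
    have hN : 0 < N := i.pos
    have h2 := h _ ((hmem _).2 ⟨⟨0, hN⟩, rfl⟩)
      ((latticePt_pos_iff hζp hζm h0 ht).2 (lt_of_le_of_lt (Nat.zero_le _) hi))
    have h3 := hanti.le_iff_ge.1 h2
    have h4 : (i : ℕ) = 0 := Nat.le_zero.1 h3
    exact ⟨n i, by rw [latticePt, latticeBase, if_pos hi, h4, pow_zero, mul_one]⟩
  · intro x hx hx0 h
    obtain ⟨i, rfl⟩ := (hmem _).1 hx
    have hi : k ≤ (i : ℕ) := by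
      by_contra hi
      exact lt_asymm hx0 ((latticePt_pos_iff hζp hζm h0 ht).2 (not_le.1 hi))
    have hiN := i.2
    have h2 := h _ ((hmem _).2 ⟨⟨N - 1, by omega⟩, rfl⟩)
      (latticePt_neg hζm h0 ht (by simp only; omega))
    have h3 : N - 1 ≤ (i : ℕ) := hanti.le_iff_ge.1 h2
    have h4 : N - 1 - (i : ℕ) = 0 := by omega
    exact ⟨n i, by rw [latticePt, latticeBase, if_neg (not_lt.2 hi), h4, pow_zero, mul_one]⟩
  · intro x hx y hy hy0 hyx h
    obtain ⟨i, rfl⟩ := (hmem _).1 hx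
    obtain ⟨j, rfl⟩ := (hmem _).1 hy
    have hij := hanti.lt_iff_gt.1 hyx
    have hj := (latticePt_pos_iff hζp hζm h0 ht).1 hy0
    obtain ⟨m, hm⟩ := latticePt_pos_eq (t := t) (ζp := ζp) (ζm := ζm) h0 hij hj
      ((hn i j hij).1 hj)
    exact ⟨m, by rw [hm, hsucc i j hij h, pow_one]⟩
  · intro x hx y hy hyx hx0 h
    obtain ⟨i, rfl⟩ := (hmem _).1 hx
    obtain ⟨j, rfl⟩ := (hmem _).1 hy
    have hij := hanti.lt_iff_gt.1 hyx
    have hi : k ≤ (i : ℕ) := by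
      by_contra hi
      exact lt_asymm hx0 ((latticePt_pos_iff hζp hζm h0 ht).2 (not_le.1 hi))
    obtain ⟨m, hm⟩ := latticePt_neg_eq (t := t) (ζp := ζp) (ζm := ζm) h0 hij hi
      ((hn i j hij).2 hi)
    exact ⟨m, by rw [hm, hsucc i j hij h, pow_one]⟩

lemma decVec_image {p : Fin N → ℝ} (hp : StrictAnti p) :
    decVec N (Finset.univ.image p) = p := by
  have hc : (Finset.univ.image p).card = N := by
    rw [Finset.card_image_of_injective _ hp.injective, Finset.card_univ, Fintype.card_fin]
  rw [decVec, dif_pos hc]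
  have h : (fun i : Fin N => p i.rev) = (Finset.univ.image p).orderEmbOfFin hc :=
    Finset.orderEmbOfFin_unique hc (fun i => Finset.mem_image_of_mem _ (Finset.mem_univ _))
      (fun i j hij => hp (Fin.rev_lt_rev.2 hij))
  funext i
  have := congrFun h i.rev
  simp only [Fin.rev_rev] at this
  rw [this]
  rfl

lemma card_filter_pos_latticeConfig (hζp : 0 < ζp) (hζm : ζm < 0) (h0 : 0 < q) (h1 : q < 1)
    (ht : 0 < t) (ht1 : t < 1) {n : Fin N → ℤ} (hn : Admissible k n) (hk : k ≤ N) :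
    ((latticeConfig q t ζp ζm k n).filter (fun x => 0 < x)).card = k := by
  have hanti := latticePt_strictAnti hζp hζm h0 h1 ht ht1 hn
  rw [latticeConfig, Finset.filter_image, Finset.card_image_of_injective _ hanti.injective]
  simp only [latticePt_pos_iff hζp hζm h0 ht]
  rw [Fin.card_filter_val_lt, min_eq_right hk]

lemma strictAnti_decVec {X : Finset ℝ} (hX : X.card = N) : StrictAnti (decVec N X) := by
  intro i j hij
  simp only [decVec, dif_pos hX]
  exact (X.orderIsoOfFin hX).strictMono (Fin.rev_lt_rev.2 hij)

lemma image_decVec {X : Finset ℝ} (hX : X.card = N) : Finset.univ.image (decVec N X) = X := by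
  refine Finset.eq_of_subset_of_card_le ?_ ?_
  · intro x hx
    obtain ⟨i, -, rfl⟩ := Finset.mem_image.1 hx
    simp only [decVec, dif_pos hX]
    exact ((X.orderIsoOfFin hX) i.rev).2
  · rw [Finset.card_image_of_injective _ (strictAnti_decVec hX).injective, Finset.card_univ,
      Fintype.card_fin, hX]

lemma exists_sign_index {p : Fin N → ℝ} (hp : StrictAnti p) :
    ∃ k, k ≤ N ∧ ∀ i : Fin N, 0 < p i ↔ (i : ℕ) < k := by
  classical
  by_cases h : ∃ m : ℕ, ∃ hm : m < N, ¬ 0 < p ⟨m, hm⟩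
  · obtain ⟨hm, hneg⟩ := Nat.find_spec h
    refine ⟨Nat.find h, hm.le, fun i => ⟨fun hi => ?_, fun hi => ?_⟩⟩
    · by_contra hge
      refine hneg (lt_of_lt_of_le hi (hp.antitone ?_))
      exact not_lt.1 hge
    · have := Nat.find_min h hi
      push Not at this
      exact this i.2
  · push Not at h
    exact ⟨N, le_rfl, fun i => iff_of_true (h i i.2) i.2⟩

lemma exists_latticeConfig_eq (h0 : 0 < q) (h1 : q < 1) (ht : 0 < t) (hζp : 0 < ζp)
    (hζm : ζm < 0) {X : Finset ℝ} (hX : X ∈ OmegaN q t ζp ζm N) :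
    ∃ k, k ≤ N ∧ ∃ n : Fin N → ℤ, Admissible k n ∧ latticeConfig q t ζp ζm k n = X := by
  obtain ⟨hcard, -, hX0, -, -, hXp, hXm, hXpp, hXmm⟩ := hX
  have hanti := strictAnti_decVec hcard
  have himg := image_decVec hcard
  set p := decVec N X with hp
  have hmem : ∀ i, p i ∈ (X : Set ℝ) := fun i => by
    rw [← himg]; exact Finset.mem_coe.2 (Finset.mem_image_of_mem _ (Finset.mem_univ _))
  have hmem' : ∀ x ∈ (X : Set ℝ), ∃ i, p i = x := fun x hx => by
    rw [← himg] at hx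
    simpa using hx
  obtain ⟨k, hkN, hk⟩ := exists_sign_index hanti
  have hneg : ∀ i : Fin N, k ≤ (i : ℕ) → p i < 0 := fun i hi =>
    lt_of_le_of_ne (not_lt.1 fun h => absurd ((hk i).1 h) (not_lt.2 hi))
      fun h => hX0 (h ▸ hmem i)
  have hgap : ∀ i j : Fin N, (j : ℕ) = i + 1 → ∀ z ∈ (X : Set ℝ), z ≤ p j ∨ p i ≤ z := by
    intro i j hij z hz
    obtain ⟨l, rfl⟩ := hmem' z hz
    rcases le_or_gt j l with h | h
    · exact Or.inl (hanti.antitone h)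
    · refine Or.inr (hanti.antitone ?_)
      have h' : (l : ℕ) < j := h
      exact Fin.le_def.2 (by omega)
  have hpos_chain : ∀ d : ℕ, ∀ i j : Fin N, (j : ℕ) = i + d → (j : ℕ) < k →
      ∃ m : ℕ, p j = p i * t ^ d * q ^ m := by
    intro d
    induction d with
    | zero =>
      intro i j hij _
      exact ⟨0, by rw [show j = i from Fin.ext hij]; simp⟩
    | succ d ih =>
      intro i j hij hj
      have hj' : (i : ℕ) + d < N := by have := j.2; omega
      obtain ⟨m, hm⟩ := ih i ⟨i + d, hj'⟩ rfl (by simp only; omega)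
      obtain ⟨m', hm'⟩ := hXpp _ (hmem ⟨i + d, hj'⟩) _ (hmem j) ((hk j).2 hj)
        (hanti (Fin.lt_def.2 (by simp only; omega))) (hgap _ _ (by simp only; omega))
      exact ⟨m + m', by rw [hm', hm, pow_succ, pow_add]; ring⟩
  have hneg_chain : ∀ d : ℕ, ∀ i j : Fin N, (j : ℕ) = i + d → k ≤ (i : ℕ) →
      ∃ m : ℕ, p i = p j * t ^ d * q ^ m := by
    intro d
    induction d with
    | zero =>
      intro i j hij _
      exact ⟨0, by rw [show j = i from Fin.ext hij]; simp⟩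
    | succ d ih =>
      intro i j hij hi
      have hj' : (i : ℕ) + d < N := by have := j.2; omega
      obtain ⟨m, hm⟩ := ih i ⟨i + d, hj'⟩ rfl hi
      obtain ⟨m', hm'⟩ := hXmm _ (hmem ⟨i + d, hj'⟩) _ (hmem j)
        (hanti (Fin.lt_def.2 (by simp only; omega))) (hneg _ (by simp only; omega))
        (hgap _ _ (by simp only; omega))
      exact ⟨m + m', by rw [hm, hm', pow_succ, pow_add]; ring⟩
  have hex : ∀ i : Fin N, ∃ m : ℤ, p i = latticeBase ζp ζm t k i * q ^ m := by
    intro i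
    have hN : 0 < N := i.pos
    rcases lt_or_ge (i : ℕ) k with hi | hi
    · obtain ⟨m, hm⟩ := hpos_chain i ⟨0, hN⟩ i (by simp) hi
      obtain ⟨l, hl⟩ := hXp _ (hmem ⟨0, hN⟩) ((hk _).2 (by simp only; omega)) (by
        intro y hy _
        obtain ⟨j, rfl⟩ := hmem' y hy
        exact hanti.antitone (Fin.le_def.2 (Nat.zero_le _)))
      refine ⟨l + m, ?_⟩
      rw [hm, hl, latticeBase, if_pos hi, zpow_add₀ h0.ne', zpow_natCast]
      ring
    · have hiN := i.2
      obtain ⟨m, hm⟩ := hneg_chain (N - 1 - i) i ⟨N - 1, by omega⟩ (by simp only; omega) hi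
      obtain ⟨l, hl⟩ := hXm _ (hmem ⟨N - 1, by omega⟩) (hneg _ (by simp only; omega)) (by
        intro y hy _
        obtain ⟨j, rfl⟩ := hmem' y hy
        refine hanti.antitone (Fin.le_def.2 ?_)
        have := j.2
        simp only
        omega)
      refine ⟨l + m, ?_⟩
      rw [hm, hl, latticeBase, if_neg (not_lt.2 hi), zpow_add₀ h0.ne', zpow_natCast]
      ring
  choose n hn using hex
  have hpt : latticePt q t ζp ζm k n = p := funext fun i => (hn i).symm
  refine ⟨k, hkN, n, ?_, by rw [latticeConfig, hpt, himg]⟩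
  intro i j hij
  have hij' : (i : ℕ) < j := hij
  refine ⟨fun hj => ?_, fun hi => ?_⟩
  · obtain ⟨m, hm⟩ := hpos_chain (j - i) i j (by omega) hj
    have e : t ^ (j : ℕ) = t ^ (i : ℕ) * t ^ ((j : ℕ) - i) := by
      rw [← pow_add]; congr 1; omega
    rw [hn i, hn j, latticeBase, latticeBase, if_pos hj, if_pos (hij'.trans hj), e] at hm
    have h3 : ζp * (t ^ (i : ℕ) * t ^ ((j : ℕ) - i)) ≠ 0 := by positivity
    have h4 : q ^ n j = q ^ (n i + m) := by
      rw [zpow_add₀ h0.ne', zpow_natCast]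
      apply mul_left_cancel₀ h3
      rw [hm]; ring
    have := zpow_right_injective₀ h0 h1.ne h4
    omega
  · obtain ⟨m, hm⟩ := hneg_chain (j - i) i j (by omega) hi
    have e : t ^ (N - 1 - (i : ℕ)) = t ^ (N - 1 - (j : ℕ)) * t ^ ((j : ℕ) - i) := by
      rw [← pow_add]; congr 1; omega
    rw [hn i, hn j, latticeBase, latticeBase, if_neg (not_lt.2 hi),
      if_neg (not_lt.2 (hi.trans hij'.le)), e] at hm
    have h3 : ζm * (t ^ (N - 1 - (j : ℕ)) * t ^ ((j : ℕ) - i)) ≠ 0 :=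
      mul_ne_zero hζm.ne (by positivity)
    have h4 : q ^ n i = q ^ (n j + m) := by
      rw [zpow_add₀ h0.ne', zpow_natCast]
      apply mul_left_cancel₀ h3
      rw [hm]; ring
    have := zpow_right_injective₀ h0 h1.ne h4
    omega

lemma latticeConfig_injective (hζp : 0 < ζp) (hζm : ζm < 0) (h0 : 0 < q) (h1 : q < 1)
    (ht : 0 < t) (ht1 : t < 1) {k' : ℕ} (hk : k ≤ N) (hk' : k' ≤ N) {n n' : Fin N → ℤ}
    (hn : Admissible k n) (hn' : Admissible k' n')
    (h : latticeConfig q t ζp ζm k n = latticeConfig q t ζp ζm k' n') : k = k' ∧ n = n' := by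
  have hkk : k = k' := by
    rw [← card_filter_pos_latticeConfig hζp hζm h0 h1 ht ht1 hn hk, h,
      card_filter_pos_latticeConfig hζp hζm h0 h1 ht ht1 hn' hk']
  subst hkk
  refine ⟨rfl, ?_⟩
  have h2 := congrArg (decVec N) h
  rw [latticeConfig, latticeConfig,
    decVec_image (latticePt_strictAnti hζp hζm h0 h1 ht ht1 hn),
    decVec_image (latticePt_strictAnti hζp hζm h0 h1 ht ht1 hn')] at h2
  funext i
  exact zpow_right_injective₀ h0 h1.ne
    (mul_left_cancel₀ (latticeBase_ne_zero hζp hζm ht i) (congrFun h2 i))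

open Classical in
/-- A finite sum of sums over the fibres of a set of pairs. -/
lemma hasSum_subtype_fin_prod {M : ℕ} {β : Type*} (D : Set (Fin M × β)) (G : Fin M → β → ℝ)
    (A : Fin M → ℝ) (h : ∀ k, HasSum (fun n => if (k, n) ∈ D then G k n else 0) (A k)) :
    HasSum (fun p : D => G p.1.1 p.1.2) (∑ k, A k) := by
  have hsum : ∀ k : Fin M, HasSum (fun p : Fin M × β =>
      if p.1 = k then D.indicator (fun p => G p.1 p.2) p else 0) (A k) := by
    intro k
    have hinj : Function.Injective (fun n : β => (k, n)) := fun a b h => (Prod.ext_iff.1 h).2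
    rw [← hinj.hasSum_iff]
    · convert h k using 2 with n
      simp [Set.indicator_apply]
    · rintro ⟨k', n⟩ h
      rw [if_neg]
      rintro rfl
      exact h ⟨n, rfl⟩
  have h2 := hasSum_subtype_iff_indicator (f := fun p : Fin M × β => G p.1 p.2) (s := D)
    (a := ∑ k, A k)
  refine h2.2 ?_
  have h3 := hasSum_sum (s := Finset.univ) fun k _ => hsum k
  simpa using h3

open Classical in
/-- Summation over `OmegaN` in lattice coordinates. -/
lemma hasSum_OmegaN (hζp : 0 < ζp) (hζm : ζm < 0) (h0 : 0 < q) (h1 : q < 1)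
    (ht : 0 < t) (ht1 : t < 1) (F : Finset ℝ → ℝ) (A : ℕ → ℝ)
    (hF : ∀ k ≤ N, HasSum (fun n : Fin N → ℤ =>
      if Admissible k n then F (latticeConfig q t ζp ζm k n) else 0) (A k)) :
    HasSum (fun X : OmegaN q t ζp ζm N => F X) (∑ k ∈ Finset.range (N + 1), A k) := by
  let D : Set (Fin (N + 1) × (Fin N → ℤ)) := {p | Admissible (p.1 : ℕ) p.2}
  let Φ : D → OmegaN q t ζp ζm N := fun p =>
    ⟨latticeConfig q t ζp ζm p.1.1 p.1.2, latticeConfig_mem_OmegaN hζp hζm h0 h1 ht ht1 p.2⟩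
  have hΦ : Function.Bijective Φ := by
    constructor
    · rintro ⟨⟨k, n⟩, hn⟩ ⟨⟨k', n'⟩, hn'⟩ h
      obtain ⟨e1, e2⟩ := latticeConfig_injective hζp hζm h0 h1 ht ht1 (Nat.lt_succ_iff.1 k.2)
        (Nat.lt_succ_iff.1 k'.2) hn hn' (congrArg Subtype.val h)
      exact Subtype.ext (Prod.ext (Fin.ext e1) e2)
    · rintro ⟨X, hX⟩
      obtain ⟨k, hk, n, hn, e⟩ := exists_latticeConfig_eq h0 h1 ht hζp hζm hX
      exact ⟨⟨(⟨k, Nat.lt_succ_iff.2 hk⟩, n), hn⟩, Subtype.ext e⟩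
  have h2 := hasSum_subtype_fin_prod D (fun k n => F (latticeConfig q t ζp ζm k n))
    (fun k => A k) fun k => hF k (Nat.lt_succ_iff.1 k.2)
  rw [Fin.sum_univ_eq_sum_range (fun k => A k)] at h2
  exact (Equiv.ofBijective Φ hΦ).hasSum_iff.1 h2

end Lattice

lemma Wc_eq {q τ : ℝ} (h0 : 0 < q) (h1 : q < 1) (s : ℂ) (N : ℕ) (x : ℝ) :
    Wc q (-Complex.I * (q : ℂ) ^ s) (Complex.I * (q : ℂ) ^ ((starRingEnd ℂ) s))
      (-Complex.I * ((q ^ τ : ℝ) : ℂ) ^ (1 - (N : ℤ)))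
      (Complex.I * ((q ^ τ : ℝ) : ℂ) ^ (1 - (N : ℤ))) x =
    (((1 - q) * |x| * qWeight q (s + ((N : ℂ) - 1) * τ) ((q ^ τ) ^ (1 - (N : ℤ)) * x) : ℝ) : ℂ) := by
  have hq : (q : ℂ) ≠ 0 := Complex.ofReal_ne_zero.2 h0.ne'
  set T : ℝ := (q ^ τ) ^ (1 - (N : ℤ)) with hT
  have hTc : ((q ^ τ : ℝ) : ℂ) ^ (1 - (N : ℤ)) = (T : ℂ) := by
    rw [hT, Complex.ofReal_zpow]
  have hTq : (T : ℂ) = (q : ℂ) ^ (-(((N : ℂ) - 1) * τ)) := by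
    rw [hT, ← Real.rpow_intCast, ← Real.rpow_mul h0.le, Complex.ofReal_cpow h0.le]
    congr 1
    push_cast
    ring
  have e1 : -Complex.I * (q : ℂ) ^ s * (x : ℂ) =
      (q : ℂ) ^ (s + ((N : ℂ) - 1) * τ) * (-Complex.I * ((T * x : ℝ) : ℂ)) := by
    rw [Complex.ofReal_mul, hTq, Complex.cpow_add _ _ hq, Complex.cpow_neg]
    have : (q : ℂ) ^ (((N : ℂ) - 1) * τ) ≠ 0 := by simp [Complex.cpow_eq_zero_iff, hq]
    field_simp
  have e2 : Complex.I * (q : ℂ) ^ ((starRingEnd ℂ) s) * (x : ℂ) =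
      (starRingEnd ℂ) (-Complex.I * (q : ℂ) ^ s * (x : ℂ)) := by
    have harg : (q : ℂ).arg ≠ Real.pi := by
      rw [Complex.arg_ofReal_of_nonneg h0.le]; exact Real.pi_ne_zero.symm
    have := Complex.cpow_conj (q : ℂ) s harg
    rw [Complex.conj_ofReal] at this
    rw [map_mul, map_mul, this]
    simp
  have e3 : -Complex.I * (T : ℂ) * (x : ℂ) = -Complex.I * ((T * x : ℝ) : ℂ) := by
    push_cast; ring
  have e4 : Complex.I * (T : ℂ) * (x : ℂ) =
      (starRingEnd ℂ) (-Complex.I * ((T * x : ℝ) : ℂ)) := by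
    simp only [map_mul, map_neg, Complex.conj_I, Complex.conj_ofReal]
    push_cast; ring
  rw [Wc, hTc, e2, e1, e3, e4, qPochC_conj h0 h1, qPochC_conj h0 h1, Complex.mul_conj,
    Complex.mul_conj, Complex.normSq_eq_norm_sq, Complex.normSq_eq_norm_sq, qWeight, norm_div,
    div_pow]
  push_cast
  ring

lemma sDensity_factor_eq (s : ℂ) {c : ℂ} (hc : (starRingEnd ℂ) c = c) (u : ℝ) :
    (((1 : ℂ) + (u : ℂ) * Complex.I) ^ (-s - c) *
        ((1 : ℂ) - (u : ℂ) * Complex.I) ^ (-(starRingEnd ℂ) s - c)).re =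
      ‖Complex.exp (-((s + c) * Complex.log (1 + u * Complex.I)))‖ ^ 2 := by
  have hne : (1 : ℂ) + (u : ℂ) * Complex.I ≠ 0 := fun h => by simpa using congrArg Complex.re h
  have harg : ((1 : ℂ) + (u : ℂ) * Complex.I).arg ≠ Real.pi := by
    intro h
    have := (Complex.arg_eq_pi_iff.1 h).1
    simp at this
    linarith
  have e1 : (1 : ℂ) - (u : ℂ) * Complex.I = (starRingEnd ℂ) (1 + (u : ℂ) * Complex.I) := by
    simp [sub_eq_add_neg]
  have e2 : -(starRingEnd ℂ) s - c = (starRingEnd ℂ) (-s - c) := by simp [hc]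
  have e3 : -((s + c) * Complex.log (1 + u * Complex.I)) =
      Complex.log (1 + u * Complex.I) * (-s - c) := by ring
  rw [e1, e2, Complex.conj_cpow _ _ harg, Complex.conj_conj, Complex.mul_conj, Complex.ofReal_re,
    Complex.normSq_eq_norm_sq, Complex.cpow_def_of_ne_zero hne, e3]

lemma prod_prod_image {N : ℕ} {p : Fin N → ℝ} (hp : StrictAnti p) (g : ℝ → ℝ → ℝ) :
    ∏ x ∈ Finset.univ.image p, ∏ y ∈ Finset.univ.image p, g x y = ∏ i, ∏ j, g (p i) (p j) := by
  rw [Finset.prod_image fun a _ b _ h => hp.injective h]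
  exact Finset.prod_congr rfl fun i _ => Finset.prod_image fun a _ b _ h => hp.injective h

lemma Vqt_image {q t : ℝ} {N : ℕ} {p : Fin N → ℝ} (hp : StrictAnti p) :
    Vqt q t (Finset.univ.image p) =
      ∏ i, ∏ j, if i < j then qKer q t (p i) (p j) else 1 := by
  rw [Vqt, prod_prod_image hp (fun x y => if y < x then (x - y) else 1),
    prod_prod_image hp (fun x y => if 0 < x ∧ y < x then
      x ^ (2 * Real.logb q t - 1) * qPochR q (q * t⁻¹ * y * x⁻¹) / qPochR q (t * y * x⁻¹) else 1),
    prod_prod_image hp (fun x y => if x < 0 ∧ y < x then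
      |y| ^ (2 * Real.logb q t - 1) * qPochR q (q * t⁻¹ * x * y⁻¹) / qPochR q (t * x * y⁻¹) else 1)]
  simp only [← Finset.prod_mul_distrib]
  refine Finset.prod_congr rfl fun i _ => Finset.prod_congr rfl fun j _ => ?_
  by_cases h : i < j
  · simp [h, hp h, qKer]
  · have hnot : ¬ p j < p i := fun h2 => h (hp.lt_iff_gt.1 h2)
    simp [h, hnot]

/-- The density of the `N`-particle weight against the volumes of the lattice cells, for
configurations with `k` positive particles. -/
noncomputable def cellDensity (q τ : ℝ) (S : ℂ) (ζp ζm : ℝ) {N : ℕ} (k : ℕ) (x : Fin N → ℝ) : ℝ :=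
  CNconst q (q ^ τ) ζp ζm N k * (∏ i, ∏ j, if i < j then qKer q (q ^ τ) (x i) (x j) else 1) *
    ∏ i, qWeight q S ((q ^ τ) ^ (1 - (N : ℤ)) * x i)

lemma Mtilde_latticeConfig {q τ ζp ζm : ℝ} (hζp : 0 < ζp) (hζm : ζm < 0) (h0 : 0 < q) (h1 : q < 1)
    (hτ : 0 < τ) (s : ℂ) {N k : ℕ} (hk : k ≤ N) {n : Fin N → ℤ} (hn : Admissible k n) :
    (Mtilde q (q ^ τ) ζp ζm N (-Complex.I * (q : ℂ) ^ s)
      (Complex.I * (q : ℂ) ^ ((starRingEnd ℂ) s))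
      (-Complex.I * ((q ^ τ : ℝ) : ℂ) ^ (1 - (N : ℤ)))
      (Complex.I * ((q ^ τ : ℝ) : ℂ) ^ (1 - (N : ℤ)))
      (latticeConfig q (q ^ τ) ζp ζm k n)).re =
    (∏ i, (1 - q) * |latticePt q (q ^ τ) ζp ζm k n i|) *
      cellDensity q τ (s + ((N : ℂ) - 1) * τ) ζp ζm k (latticePt q (q ^ τ) ζp ζm k n) := by
  have ht := Real.rpow_pos_of_pos h0 τ
  have ht1 := Real.rpow_lt_one h0.le h1 hτ
  have hanti := latticePt_strictAnti hζp hζm h0 h1 ht ht1 hn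
  rw [Mtilde, card_filter_pos_latticeConfig hζp hζm h0 h1 ht ht1 hn hk, latticeConfig,
    Vqt_image hanti, Finset.prod_image fun a _ b _ h => hanti.injective h]
  simp only [Wc_eq h0 h1]
  rw [← Complex.ofReal_prod, ← Complex.ofReal_mul, Complex.ofReal_re, Finset.prod_mul_distrib,
    cellDensity]
  ring

/-- The formula for `sDensity`, without the restriction to the chamber. -/
noncomputable def chamberDensity (τ : ℝ) (S : ℂ) {N : ℕ} (u : Fin N → ℝ) : ℝ :=
  (∏ i, ∏ j, if i < j then (u i - u j) ^ (2 * τ) else 1) *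
    ∏ i, ‖Complex.exp (-(S * Complex.log (1 + u i * Complex.I)))‖ ^ 2

lemma sDensity_of_strictAnti (τ : ℝ) (s : ℂ) {N : ℕ} {u : Fin N → ℝ} (hu : StrictAnti u) :
    sDensity τ s N u = chamberDensity τ (s + ((N : ℂ) - 1) * τ) u := by
  rw [sDensity, if_pos fun i j hij => hu hij, chamberDensity, mul_comm]
  simp only [sDensity_factor_eq s (c := ((N : ℂ) - 1) * τ) (by simp)]

lemma sDensity_of_not_strictAnti (τ : ℝ) (s : ℂ) {N : ℕ} {u : Fin N → ℝ} (hu : ¬ StrictAnti u) :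
    sDensity τ s N u = 0 := by
  rw [sDensity, if_neg fun h => hu fun i j hij => h i j hij]

lemma chamberDensity_pos (τ : ℝ) (S : ℂ) {N : ℕ} {u : Fin N → ℝ} (hu : StrictAnti u) :
    0 < chamberDensity τ S u := by
  refine mul_pos (Finset.prod_pos fun i _ => Finset.prod_pos fun j _ => ?_)
    (Finset.prod_pos fun i _ => by simp [Complex.exp_ne_zero])
  split_ifs with h
  · exact Real.rpow_pos_of_pos (sub_pos.2 (hu h)) _
  · exact one_pos

lemma tendsto_cellDensity {τ : ℝ} (hτ : 0 < τ) (S : ℂ) {ζp ζm : ℝ} (hζp : 0 < ζp) (hζm : ζm < 0)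
    {N : ℕ} (k : ℕ) {x : ℝ → Fin N → ℝ} {u : Fin N → ℝ} (hu : StrictAnti u) (hu0 : ∀ i, u i ≠ 0)
    (hx : ∀ i, Filter.Tendsto (fun q => x q i) qFilter (nhds (u i))) :
    Filter.Tendsto (fun q => cellDensity q τ S ζp ζm k (x q)) qFilter
      (nhds (chamberDensity τ S u)) := by
  have hT : Filter.Tendsto (fun q : ℝ => (q ^ τ) ^ (1 - (N : ℤ))) qFilter (nhds 1) := by
    simpa using (tendsto_rpow_qFilter τ).zpow₀ (1 - (N : ℤ)) (Or.inl one_ne_zero)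
  have h := ((tendsto_CNconst (τ := τ) hζp hζm N k).mul
    (tendsto_finsetProd Finset.univ fun i _ => tendsto_finsetProd Finset.univ fun j _ =>
      show Filter.Tendsto (fun q => if i < j then qKer q (q ^ τ) (x q i) (x q j) else 1) qFilter
        (nhds (if i < j then (u i - u j) ^ (2 * τ) else 1)) by
        split_ifs with hij
        · exact tendsto_qKer (hx i) (hx j) (hu0 i) (hu hij) hτ
        · exact tendsto_const_nhds)).mul
    (tendsto_finsetProd Finset.univ fun i _ => tendsto_qWeight S (hT.mul (hx i)))
  simpa [cellDensity, chamberDensity] using h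

lemma prod_pair_mul {N : ℕ} (a : Fin N → ℝ) :
    (∏ i, ∏ j, if i < j then a i * a j else 1) = ∏ i, a i ^ (N - 1) := by
  have e1 : (∏ i, ∏ j, if i < j then a i * a j else 1) =
      (∏ i, ∏ j, if i < j then a i else 1) * ∏ i, ∏ j, if j < i then a i else 1 := by
    rw [Finset.prod_comm (f := fun i j => if j < i then a i else 1)]
    simp only [← Finset.prod_mul_distrib]
    refine Finset.prod_congr rfl fun i _ => Finset.prod_congr rfl fun j _ => ?_
    split_ifs <;> simp
  rw [e1, ← Finset.prod_mul_distrib]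
  refine Finset.prod_congr rfl fun i _ => ?_
  rw [← Finset.prod_mul_distrib]
  have e2 : ∀ j : Fin N, ((if i < j then a i else 1) * if j < i then a i else 1) =
      if j ∈ Finset.univ.erase i then a i else 1 := by
    intro j
    rcases lt_trichotomy i j with h | h | h
    · simp [h, h.ne', h.not_gt]
    · simp [h]
    · simp [h, h.ne, h.not_gt]
  simp only [e2]
  rw [Finset.prod_ite_mem, Finset.univ_inter, Finset.prod_const,
    Finset.card_erase_of_mem (Finset.mem_univ _), Finset.card_univ, Fintype.card_fin]

lemma exists_cellDensity_bound {τ : ℝ} (hτ : 0 < τ) (s : ℂ) {ρ : ℝ} (hρ0 : 0 < ρ) (hρ : ρ < s.re)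
    {ζp ζm : ℝ} (hζp : 0 < ζp) (hζm : ζm < 0) {N : ℕ} (hN : 1 ≤ N) (k : ℕ) :
    ∃ C, 0 < C ∧ ∀ᶠ q in qFilter, ∀ x : Fin N → ℝ, (∀ i, x i ≠ 0) → StrictAnti x →
      (∀ i j, i < j → 0 < x j → x j ≤ x i * q ^ τ) →
      (∀ i j, i < j → x i < 0 → -x i ≤ -x j * q ^ τ) →
      |cellDensity q τ (s + ((N : ℂ) - 1) * τ) ζp ζm k x| ≤ C * ∏ i, (1 + x i ^ 2) ^ (-ρ) := by
  have hN' : (1 : ℝ) ≤ N := by exact_mod_cast hN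
  obtain ⟨C₁, hC₁, hb₁⟩ := exists_qWeight_bound (s + ((N : ℂ) - 1) * τ)
    (ρ := ρ + ((N : ℝ) - 1) * τ) (by
      simp only [Complex.add_re, Complex.mul_re, Complex.sub_re, Complex.natCast_re,
        Complex.one_re, Complex.ofReal_re, Complex.sub_im, Complex.natCast_im, Complex.one_im,
        Complex.ofReal_im]
      linarith)
  obtain ⟨C₂, hC₂, hb₂⟩ := exists_qKer_bound hτ
  have hb₃ : ∀ᶠ q in qFilter, |CNconst q (q ^ τ) ζp ζm N k| < 2 :=
    (tendsto_CNconst hζp hζm N k).abs.eventually_lt_const (by norm_num)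
  refine ⟨2 * (C₂ ^ N) ^ N * C₁ ^ N, by positivity, ?_⟩
  filter_upwards [hb₁, hb₂, hb₃, eventually_qFilter (P := fun q => 0 < q ∧ q < 1)
      zero_lt_one fun q _ h0 h1 => ⟨h0, h1⟩]
    with q h1 h2 h3 ⟨hq0, hq1⟩ x hx0 hx hxp hxm
  have hT : 1 ≤ (q ^ τ) ^ (1 - (N : ℤ)) := by
    have ht := Real.rpow_pos_of_pos hq0 τ
    have ht1 := Real.rpow_lt_one hq0.le hq1 hτ
    exact one_le_zpow_of_nonpos₀ ht ht1.le (by omega)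
  have hker : |∏ i, ∏ j, if i < j then qKer q (q ^ τ) (x i) (x j) else 1| ≤
      (C₂ ^ N) ^ N * ∏ i, ((1 + x i ^ 2) ^ τ) ^ (N - 1) := by
    calc |∏ i, ∏ j, if i < j then qKer q (q ^ τ) (x i) (x j) else 1|
        ≤ ∏ i, ∏ j, (C₂ * if i < j then (1 + x i ^ 2) ^ τ * (1 + x j ^ 2) ^ τ else 1) := by
          rw [Finset.abs_prod]
          refine Finset.prod_le_prod (fun i _ => abs_nonneg _) fun i _ => ?_
          rw [Finset.abs_prod]
          refine Finset.prod_le_prod (fun j _ => abs_nonneg _) fun j _ => ?_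
          split_ifs with hij
          · exact h2 _ _ (hx0 i) (hx hij) (hxp i j hij) (hxm i j hij)
          · simpa using hC₂
      _ = _ := by
          simp only [Finset.prod_mul_distrib, Finset.prod_const, Finset.card_univ,
            Fintype.card_fin]
          rw [prod_pair_mul]
  have hweight : |∏ i, qWeight q (s + ((N : ℂ) - 1) * τ) ((q ^ τ) ^ (1 - (N : ℤ)) * x i)| ≤
      C₁ ^ N * ∏ i, (1 + x i ^ 2) ^ (-(ρ + ((N : ℝ) - 1) * τ)) := by
    rw [Finset.abs_prod]
    calc _ ≤ ∏ i, C₁ * (1 + x i ^ 2) ^ (-(ρ + ((N : ℝ) - 1) * τ)) := by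
          refine Finset.prod_le_prod (fun i _ => abs_nonneg _) fun i _ => ?_
          rw [abs_of_nonneg (by unfold qWeight; positivity)]
          refine (h1 _).trans ?_
          gcongr C₁ * ?_
          refine Real.rpow_le_rpow_of_nonpos (by positivity) ?_ ?_
          · rw [mul_pow]
            nlinarith [sq_nonneg (x i), one_le_pow₀ hT (n := 2)]
          · nlinarith
      _ = _ := by simp [Finset.prod_mul_distrib]
  have hcomb : (∏ i, ((1 + x i ^ 2) ^ τ) ^ (N - 1)) *
      ∏ i, (1 + x i ^ 2) ^ (-(ρ + ((N : ℝ) - 1) * τ)) = ∏ i, (1 + x i ^ 2) ^ (-ρ) := by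
    rw [← Finset.prod_mul_distrib]
    refine Finset.prod_congr rfl fun i _ => ?_
    have hp : 0 < 1 + x i ^ 2 := by positivity
    rw [← Real.rpow_natCast, ← Real.rpow_mul hp.le, ← Real.rpow_add hp, Nat.cast_sub hN]
    congr 1
    push_cast
    ring
  rw [cellDensity, abs_mul, abs_mul]
  calc _ ≤ 2 * ((C₂ ^ N) ^ N * ∏ i, ((1 + x i ^ 2) ^ τ) ^ (N - 1)) *
        (C₁ ^ N * ∏ i, (1 + x i ^ 2) ^ (-(ρ + ((N : ℝ) - 1) * τ))) := by
        gcongr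
    _ = 2 * (C₂ ^ N) ^ N * C₁ ^ N * ((∏ i, ((1 + x i ^ 2) ^ τ) ^ (N - 1)) *
        ∏ i, (1 + x i ^ 2) ^ (-(ρ + ((N : ℝ) - 1) * τ))) := by ring
    _ = _ := by rw [hcomb]

/-- The vectors whose first `k` coordinates are positive and whose other coordinates are
negative. -/
def signRegion (N k : ℕ) : Set (Fin N → ℝ) :=
  {u | ∀ i : Fin N, ((i : ℕ) < k → 0 < u i) ∧ (k ≤ (i : ℕ) → u i < 0)}

/-- The lattice coordinates of the cell containing `u`. -/
noncomputable def cellIndex (q t ζp ζm : ℝ) {N : ℕ} (k : ℕ) (u : Fin N → ℝ) : Fin N → ℤ :=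
  fun i => ⌊Real.logb q (u i / latticeBase ζp ζm t k i)⌋

/-- The cell with lattice coordinates `n`. -/
def latticeCell (q t ζp ζm : ℝ) {N : ℕ} (k : ℕ) (n : Fin N → ℤ) : Set (Fin N → ℝ) :=
  signRegion N k ∩ cellIndex q t ζp ζm k ⁻¹' {n}

lemma floor_logb_eq_iff {q v : ℝ} (h0 : 0 < q) (h1 : q < 1) (hv : 0 < v) (m : ℤ) :
    ⌊Real.logb q v⌋ = m ↔ q ^ (m + 1) < v ∧ v ≤ q ^ m := by
  rw [Int.floor_eq_iff, Real.le_logb_iff_rpow_le_of_base_lt_one h0 h1 hv,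
    Real.logb_lt_iff_lt_rpow_of_base_lt_one h0 h1 hv, ← Real.rpow_intCast, ← Real.rpow_intCast]
  push_cast
  exact and_comm

section Cells

variable {q t ζp ζm : ℝ} {N k : ℕ}

lemma div_latticeBase_pos (hζp : 0 < ζp) (hζm : ζm < 0) (ht : 0 < t) {u : Fin N → ℝ}
    (hu : u ∈ signRegion N k) (i : Fin N) : 0 < u i / latticeBase ζp ζm t k i := by
  rcases lt_or_ge (i : ℕ) k with h | h
  · exact div_pos ((hu i).1 h) (latticeBase_pos hζp ht h)
  · exact div_pos_of_neg_of_neg ((hu i).2 h) (latticeBase_neg hζm ht h)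

lemma latticeCell_eq_pi (hζp : 0 < ζp) (hζm : ζm < 0) (h0 : 0 < q) (h1 : q < 1) (ht : 0 < t)
    (n : Fin N → ℤ) : latticeCell q t ζp ζm k n =
      Set.pi Set.univ fun i =>
        (fun v => v * (latticeBase ζp ζm t k i)⁻¹) ⁻¹' Set.Ioc (q ^ (n i + 1)) (q ^ n i) := by
  ext u
  simp only [latticeCell, Set.mem_inter_iff, Set.mem_preimage, Set.mem_singleton_iff, Set.mem_pi,
    Set.mem_univ, true_imp_iff, Set.mem_Ioc, ← div_eq_mul_inv]
  constructor
  · rintro ⟨hu, hn⟩ i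
    exact (floor_logb_eq_iff h0 h1 (div_latticeBase_pos hζp hζm ht hu i) _).1 (congrFun hn i)
  · intro h
    have hpos : ∀ i, 0 < u i / latticeBase ζp ζm t k i := fun i => (zpow_pos h0 _).trans (h i).1
    refine ⟨fun i => ⟨fun hi => ?_, fun hi => ?_⟩, ?_⟩
    · have hc := latticeBase_pos (ζm := ζm) hζp ht hi
      have := mul_pos (hpos i) hc
      rwa [div_mul_cancel₀ _ hc.ne'] at this
    · have hc := latticeBase_neg (ζp := ζp) hζm ht hi
      have := mul_neg_of_pos_of_neg (hpos i) hc
      rwa [div_mul_cancel₀ _ hc.ne] at this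
    · exact funext fun i => (floor_logb_eq_iff h0 h1 (hpos i) _).2 (h i)

lemma volume_latticeCell (hζp : 0 < ζp) (hζm : ζm < 0) (h0 : 0 < q) (h1 : q < 1) (ht : 0 < t)
    (n : Fin N → ℤ) : MeasureTheory.volume.real (latticeCell q t ζp ζm k n) =
      ∏ i, (1 - q) * |latticePt q t ζp ζm k n i| := by
  rw [latticeCell_eq_pi hζp hζm h0 h1 ht, MeasureTheory.Measure.real, MeasureTheory.volume_pi_pi,
    ENNReal.toReal_prod]
  refine Finset.prod_congr rfl fun i _ => ?_
  have hz := zpow_pos h0 (n i)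
  rw [Real.volume_preimage_mul_right (inv_ne_zero (latticeBase_ne_zero hζp hζm ht i)),
    Real.volume_Ioc, inv_inv, ← ENNReal.ofReal_mul (abs_nonneg _), ENNReal.toReal_ofReal,
    latticePt, abs_mul, abs_of_pos hz, zpow_add_one₀ h0.ne']
  · ring
  · rw [zpow_add_one₀ h0.ne']
    exact mul_nonneg (abs_nonneg _) (by nlinarith)

lemma measurableSet_signRegion (N k : ℕ) : MeasurableSet (signRegion N k) := by
  have : signRegion N k = ⋂ i : Fin N, ({u | (i : ℕ) < k → 0 < u i} ∩
      {u | k ≤ (i : ℕ) → u i < 0}) := by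
    ext u
    simp [signRegion]
  rw [this]
  refine MeasurableSet.iInter fun i => MeasurableSet.inter ?_ ?_
  · by_cases h : (i : ℕ) < k
    · simpa [h] using measurableSet_lt measurable_const (measurable_pi_apply i)
    · simp [h]
  · by_cases h : k ≤ (i : ℕ)
    · simpa [h] using measurableSet_lt (measurable_pi_apply i) measurable_const
    · simp [h]

lemma measurable_cellIndex : Measurable (cellIndex q t ζp ζm k : (Fin N → ℝ) → Fin N → ℤ) := by
  refine measurable_pi_lambda _ fun i => Measurable.floor ?_
  unfold Real.logb
  exact (Real.measurable_log.comp ((measurable_pi_apply i).div_const _)).div_const _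

lemma measurableSet_latticeCell (n : Fin N → ℤ) : MeasurableSet (latticeCell q t ζp ζm k n) :=
  (measurableSet_signRegion N k).inter (measurable_cellIndex (measurableSet_singleton n))

/-- A sum weighted by the volumes of the cells is the integral of a step function. -/
lemma hasSum_cells (hζp : 0 < ζp) (hζm : ζm < 0) (h0 : 0 < q) (h1 : q < 1) (ht : 0 < t)
    (G : (Fin N → ℤ) → ℝ)
    (hG : MeasureTheory.IntegrableOn (fun u => G (cellIndex q t ζp ζm k u)) (signRegion N k)) :
    HasSum (fun n => (∏ i, (1 - q) * |latticePt q t ζp ζm k n i|) * G n)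
      (∫ u in signRegion N k, G (cellIndex q t ζp ζm k u)) := by
  have hU : ⋃ n, latticeCell q t ζp ζm k n = signRegion N k := by
    ext u
    simp [latticeCell]
  have hd : Pairwise (Function.onFun Disjoint (latticeCell (N := N) q t ζp ζm k)) := by
    intro n m hnm
    rw [Function.onFun, Set.disjoint_left]
    rintro u ⟨-, h⟩ ⟨-, h'⟩
    exact hnm (h.symm.trans h')
  have h := MeasureTheory.hasSum_integral_iUnion
    (measurableSet_latticeCell (q := q) (t := t) (ζp := ζp) (ζm := ζm) (N := N) (k := k)) hd
    (f := fun u => G (cellIndex q t ζp ζm k u)) (μ := MeasureTheory.volume) (by rwa [hU])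
  rw [hU] at h
  refine h.congr_fun fun n => ?_
  rw [← volume_latticeCell hζp hζm h0 h1 ht n, ← smul_eq_mul, ← MeasureTheory.setIntegral_const]
  refine MeasureTheory.setIntegral_congr_fun (measurableSet_latticeCell n) fun u hu => ?_
  exact congrArg G hu.2.symm

lemma div_latticePt_cellIndex (hζp : 0 < ζp) (hζm : ζm < 0) (h0 : 0 < q) (h1 : q < 1) (ht : 0 < t)
    {u : Fin N → ℝ} (hu : u ∈ signRegion N k) (i : Fin N) :
    q < u i / latticePt q t ζp ζm k (cellIndex q t ζp ζm k u) i ∧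
      u i / latticePt q t ζp ζm k (cellIndex q t ζp ζm k u) i ≤ 1 := by
  have h := (floor_logb_eq_iff h0 h1 (div_latticeBase_pos hζp hζm ht hu i) _).1 rfl
  have hz := zpow_pos h0 (cellIndex q t ζp ζm k u i)
  rw [latticePt, ← div_div, lt_div_iff₀ hz, div_le_one hz]
  refine ⟨?_, h.2⟩
  rw [mul_comm, ← zpow_add_one₀ h0.ne']
  exact h.1

lemma sq_le_sq_latticePt (hζp : 0 < ζp) (hζm : ζm < 0) (h0 : 0 < q) (h1 : q < 1) (ht : 0 < t)
    {u : Fin N → ℝ} (hu : u ∈ signRegion N k) (i : Fin N) :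
    u i ^ 2 ≤ latticePt q t ζp ζm k (cellIndex q t ζp ζm k u) i ^ 2 := by
  have h := div_latticePt_cellIndex hζp hζm h0 h1 ht hu i
  have hne := latticePt_ne_zero (k := k) hζp hζm h0 ht (cellIndex q t ζp ζm k u) i
  have h2 : (u i / latticePt q t ζp ζm k (cellIndex q t ζp ζm k u) i) ^ 2 ≤ 1 :=
    pow_le_one₀ (h0.le.trans h.1.le) h.2
  rwa [div_pow, div_le_one (by positivity)] at h2

end Cells

lemma tendsto_latticePt {τ ζp ζm : ℝ} (hζp : 0 < ζp) (hζm : ζm < 0) {N k : ℕ} {u : Fin N → ℝ}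
    (hu : u ∈ signRegion N k) (i : Fin N) :
    Filter.Tendsto (fun q => latticePt q (q ^ τ) ζp ζm k (cellIndex q (q ^ τ) ζp ζm k u) i)
      qFilter (nhds (u i)) := by
  have hui : u i ≠ 0 := by
    rcases lt_or_ge (i : ℕ) k with h | h
    · exact ((hu i).1 h).ne'
    · exact ((hu i).2 h).ne
  have h1 : Filter.Tendsto
      (fun q => u i / latticePt q (q ^ τ) ζp ζm k (cellIndex q (q ^ τ) ζp ζm k u) i)
      qFilter (nhds 1) := by
    refine tendsto_of_tendsto_of_tendsto_of_le_of_le' tendsto_id_qFilter tendsto_const_nhds ?_ ?_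
    · exact eventually_qFilter zero_lt_one fun q _ h0 h1 =>
        (div_latticePt_cellIndex hζp hζm h0 h1 (Real.rpow_pos_of_pos h0 _) hu i).1.le
    · exact eventually_qFilter zero_lt_one fun q _ h0 h1 =>
        (div_latticePt_cellIndex hζp hζm h0 h1 (Real.rpow_pos_of_pos h0 _) hu i).2
  have h2 := (tendsto_const_nhds (x := u i)).div h1 one_ne_zero
  rw [div_one] at h2
  refine h2.congr fun q => ?_
  rw [Pi.div_apply, div_div_cancel₀ hui]

lemma eventually_admissible {τ ζp ζm : ℝ} (hζp : 0 < ζp) (hζm : ζm < 0) {N k : ℕ} {u : Fin N → ℝ}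
    (hu : u ∈ signRegion N k) (hanti : StrictAnti u) :
    ∀ᶠ q in qFilter, Admissible k (cellIndex q (q ^ τ) ζp ζm k u) := by
  have hpair : ∀ i j : Fin N, i < j → ∀ᶠ q in qFilter,
      ((j : ℕ) < k → cellIndex q (q ^ τ) ζp ζm k u i ≤ cellIndex q (q ^ τ) ζp ζm k u j) ∧
      (k ≤ (i : ℕ) → cellIndex q (q ^ τ) ζp ζm k u j ≤ cellIndex q (q ^ τ) ζp ζm k u i) := by
    intro i j hij
    have hij' : (i : ℕ) < j := hij
    have hp := fun i => tendsto_latticePt (τ := τ) hζp hζm hu i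
    have hfac : Filter.Tendsto (fun q : ℝ => (q ^ τ) ^ ((j : ℕ) - i) / q) qFilter (nhds 1) := by
      have h := ((tendsto_rpow_qFilter τ).pow ((j : ℕ) - i)).div tendsto_id_qFilter one_ne_zero
      rw [one_pow, div_one] at h
      exact h
    have e1 : ∀ᶠ q in qFilter,
        latticePt q (q ^ τ) ζp ζm k (cellIndex q (q ^ τ) ζp ζm k u) j <
        latticePt q (q ^ τ) ζp ζm k (cellIndex q (q ^ τ) ζp ζm k u) i *
          ((q ^ τ) ^ ((j : ℕ) - i) / q) :=
      (hp j).eventually_lt ((hp i).mul hfac) (by simpa using hanti hij)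
    have e2 : ∀ᶠ q in qFilter,
        latticePt q (q ^ τ) ζp ζm k (cellIndex q (q ^ τ) ζp ζm k u) j *
          ((q ^ τ) ^ ((j : ℕ) - i) / q) <
        latticePt q (q ^ τ) ζp ζm k (cellIndex q (q ^ τ) ζp ζm k u) i :=
      ((hp j).mul hfac).eventually_lt (hp i) (by simpa using hanti hij)
    filter_upwards [e1, e2, eventually_qFilter (P := fun q => 0 < q ∧ q < 1)
      zero_lt_one fun q _ h0 h1 => ⟨h0, h1⟩] with q e1 e2 ⟨h0, h1⟩
    have ht := Real.rpow_pos_of_pos h0 τ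
    set n := cellIndex q (q ^ τ) ζp ζm k u
    refine ⟨fun hj => ?_, fun hi => ?_⟩
    · by_contra hlt
      refine absurd e1 (not_lt.2 ?_)
      rw [latticePt, latticePt, latticeBase, latticeBase, if_pos hj, if_pos (hij'.trans hj)]
      have e : (q ^ τ) ^ (j : ℕ) = (q ^ τ) ^ (i : ℕ) * (q ^ τ) ^ ((j : ℕ) - i) := by
        rw [← pow_add]; congr 1; omega
      calc ζp * (q ^ τ) ^ (i : ℕ) * q ^ n i * ((q ^ τ) ^ ((j : ℕ) - i) / q)
          = ζp * (q ^ τ) ^ (j : ℕ) * q ^ (n i - 1) := by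
            rw [zpow_sub_one₀ h0.ne', e]; ring
        _ ≤ ζp * (q ^ τ) ^ (j : ℕ) * q ^ n j :=
            mul_le_mul_of_nonneg_left (zpow_le_zpow_right_of_le_one₀ h0 h1.le (by omega))
              (by positivity)
    · by_contra hlt
      refine absurd e2 (not_lt.2 ?_)
      rw [latticePt, latticePt, latticeBase, latticeBase, if_neg (not_lt.2 hi),
        if_neg (not_lt.2 (hi.trans hij'.le))]
      have e : (q ^ τ) ^ (N - 1 - (i : ℕ)) =
          (q ^ τ) ^ (N - 1 - (j : ℕ)) * (q ^ τ) ^ ((j : ℕ) - i) := by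
        rw [← pow_add]; congr 1; omega
      calc ζm * (q ^ τ) ^ (N - 1 - (i : ℕ)) * q ^ n i
          ≤ ζm * (q ^ τ) ^ (N - 1 - (i : ℕ)) * q ^ (n j - 1) :=
            mul_le_mul_of_nonpos_left (zpow_le_zpow_right_of_le_one₀ h0 h1.le (by omega))
              (mul_nonpos_of_nonpos_of_nonneg hζm.le (by positivity))
        _ = ζm * (q ^ τ) ^ (N - 1 - (j : ℕ)) * q ^ n j * ((q ^ τ) ^ ((j : ℕ) - i) / q) := by
            rw [zpow_sub_one₀ h0.ne', e]; ring
  have h : ∀ᶠ q in qFilter, ∀ i j : Fin N, i < j →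
      ((j : ℕ) < k → cellIndex q (q ^ τ) ζp ζm k u i ≤ cellIndex q (q ^ τ) ζp ζm k u j) ∧
      (k ≤ (i : ℕ) → cellIndex q (q ^ τ) ζp ζm k u j ≤ cellIndex q (q ^ τ) ζp ζm k u i) := by
    rw [Filter.eventually_all]
    intro i
    rw [Filter.eventually_all]
    intro j
    by_cases hij : i < j
    · exact (hpair i j hij).mono fun q hq _ => hq
    · exact Filter.Eventually.of_forall fun q h => absurd h hij
  exact h

lemma eventually_not_admissible {τ ζp ζm : ℝ} (hτ : 0 < τ) (hζp : 0 < ζp) (hζm : ζm < 0) {N k : ℕ}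
    {u : Fin N → ℝ} (hu : u ∈ signRegion N k) (hinj : Function.Injective u)
    (hanti : ¬ StrictAnti u) :
    ∀ᶠ q in qFilter, ¬ Admissible k (cellIndex q (q ^ τ) ζp ζm k u) := by
  obtain ⟨i, j, hij, hlt⟩ : ∃ i j, i < j ∧ u i < u j := by
    by_contra! h
    exact hanti fun i j hij => lt_of_le_of_ne (h i j hij) fun e => hij.ne (hinj e).symm
  filter_upwards [(tendsto_latticePt (τ := τ) hζp hζm hu i).eventually_lt
    (tendsto_latticePt (τ := τ) hζp hζm hu j) hlt,
    eventually_qFilter (P := fun q => 0 < q ∧ q < 1) zero_lt_one fun q _ h0 h1 => ⟨h0, h1⟩]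
    with q hq ⟨h0, h1⟩ hadm
  exact lt_asymm hq (latticePt_strictAnti hζp hζm h0 h1 (Real.rpow_pos_of_pos h0 τ)
    (Real.rpow_lt_one h0.le h1 hτ) hadm hij)

open MeasureTheory in
lemma ae_ne_zero_and_injective (N : ℕ) :
    ∀ᵐ u : Fin N → ℝ, (∀ i, u i ≠ 0) ∧ Function.Injective u := by
  have key : ∀ L : (Fin N → ℝ) →ₗ[ℝ] ℝ, L ≠ 0 → ∀ᵐ u : Fin N → ℝ, L u ≠ 0 := by
    intro L hL
    have h := Measure.addHaar_submodule (volume : Measure (Fin N → ℝ)) (LinearMap.ker L)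
      (fun h => hL (LinearMap.ker_eq_top.1 h))
    rw [ae_iff]
    convert h using 2
    ext u
    simp
  have h1 : ∀ᵐ u : Fin N → ℝ, ∀ i, u i ≠ 0 := by
    rw [ae_all_iff]
    intro i
    refine key (LinearMap.proj i) fun h => ?_
    simpa using LinearMap.congr_fun h (Pi.single i 1)
  have h2 : ∀ᵐ u : Fin N → ℝ, ∀ i j, i ≠ j → u i ≠ u j := by
    rw [ae_all_iff]
    intro i
    rw [ae_all_iff]
    intro j
    by_cases hij : i = j
    · exact Filter.Eventually.of_forall fun u h => absurd hij h
    · have := key ((LinearMap.proj i : (Fin N → ℝ) →ₗ[ℝ] ℝ) - LinearMap.proj j) fun h => by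
        have h1 := LinearMap.congr_fun h (Pi.single i (1 : ℝ))
        simp [Ne.symm hij] at h1
      filter_upwards [this] with u hu _ h
      exact hu (by simp [h])
  filter_upwards [h1, h2] with u hu1 hu2
  exact ⟨hu1, fun i j hij => by_contra fun h => hu2 i j h hij⟩

lemma integrable_prod_rpow {ρ : ℝ} (hρ : 1 / 2 < ρ) (N : ℕ) :
    MeasureTheory.Integrable (fun u : Fin N → ℝ => ∏ i, (1 + u i ^ 2) ^ (-ρ)) := by
  refine MeasureTheory.Integrable.fintype_prod (f := fun _ (x : ℝ) => (1 + x ^ 2) ^ (-ρ))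
    (μ := fun _ => MeasureTheory.volume) fun _ => ?_
  have h := integrable_rpow_neg_one_add_norm_sq (E := ℝ) (μ := MeasureTheory.volume) (r := 2 * ρ)
    (by simp; linarith)
  refine h.congr (Filter.Eventually.of_forall fun x => ?_)
  simp only [Real.norm_eq_abs, sq_abs]
  congr 1
  ring

lemma continuous_chamberDensity {τ : ℝ} (hτ : 0 < τ) (S : ℂ) (N : ℕ) :
    Continuous (chamberDensity τ S : (Fin N → ℝ) → ℝ) := by
  unfold chamberDensity
  refine Continuous.mul ?_ ?_
  · refine continuous_finsetProd _ fun i _ => continuous_finsetProd _ fun j _ => ?_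
    split_ifs
    · exact ((continuous_apply i).sub (continuous_apply j)).rpow_const
        fun _ => Or.inr (by positivity)
    · exact continuous_const
  · refine continuous_finsetProd _ fun i _ => ?_
    refine (Complex.continuous_exp.comp (Continuous.neg (continuous_const.mul
      (Continuous.clog ?_ ?_)))).norm.pow 2
    · fun_prop
    · intro u
      exact Or.inl (by simp)

lemma isOpen_strictAnti (N : ℕ) : IsOpen {u : Fin N → ℝ | StrictAnti u} := by
  have : {u : Fin N → ℝ | StrictAnti u} = ⋂ i, ⋂ j, {u | i < j → u j < u i} := by
    ext u
    simp [StrictAnti]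
  rw [this]
  refine isOpen_iInter_of_finite fun i => isOpen_iInter_of_finite fun j => ?_
  by_cases h : i < j
  · simpa [h] using isOpen_lt (continuous_apply j) (continuous_apply i)
  · simp [h]

lemma measurable_sDensity {τ : ℝ} (hτ : 0 < τ) (s : ℂ) (N : ℕ) : Measurable (sDensity τ s N) := by
  have : sDensity τ s N = {u : Fin N → ℝ | StrictAnti u}.indicator
      (chamberDensity τ (s + ((N : ℂ) - 1) * τ)) := by
    funext u
    by_cases hu : StrictAnti u
    · rw [Set.indicator_of_mem (show u ∈ {u : Fin N → ℝ | StrictAnti u} from hu),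
        sDensity_of_strictAnti τ s hu]
    · rw [Set.indicator_of_notMem (show u ∉ {u : Fin N → ℝ | StrictAnti u} from hu),
        sDensity_of_not_strictAnti τ s hu]
  rw [this]
  exact (continuous_chamberDensity hτ _ N).measurable.indicator (isOpen_strictAnti N).measurableSet

lemma sDensity_nonneg (τ : ℝ) (s : ℂ) {N : ℕ} (u : Fin N → ℝ) : 0 ≤ sDensity τ s N u := by
  by_cases hu : StrictAnti u
  · rw [sDensity_of_strictAnti τ s hu]; exact (chamberDensity_pos τ _ hu).le
  · rw [sDensity_of_not_strictAnti τ s hu]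

lemma integrable_sDensity {τ : ℝ} (hτ : 0 < τ) {s : ℂ} (hs : 1 / 2 < s.re) {N : ℕ} (hN : 1 ≤ N) :
    MeasureTheory.Integrable (sDensity τ s N) := by
  obtain ⟨ρ, hρ1, hρ2⟩ := exists_between hs
  obtain ⟨C, hC, hb⟩ := exists_cellDensity_bound hτ s (by linarith) hρ2 one_pos
    (neg_one_lt_zero (R := ℝ)) hN 0
  refine ((integrable_prod_rpow hρ1 N).const_mul C).mono'
    (measurable_sDensity hτ s N).aestronglyMeasurable ?_
  filter_upwards [ae_ne_zero_and_injective N] with u ⟨hu0, _⟩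
  by_cases hu : StrictAnti u
  · rw [sDensity_of_strictAnti τ s hu, Real.norm_eq_abs]
    have hspace : ∀ᶠ q in qFilter, ∀ i j, i < j →
        (0 < u j → u j ≤ u i * q ^ τ) ∧ (u i < 0 → -u i ≤ -u j * q ^ τ) := by
      rw [Filter.eventually_all]
      intro i
      rw [Filter.eventually_all]
      intro j
      by_cases hij : i < j
      · have e1 : ∀ᶠ q in qFilter, u j < u i * q ^ τ :=
          ((tendsto_rpow_qFilter τ).const_mul (u i)).eventually_const_lt (by simpa using hu hij)
        have e2 : ∀ᶠ q in qFilter, -u i < -u j * q ^ τ :=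
          ((tendsto_rpow_qFilter τ).const_mul (-u j)).eventually_const_lt (by simpa using hu hij)
        filter_upwards [e1, e2] with q h1 h2 _
        exact ⟨fun _ => h1.le, fun _ => h2.le⟩
      · exact Filter.Eventually.of_forall fun q h => absurd h hij
    refine le_of_tendsto (tendsto_cellDensity hτ _ one_pos (neg_one_lt_zero (R := ℝ)) 0
      (x := fun _ => u) hu hu0 fun i => tendsto_const_nhds).abs ?_
    filter_upwards [hb, hspace] with q h1 h2
    exact h1 u hu0 hu (fun i j hij => (h2 i j hij).1) fun i j hij => (h2 i j hij).2
  · rw [sDensity_of_not_strictAnti τ s hu, norm_zero]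
    exact mul_nonneg hC.le (Finset.prod_nonneg fun i _ => by positivity)

lemma integral_sDensity_pos {τ : ℝ} (hτ : 0 < τ) {s : ℂ} (hs : 1 / 2 < s.re) {N : ℕ}
    (hN : 1 ≤ N) : 0 < ∫ u, sDensity τ s N u := by
  rw [MeasureTheory.integral_pos_iff_support_of_nonneg (fun u => sDensity_nonneg τ s u)
    (integrable_sDensity hτ hs hN)]
  have hsub : {u : Fin N → ℝ | StrictAnti u} ⊆ Function.support (sDensity τ s N) := by
    intro u hu
    rw [Function.mem_support, sDensity_of_strictAnti τ s hu]
    exact (chamberDensity_pos τ _ hu).ne'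
  refine lt_of_lt_of_le ((isOpen_strictAnti N).measure_pos _ ⟨fun i => -(i : ℝ), ?_⟩)
    (MeasureTheory.measure_mono hsub)
  intro i j hij
  have : (i : ℕ) < j := hij
  simpa using this

open Classical in
/-- The summand attached to a cell, divided by the volume of the cell. -/
noncomputable def cellTerm (q τ : ℝ) (S : ℂ) (ζp ζm : ℝ) {N : ℕ} (k : ℕ) (f : (Fin N → ℝ) → ℝ)
    (n : Fin N → ℤ) : ℝ :=
  if Admissible k n then
    cellDensity q τ S ζp ζm k (latticePt q (q ^ τ) ζp ζm k n) * f (latticePt q (q ^ τ) ζp ζm k n)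
  else 0

section Limit

variable {τ : ℝ} {s : ℂ} {ζp ζm : ℝ} {N : ℕ} {f : (Fin N → ℝ) → ℝ}

lemma exists_cellTerm_bound (hτ : 0 < τ) (hs : 1 / 2 < s.re) (hζp : 0 < ζp) (hζm : ζm < 0)
    (hN : 1 ≤ N) (hf : ∃ C : ℝ, ∀ u, |f u| ≤ C) (k : ℕ) :
    ∃ g : (Fin N → ℝ) → ℝ, MeasureTheory.Integrable g ∧ ∀ᶠ q in qFilter, ∀ u ∈ signRegion N k,
      ‖cellTerm q τ (s + ((N : ℂ) - 1) * τ) ζp ζm k f (cellIndex q (q ^ τ) ζp ζm k u)‖ ≤ g u := by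
  obtain ⟨ρ, hρ1, hρ2⟩ := exists_between hs
  obtain ⟨B, hB⟩ := hf
  have hB0 : 0 ≤ B := (abs_nonneg _).trans (hB 0)
  obtain ⟨C, hC, hb⟩ := exists_cellDensity_bound hτ s (by linarith) hρ2 hζp hζm hN k
  refine ⟨fun u => C * B * ∏ i, (1 + u i ^ 2) ^ (-ρ), (integrable_prod_rpow hρ1 N).const_mul _, ?_⟩
  filter_upwards [hb, eventually_qFilter (P := fun q => 0 < q ∧ q < 1)
    zero_lt_one fun q _ h0 h1 => ⟨h0, h1⟩] with q hq ⟨h0, h1⟩ u hu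
  have ht := Real.rpow_pos_of_pos h0 τ
  have ht1 := Real.rpow_lt_one h0.le h1 hτ
  unfold cellTerm
  split_ifs with hadm
  · rw [Real.norm_eq_abs, abs_mul]
    have h2 := hq _ (latticePt_ne_zero hζp hζm h0 ht (cellIndex q (q ^ τ) ζp ζm k u))
      (latticePt_strictAnti hζp hζm h0 h1 ht ht1 hadm)
      (fun i j hij hj => latticePt_le_mul hζp hζm h0 h1 ht ht1 hadm hij
        ((latticePt_pos_iff hζp hζm h0 ht).1 hj))
      (fun i j hij hi => neg_latticePt_le_mul hζm h0 h1 ht ht1 hadm hij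
        (not_lt.1 fun h => lt_asymm hi ((latticePt_pos_iff hζp hζm h0 ht).2 h)))
    have h3 : ∏ i, (1 + latticePt q (q ^ τ) ζp ζm k (cellIndex q (q ^ τ) ζp ζm k u) i ^ 2) ^ (-ρ) ≤
        ∏ i, (1 + u i ^ 2) ^ (-ρ) :=
      Finset.prod_le_prod (fun i _ => by positivity) fun i _ =>
        Real.rpow_le_rpow_of_nonpos (by positivity)
          (by linarith [sq_le_sq_latticePt hζp hζm h0 h1 ht hu i]) (by linarith)
    calc _ ≤ (C * ∏ i, (1 + u i ^ 2) ^ (-ρ)) * B :=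
          mul_le_mul (h2.trans (mul_le_mul_of_nonneg_left h3 hC.le)) (hB _) (abs_nonneg _)
            (mul_nonneg hC.le (Finset.prod_nonneg fun i _ => by positivity))
      _ = _ := by ring
  · rw [norm_zero]
    exact mul_nonneg (mul_nonneg hC.le hB0) (Finset.prod_nonneg fun i _ => by positivity)

lemma measurable_cellTerm (q t : ℝ) (S : ℂ) (k : ℕ) :
    Measurable fun u => cellTerm q τ S ζp ζm k f (cellIndex q t ζp ζm k u) :=
  (measurable_of_countable (cellTerm q τ S ζp ζm k f)).comp measurable_cellIndex

lemma tendsto_cellTerm (hτ : 0 < τ) (hζp : 0 < ζp) (hζm : ζm < 0) (hf : Continuous f) (k : ℕ)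
    {u : Fin N → ℝ} (hu : u ∈ signRegion N k) (hu0 : ∀ i, u i ≠ 0) (hinj : Function.Injective u) :
    Filter.Tendsto (fun q => cellTerm q τ (s + ((N : ℂ) - 1) * τ) ζp ζm k f
      (cellIndex q (q ^ τ) ζp ζm k u)) qFilter (nhds (sDensity τ s N u * f u)) := by
  by_cases hanti : StrictAnti u
  · rw [sDensity_of_strictAnti τ s hanti]
    have hp := fun i => tendsto_latticePt (τ := τ) hζp hζm hu i
    refine ((tendsto_cellDensity hτ _ hζp hζm k hanti hu0 hp).mul
      ((hf.tendsto u).comp (tendsto_pi_nhds.2 hp))).congr' ?_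
    filter_upwards [eventually_admissible (τ := τ) hζp hζm hu hanti] with q hq
    rw [cellTerm, if_pos hq]
    rfl
  · rw [sDensity_of_not_strictAnti τ s hanti, zero_mul]
    refine tendsto_const_nhds.congr' ?_
    filter_upwards [eventually_not_admissible hτ hζp hζm hu hinj hanti] with q hq
    rw [cellTerm, if_neg hq]

lemma tendsto_integral_cellTerm (hτ : 0 < τ) (hs : 1 / 2 < s.re) (hζp : 0 < ζp) (hζm : ζm < 0)
    (hN : 1 ≤ N) (hfc : Continuous f) (hf : ∃ C : ℝ, ∀ u, |f u| ≤ C) (k : ℕ) :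
    (∀ᶠ q in qFilter, MeasureTheory.IntegrableOn (fun u =>
      cellTerm q τ (s + ((N : ℂ) - 1) * τ) ζp ζm k f (cellIndex q (q ^ τ) ζp ζm k u))
      (signRegion N k)) ∧
    Filter.Tendsto (fun q => ∫ u in signRegion N k,
      cellTerm q τ (s + ((N : ℂ) - 1) * τ) ζp ζm k f (cellIndex q (q ^ τ) ζp ζm k u)) qFilter
      (nhds (∫ u in signRegion N k, sDensity τ s N u * f u)) := by
  obtain ⟨g, hg, hb⟩ := exists_cellTerm_bound (f := f) hτ hs hζp hζm hN hf k
  have hb' : ∀ᶠ q in qFilter, ∀ᵐ u ∂MeasureTheory.volume.restrict (signRegion N k),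
      ‖cellTerm q τ (s + ((N : ℂ) - 1) * τ) ζp ζm k f (cellIndex q (q ^ τ) ζp ζm k u)‖ ≤ g u :=
    hb.mono fun q hq => (MeasureTheory.ae_restrict_mem (measurableSet_signRegion N k)).mono hq
  refine ⟨hb'.mono fun q hq => hg.restrict.mono'
    (measurable_cellTerm _ _ _ k).aestronglyMeasurable hq, ?_⟩
  refine MeasureTheory.tendsto_integral_filter_of_dominated_convergence g
    (Filter.Eventually.of_forall fun q => (measurable_cellTerm _ _ _ k).aestronglyMeasurable) hb'
    hg.restrict ?_
  filter_upwards [MeasureTheory.ae_restrict_mem (measurableSet_signRegion N k),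
    MeasureTheory.ae_restrict_of_ae (ae_ne_zero_and_injective N)] with u hu ⟨hu0, hinj⟩
  exact tendsto_cellTerm hτ hζp hζm hfc k hu hu0 hinj

lemma sum_integral_signRegion (hτ : 0 < τ) (hs : 1 / 2 < s.re) (hN : 1 ≤ N) (hfc : Continuous f)
    (hf : ∃ C : ℝ, ∀ u, |f u| ≤ C) :
    ∑ k ∈ Finset.range (N + 1), ∫ u in signRegion N k, sDensity τ s N u * f u =
      ∫ u, sDensity τ s N u * f u := by
  obtain ⟨B, hB⟩ := hf
  have h_int : MeasureTheory.Integrable fun u => sDensity τ s N u * f u :=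
    (integrable_sDensity hτ hs hN).mul_bdd hfc.aestronglyMeasurable
      (Filter.Eventually.of_forall hB)
  rw [← MeasureTheory.integral_biUnion_finset]
  · refine MeasureTheory.setIntegral_eq_integral_of_ae_compl_eq_zero ?_
    filter_upwards [ae_ne_zero_and_injective N] with u ⟨hu0, _⟩ hu
    rw [sDensity_of_not_strictAnti, zero_mul]
    intro hanti
    obtain ⟨k, hk, h⟩ := exists_sign_index hanti
    refine hu (Set.mem_biUnion (x := k) (by simpa [Nat.lt_succ_iff] using hk) fun i =>
      ⟨(h i).2, fun hi => lt_of_le_of_ne (not_lt.1 fun h' => ?_) (hu0 i)⟩)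
    exact absurd ((h i).1 h') (not_lt.2 hi)
  · exact fun k _ => measurableSet_signRegion N k
  · intro k hk l hl hkl
    rw [Function.onFun, Set.disjoint_left]
    have aux : ∀ k l : ℕ, k < l → l ≤ N → ∀ u : Fin N → ℝ, u ∈ signRegion N k →
        u ∉ signRegion N l := by
      intro k l hkl hl u hu hu'
      exact lt_asymm ((hu ⟨k, by omega⟩).2 le_rfl) ((hu' ⟨k, by omega⟩).1 hkl)
    simp only [Finset.coe_range, Set.mem_Iio, Nat.lt_succ_iff] at hk hl
    rcases lt_or_gt_of_ne hkl with h | h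
    · exact fun u => aux k l h hl u
    · exact fun u hu hu' => aux l k h hk u hu' hu
  · exact fun k _ => h_int.integrableOn

end Limit

/-- The unnormalized weight of a configuration under the parameters of the degeneration. -/
noncomputable def degenerateWeight (τ : ℝ) (s : ℂ) (ζp ζm : ℝ) (N : ℕ) (q : ℝ) (X : Finset ℝ) : ℝ :=
  (Mtilde q (q ^ τ) ζp ζm N (-Complex.I * (q : ℂ) ^ s)
    (Complex.I * (q : ℂ) ^ ((starRingEnd ℂ) s))
    (-Complex.I * ((q ^ τ : ℝ) : ℂ) ^ (1 - (N : ℤ)))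
    (Complex.I * ((q ^ τ : ℝ) : ℂ) ^ (1 - (N : ℤ))) X).re

lemma exists_hasSum_degenerateWeight {τ : ℝ} (hτ : 0 < τ) {s : ℂ} (hs : 1 / 2 < s.re) {ζp ζm : ℝ}
    (hζp : 0 < ζp) (hζm : ζm < 0) {N : ℕ} (hN : 1 ≤ N) {f : (Fin N → ℝ) → ℝ} (hfc : Continuous f)
    (hf : ∃ C : ℝ, ∀ u, |f u| ≤ C) :
    ∃ B : ℝ → ℝ, (∀ᶠ q in qFilter, HasSum (fun X : OmegaN q (q ^ τ) ζp ζm N =>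
      degenerateWeight τ s ζp ζm N q X * f (decVec N X)) (B q)) ∧
      Filter.Tendsto B qFilter (nhds (∫ u, sDensity τ s N u * f u)) := by
  have hlim := tendsto_integral_cellTerm (f := f) hτ hs hζp hζm hN hfc hf
  refine ⟨fun q => ∑ k ∈ Finset.range (N + 1), ∫ u in signRegion N k,
    cellTerm q τ (s + ((N : ℂ) - 1) * τ) ζp ζm k f (cellIndex q (q ^ τ) ζp ζm k u), ?_, ?_⟩
  · have h_int := (Filter.eventually_all_finset (Finset.range (N + 1))).2 fun k _ => (hlim k).1
    filter_upwards [h_int, eventually_qFilter (P := fun q => 0 < q ∧ q < 1)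
      zero_lt_one fun q _ h0 h1 => ⟨h0, h1⟩] with q hq ⟨h0, h1⟩
    have ht := Real.rpow_pos_of_pos h0 τ
    have ht1 := Real.rpow_lt_one h0.le h1 hτ
    refine hasSum_OmegaN hζp hζm h0 h1 ht ht1
      (fun X => degenerateWeight τ s ζp ζm N q X * f (decVec N X)) _ fun k hk => ?_
    refine (hasSum_cells hζp hζm h0 h1 ht _
      (hq k (Finset.mem_range.2 (Nat.lt_succ_iff.2 hk)))).congr_fun fun n => ?_
    unfold cellTerm
    split_ifs with hn
    · rw [degenerateWeight, Mtilde_latticeConfig hζp hζm h0 h1 hτ s hk hn, latticeConfig,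
        decVec_image (latticePt_strictAnti hζp hζm h0 h1 ht ht1 hn), mul_assoc]
    · rw [mul_zero]
  · rw [← sum_integral_signRegion hτ hs hN hfc hf]
    exact tendsto_finsetSum _ fun k _ => (hlim k).2

lemma integral_sMeasure {τ : ℝ} (hτ : 0 < τ) {s : ℂ} (hs : 1 / 2 < s.re) {N : ℕ} (hN : 1 ≤ N)
    (f : (Fin N → ℝ) → ℝ) :
    ∫ u, f u ∂(sMeasure τ s N) = (∫ u, sDensity τ s N u * f u) / ∫ u, sDensity τ s N u := by
  have hZ := integral_sDensity_pos hτ hs hN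
  rw [sMeasure, MeasureTheory.integral_smul_measure,
    integral_withDensity_eq_integral_toReal_smul (measurable_sDensity hτ s N).ennreal_ofReal
      (Filter.Eventually.of_forall fun u => ENNReal.ofReal_lt_top),
    ENNReal.toReal_inv, ENNReal.toReal_ofReal hZ.le, smul_eq_mul, div_eq_inv_mul]
  simp only [ENNReal.toReal_ofReal (sDensity_nonneg τ s _), smul_eq_mul]

lemma eventually_principalSeries {s : ℂ} (hs : 1 / 2 < s.re) :
    ∀ᶠ q in qFilter, PrincipalSeries q (-Complex.I * (q : ℂ) ^ s)
      (Complex.I * (q : ℂ) ^ ((starRingEnd ℂ) s)) (-Complex.I) Complex.I := by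
  have hcos : Filter.Tendsto (fun q : ℝ => Real.cos (Real.log q * s.im)) qFilter (nhds 1) := by
    have h1 : Filter.Tendsto (fun q : ℝ => Real.log q) qFilter (nhds 0) := by
      simpa [Function.comp_def] using (Real.continuousAt_log one_ne_zero).tendsto.comp tendsto_id_qFilter
    simpa [Function.comp_def] using (Real.continuous_cos.tendsto _).comp (h1.mul_const s.im)
  filter_upwards [hcos.eventually_const_lt zero_lt_one,
    eventually_qFilter (P := fun q => 0 < q ∧ q < 1)
      zero_lt_one fun q _ h0 h1 => ⟨h0, h1⟩] with q hq ⟨h0, h1⟩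
  have hqc : (q : ℂ) ≠ 0 := Complex.ofReal_ne_zero.2 h0.ne'
  have harg : (q : ℂ).arg ≠ Real.pi := by
    rw [Complex.arg_ofReal_of_nonneg h0.le]; exact Real.pi_ne_zero.symm
  have hconj := Complex.cpow_conj (q : ℂ) s harg
  rw [Complex.conj_ofReal] at hconj
  refine ⟨?_, ?_, by simp, by simp, ?_⟩
  · rw [hconj, map_mul, Complex.conj_conj, Complex.conj_I]
  · have e : (-Complex.I * (q : ℂ) ^ s).im = -((q : ℂ) ^ s).re := by simp
    rw [e, Complex.cpow_def_of_ne_zero hqc, ← Complex.ofReal_log h0.le, Complex.exp_re]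
    have : ((Real.log q : ℂ) * s).im = Real.log q * s.im := by simp
    rw [this]
    exact neg_ne_zero.2 (mul_pos (Real.exp_pos _) hq).ne'
  · have e : -Complex.I * (q : ℂ) ^ s * (Complex.I * (q : ℂ) ^ ((starRingEnd ℂ) s)) =
        ((q ^ (2 * s.re) : ℝ) : ℂ) := by
      have : -Complex.I * (q : ℂ) ^ s * (Complex.I * (q : ℂ) ^ ((starRingEnd ℂ) s)) =
          -(Complex.I * Complex.I) * ((q : ℂ) ^ s * (q : ℂ) ^ ((starRingEnd ℂ) s)) := by ring
      rw [this, Complex.I_mul_I, neg_neg, one_mul, ← Complex.cpow_add _ _ hqc, Complex.add_conj,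
        Complex.ofReal_cpow h0.le]
    rw [e, Complex.ofReal_re]
    have : (-Complex.I * Complex.I).re = 1 := by simp
    rw [this, one_mul]
    exact Real.rpow_lt_self_of_lt_one h0 h1 (by linarith)

open MeasureTheory in
/-- Degeneration to continuous beta-ensembles: as `q → 1⁻`, with `t = q^τ`,
`α = -i q^s`, `β = i q^{s̄}`, `γ = -i`, `δ = i` (a principal-series quadruple for `q`
close to 1), the push-forward of the hypergeometric measures `M_N^{q,t;α,β,γ,δ}` under
the map listing the points of a configuration in decreasing order converges weakly to
the s-measure `P_N^{τ;s}`. -/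
theorem stmt17 (τ : ℝ) (hτ : 0 < τ) (s : ℂ) (hs : 1 / 2 < s.re)
    (ζp ζm : ℝ) (hζp : 0 < ζp) (hζm : ζm < 0) (N : ℕ) (hN : 1 ≤ N) :
    let t : ℝ → ℝ := fun q => q ^ τ
    let α : ℝ → ℂ := fun q => -Complex.I * (q : ℂ) ^ s
    let β : ℝ → ℂ := fun q => Complex.I * (q : ℂ) ^ ((starRingEnd ℂ) s)
    let Mw : ℝ → Finset ℝ → ℝ := fun q X =>
      (Mtilde q (t q) ζp ζm N (α q) (β q)
        (-Complex.I * ((t q : ℝ) : ℂ) ^ (1 - (N : ℤ)))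
        (Complex.I * ((t q : ℝ) : ℂ) ^ (1 - (N : ℤ))) X).re
    let Z : ℝ → ℝ := fun q => ∑' X : OmegaN q (t q) ζp ζm N, Mw q (X : Finset ℝ)
    (∀ᶠ q in nhdsWithin 1 (Set.Ioo (0 : ℝ) 1),
      PrincipalSeries q (α q) (β q) (-Complex.I) Complex.I ∧
      Summable (fun X : OmegaN q (t q) ζp ζm N => Mw q (X : Finset ℝ)) ∧ 0 < Z q) ∧
    MeasureTheory.Integrable (sDensity τ s N) MeasureTheory.volume ∧
    0 < (∫ u, sDensity τ s N u) ∧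
    ∀ f : (Fin N → ℝ) → ℝ, Continuous f → (∃ C : ℝ, ∀ u, |f u| ≤ C) →
      Filter.Tendsto
        (fun q : ℝ => ∑' X : OmegaN q (t q) ζp ζm N,
          (Mw q (X : Finset ℝ) / Z q) * f (decVec N (X : Finset ℝ)))
        (nhdsWithin 1 (Set.Ioo (0 : ℝ) 1))
        (nhds (∫ u, f u ∂(sMeasure τ s N))) := by
  intro t α β Mw Z
  obtain ⟨B₁, hB₁, hlim₁⟩ := exists_hasSum_degenerateWeight hτ hs hζp hζm hN
    (f := fun _ => (1 : ℝ)) continuous_const ⟨1, fun _ => by simp⟩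
  simp only [mul_one] at hB₁ hlim₁
  have hpos := integral_sDensity_pos hτ hs hN
  have hZ : ∀ᶠ q in qFilter, Z q = B₁ q := hB₁.mono fun q hq => hq.tsum_eq
  refine ⟨?_, integrable_sDensity hτ hs hN, hpos, fun f hfc hf => ?_⟩
  · filter_upwards [eventually_principalSeries hs, hB₁, hZ, hlim₁.eventually_const_lt hpos]
      with q h1 h2 h3 h4
    exact ⟨h1, h2.summable, h3.symm ▸ h4⟩
  · obtain ⟨B, hB, hlim⟩ := exists_hasSum_degenerateWeight hτ hs hζp hζm hN hfc hf
    rw [integral_sMeasure hτ hs hN]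
    refine (hlim.div hlim₁ hpos.ne').congr' ?_
    filter_upwards [hB, hZ] with q h1 h2
    rw [Pi.div_apply, ← h2, ← (h1.div_const (Z q)).tsum_eq]
    refine tsum_congr fun X => ?_
    exact (div_mul_eq_mul_div _ _ _).symm
end

section
/- Fix q, t ∈ (0,1), ζ₊ > 0, ζ₋ < 0. The space Ω̃ is a locally compact, separable Hausdorff topological space; moreover, the subset Ω_∞ of infinite configurations is dense in Ω̃, and its complement ⋃_{N=0}^∞ Ω_N (the set of finite configurations, including the empty one) is also dense in Ω̃. -/
/-- The space `Ω̃` of all (finite or infinite) configurations. -/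
def OmegaTilde (q t ζp ζm : ℝ) : Type := {X : Set ℝ // IsConfig q t ζp ζm X}

/-- The topology on a space of configurations determined by the uniform structure in
which two configurations are ε-close iff they coincide outside `(-ε, ε)`. -/
def configTop {Γ : Type} (pts : Γ → Set ℝ) : TopologicalSpace Γ :=
  TopologicalSpace.generateFrom
    {S | ∃ (Y : Γ) (ε : ℝ), 0 < ε ∧ S = {Z | ∀ x : ℝ, ε ≤ |x| → (x ∈ pts Y ↔ x ∈ pts Z)}}

/-- The topology of `Ω̃`. -/
noncomputable def cylTop (q t ζp ζm : ℝ) : TopologicalSpace (OmegaTilde q t ζp ζm) :=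
  configTop (fun X => X.1)

open Filter Topology

/-- The conditions of `IsConfig` that concern the positive part of `X`. -/
def IsHalfConfig (q t ζ : ℝ) (X : Set ℝ) : Prop :=
  (∀ x ∈ X, 0 < x → {y ∈ X | x < y}.Finite) ∧
  (∀ x ∈ X, 0 < x → (∀ y ∈ X, 0 < y → y ≤ x) → ∃ n : ℤ, x = ζ * q ^ n) ∧
  (∀ x ∈ X, ∀ y ∈ X, 0 < y → y < x → (∀ z ∈ X, z ≤ y ∨ x ≤ z) → ∃ k : ℕ, y = x * t * q ^ k)

theorem isConfig_iff {q t ζp ζm : ℝ} {X : Set ℝ} :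
    IsConfig q t ζp ζm X ↔ X.Countable ∧ (0 : ℝ) ∉ X ∧ IsHalfConfig q t ζp X ∧
      IsHalfConfig q t (-ζm) {x | -x ∈ X} := by
  have hfin (x : ℝ) : {y ∈ {y | -y ∈ X} | x < y}.Finite ↔ {y ∈ X | y < -x}.Finite := by
    have h : {y ∈ {y | -y ∈ X} | x < y} = Neg.neg ⁻¹' {y ∈ X | y < -x} := by
      ext y; simp
    rw [h]
    constructor
    · intro h'
      have := h'.image Neg.neg
      rwa [Set.image_preimage_eq _ neg_surjective] at this
    · exact fun h' => h'.preimage neg_injective.injOn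
  constructor
  · rintro ⟨h1, h2, h3, h4, h5, h6, h7, h8⟩
    refine ⟨h1, h2, ⟨h3, h5, h7⟩, ?_, ?_, ?_⟩
    · intro x hx h0
      exact (hfin x).2 (h4 _ hx (by linarith))
    · intro x hx h0 hm
      obtain ⟨n, hn⟩ := h6 (-x) hx (by linarith) fun y hy hy0 => by
        have := hm (-y) (by simpa using hy) (by linarith)
        linarith
      exact ⟨n, by linarith⟩
    · intro x hx y hy h0 hxy hz
      obtain ⟨k, hk⟩ := h8 (-y) hy (-x) hx (by linarith) (by linarith) fun z hz' => by
        rcases hz (-z) (by simpa using hz') with h | h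
        · right; linarith
        · left; linarith
      exact ⟨k, by linarith⟩
  · rintro ⟨h1, h2, ⟨h3, h5, h7⟩, h4, h6, h8⟩
    refine ⟨h1, h2, h3, ?_, h5, ?_, h7, ?_⟩
    · intro x hx h0
      simpa using (hfin (-x)).1 (h4 (-x) (by simpa using hx) (by linarith))
    · intro x hx h0 hm
      obtain ⟨n, hn⟩ := h6 (-x) (by simpa using hx) (by linarith) fun y hy hy0 => by
        have := hm (-y) hy (by linarith)
        linarith
      exact ⟨n, by linarith⟩
    · intro x hx y hy hxy h0 hz
      obtain ⟨k, hk⟩ := h8 (-y) (by simpa using hy) (-x) (by simpa using hx) (by linarith)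
        (by linarith) fun z hz' => by
          rcases hz (-z) hz' with h | h
          · right; linarith
          · left; linarith
      exact ⟨k, by linarith⟩

namespace IsHalfConfig

variable {q t ζ : ℝ} {X : Set ℝ}

theorem exists_eq_of_le (hq0 : 0 < q) (hq1 : q < 1) (hζ : 0 < ζ)
    (hX : IsHalfConfig q t ζ X) {R : ℝ} (hR : ∀ x ∈ X, 0 < x → x ≤ R) {x : ℝ} (hx : x ∈ X)
    (hx0 : 0 < x) : ∃ (a : ℕ) (n : ℤ), x = ζ * q ^ n * t ^ a ∧ ζ * q ^ n ≤ R := by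
  obtain ⟨h1, h2, h3⟩ := hX
  induction hc : {y ∈ X | x < y}.ncard using Nat.strong_induction_on generalizing x with
  | _ c ih =>
    rcases {y ∈ X | x < y}.eq_empty_or_nonempty with he | hne
    · obtain ⟨n, hn⟩ := h2 x hx hx0 fun y hy _ => by
        by_contra! h
        exact (he ▸ (⟨hy, h⟩ : y ∈ {y ∈ X | x < y}) : y ∈ (∅ : Set ℝ))
      exact ⟨0, n, by simpa using hn, hn ▸ hR x hx hx0⟩
    · obtain ⟨y, ⟨hyX, hxy⟩, hmin⟩ := (h1 x hx hx0).exists_minimalFor id _ hne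
      have hmin' : ∀ z ∈ X, x < z → y ≤ z := fun z hz hxz => by
        rcases le_total y z with h | h
        · exact h
        · exact hmin ⟨hz, hxz⟩ h
      obtain ⟨a, n, hy, hn⟩ := ih _ (by
        rw [← hc]
        refine Set.ncard_lt_ncard ?_ (h1 x hx hx0)
        refine ⟨fun z hz => ⟨hz.1, hxy.trans hz.2⟩, fun h => ?_⟩
        exact lt_irrefl y (h ⟨hyX, hxy⟩).2) hyX (hx0.trans hxy) rfl
      obtain ⟨k, hk⟩ := h3 y hyX x hx hx0 hxy fun z hz => by
        rcases le_or_gt z x with h | h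
        · exact Or.inl h
        · exact Or.inr (hmin' z hz h)
      refine ⟨a + 1, n + k, ?_, ?_⟩
      · rw [hk, hy, zpow_add₀ hq0.ne', zpow_natCast]; ring
      · refine le_trans ?_ hn
        rw [zpow_add₀ hq0.ne', zpow_natCast, ← mul_assoc]
        exact mul_le_of_le_one_right (by positivity) (pow_le_one₀ hq0.le hq1.le)

theorem congr_of_local (h : ∀ δ > 0, ∃ Z, IsHalfConfig q t ζ Z ∧ ∀ x, δ ≤ x → (x ∈ X ↔ x ∈ Z)) :
    IsHalfConfig q t ζ X := by
  refine ⟨?_, ?_, ?_⟩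
  · intro x hx hx0
    obtain ⟨Z, hZ, hXZ⟩ := h x hx0
    refine (hZ.1 x ((hXZ x le_rfl).1 hx) hx0).subset fun y hy => ?_
    exact ⟨(hXZ y hy.2.le).1 hy.1, hy.2⟩
  · intro x hx hx0 hm
    obtain ⟨Z, hZ, hXZ⟩ := h x hx0
    refine hZ.2.1 x ((hXZ x le_rfl).1 hx) hx0 fun y hy hy0 => ?_
    by_contra! hxy
    exact absurd (hm y ((hXZ y hxy.le).2 hy) hy0) hxy.not_ge
  · intro x hx y hy hy0 hyx hz
    obtain ⟨Z, hZ, hXZ⟩ := h y hy0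
    refine hZ.2.2 x ((hXZ x hyx.le).1 hx) y ((hXZ y le_rfl).1 hy) hy0 hyx fun z hzZ => ?_
    rcases le_or_gt z y with hzy | hzy
    · exact Or.inl hzy
    · exact hz z ((hXZ z hzy.le).2 hzZ)

theorem truncate (hX : IsHalfConfig q t ζ X) (δ : ℝ) :
    IsHalfConfig q t ζ {x ∈ X | δ ≤ |x|} := by
  refine ⟨?_, ?_, ?_⟩
  · intro x hx hx0
    exact (hX.1 x hx.1 hx0).subset fun y hy => ⟨hy.1.1, hy.2⟩
  · intro x hx hx0 hm
    refine hX.2.1 x hx.1 hx0 fun y hy hy0 => ?_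
    by_contra! hxy
    refine absurd (hm y ⟨hy, hx.2.trans ?_⟩ hy0) hxy.not_ge
    rw [abs_of_pos hx0, abs_of_pos hy0]
    exact hxy.le
  · intro x hx y hy hy0 hyx hz
    refine hX.2.2 x hx.1 y hy.1 hy0 hyx fun z hzX => ?_
    rcases le_or_gt z y with hzy | hzy
    · exact Or.inl hzy
    · refine hz z ⟨hzX, hy.2.trans ?_⟩
      rw [abs_of_pos hy0, abs_of_pos (hy0.trans hzy)]
      exact hzy.le

theorem exists_le (hX : IsHalfConfig q t ζ X) : ∃ R, ∀ x ∈ X, 0 < x → x ≤ R := by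
  by_cases h : ∃ x ∈ X, 0 < x
  · obtain ⟨x, hx, hx0⟩ := h
    obtain ⟨R, hR⟩ := (hX.1 x hx hx0).bddAbove
    refine ⟨max x R, fun y hy _ => ?_⟩
    rcases le_or_gt y x with h | h
    · exact le_max_of_le_left h
    · exact le_max_of_le_right (hR ⟨hy, h⟩)
  · push Not at h
    exact ⟨0, fun x hx _ => h x hx⟩

/-- The positions in `[δ, ∞)` that a half configuration bounded by `R` can occupy. -/
theorem finite_positions (hq0 : 0 < q) (hq1 : q < 1) (ht0 : 0 < t) (ht1 : t < 1) (hζ : 0 < ζ)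
    {δ : ℝ} (hδ : 0 < δ) (R : ℝ) :
    {x : ℝ | δ ≤ x ∧ ∃ (a : ℕ) (n : ℤ), x = ζ * q ^ n * t ^ a ∧ ζ * q ^ n ≤ R}.Finite := by
  rcases le_or_gt R 0 with hR | hR
  · refine Set.Finite.subset Set.finite_empty ?_
    rintro x ⟨-, a, n, -, h⟩
    have : 0 < ζ * q ^ n := by positivity
    linarith
  obtain ⟨A, hA⟩ := exists_pow_lt_of_lt_one (div_pos hδ hR) ht1
  obtain ⟨M, hM⟩ := exists_pow_lt_of_lt_one (div_pos hζ hR) hq1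
  obtain ⟨N, hN⟩ := exists_pow_lt_of_lt_one (div_pos hδ hζ) hq1
  refine (((Set.finite_Iic A).prod (Set.finite_Icc (-(M : ℤ)) N)).image
    fun p => ζ * q ^ p.2 * t ^ p.1).subset ?_
  rintro x ⟨hδx, a, n, rfl, hn⟩
  refine ⟨(a, n), ⟨?_, ?_, ?_⟩, rfl⟩
  · by_contra! h
    have h1 : t ^ a ≤ t ^ A := pow_le_pow_of_le_one ht0.le ht1.le (by simpa using (not_le.1 h).le)
    have h2 : ζ * q ^ n * t ^ a ≤ R * t ^ A := by gcongr
    have h3 := (lt_div_iff₀ hR).1 hA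
    linarith
  · by_contra! h
    have h1 : q ^ (-(M : ℤ)) ≤ q ^ n := zpow_le_zpow_right_of_le_one₀ hq0 hq1.le h.le
    rw [zpow_neg, zpow_natCast] at h1
    have h3 := (lt_div_iff₀ hR).1 hM
    have h5 : R < ζ * (q ^ M)⁻¹ := by
      rw [← div_eq_mul_inv, lt_div_iff₀ (by positivity)]; linarith
    have h6 : ζ * (q ^ M)⁻¹ ≤ ζ * q ^ n := by gcongr
    linarith
  · by_contra! h
    have h1 : q ^ n ≤ q ^ (N : ℤ) := zpow_le_zpow_right_of_le_one₀ hq0 hq1.le h.le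
    rw [zpow_natCast] at h1
    have h3 := (lt_div_iff₀ hζ).1 hN
    have h4 : ζ * q ^ n * t ^ a ≤ ζ * q ^ n :=
      mul_le_of_le_one_right (by positivity) (pow_le_one₀ ht0.le ht1.le)
    have h5 : ζ * q ^ n ≤ ζ * q ^ N := by gcongr
    linarith

theorem mem_positions (hq0 : 0 < q) (hq1 : q < 1) (hζ : 0 < ζ)
    (hX : IsHalfConfig q t ζ X) {δ R : ℝ} (hδ : 0 < δ) (hR : ∀ x ∈ X, 0 < x → x ≤ R) {x : ℝ}
    (hx : x ∈ X) (hδx : δ ≤ x) :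
    x ∈ {x : ℝ | δ ≤ x ∧ ∃ (a : ℕ) (n : ℤ), x = ζ * q ^ n * t ^ a ∧ ζ * q ^ n ≤ R} :=
  ⟨hδx, hX.exists_eq_of_le hq0 hq1 hζ hR hx (hδ.trans_le hδx)⟩

/-- A half configuration with finitely many points, none of them in `(0, δ)`, can be continued
by a geometric progression inside `(0, δ)`. -/
theorem exists_extension (hq0 : 0 < q) (hq1 : q < 1) (ht0 : 0 < t) (ht1 : t < 1) (hζ : 0 < ζ)
    (hX : IsHalfConfig q t ζ X) (hfin : X.Finite) {δ : ℝ} (hδ : 0 < δ)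
    (hXδ : ∀ x ∈ X, 0 < x → δ ≤ x) :
    ∃ c, 0 < c ∧ c < δ ∧ IsHalfConfig q t ζ (X ∪ Set.range fun k : ℕ => c * t ^ k) := by
  obtain ⟨c, hc0, hcδ, hctop, hcgap⟩ : ∃ c, 0 < c ∧ c < δ ∧
      ((∀ x ∈ X, ¬ 0 < x) → ∃ n : ℤ, c = ζ * q ^ n) ∧
      ∀ m ∈ X, 0 < m → (∀ z ∈ X, 0 < z → m ≤ z) → ∃ k : ℕ, c = m * t * q ^ k := by
    rcases {x ∈ X | 0 < x}.eq_empty_or_nonempty with he | hne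
    · have he' : ∀ x ∈ X, ¬ 0 < x := fun x hx h0 =>
        (he ▸ (⟨hx, h0⟩ : x ∈ {x ∈ X | 0 < x}) : x ∈ (∅ : Set ℝ))
      obtain ⟨N, hN⟩ := exists_pow_lt_of_lt_one (div_pos hδ hζ) hq1
      have h3 := (lt_div_iff₀ hζ).1 hN
      exact ⟨ζ * q ^ N, by positivity, by linarith, fun _ => ⟨N, by simp⟩,
        fun m hm hm0 => absurd hm0 (he' m hm)⟩
    · obtain ⟨m, ⟨hm, hm0⟩, hmin⟩ :=
        (hfin.subset (Set.sep_subset X _)).exists_minimalFor id _ hne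
      have hmt : 0 < m * t := by positivity
      obtain ⟨N, hN⟩ := exists_pow_lt_of_lt_one (div_pos hδ hmt) hq1
      have h3 := (lt_div_iff₀ hmt).1 hN
      refine ⟨m * t * q ^ N, by positivity, by linarith, fun h => absurd hm0 (h m hm),
        fun m' hm' hm0' hmin' => ⟨N, ?_⟩⟩
      have h1 : m' ≤ m := hmin' m hm hm0
      rw [le_antisymm h1 (hmin ⟨hm', hm0'⟩ h1)]
  have hEpos (k : ℕ) : 0 < c * t ^ k := by positivity
  have hEle (k : ℕ) : c * t ^ k ≤ c :=
    mul_le_of_le_one_right hc0.le (pow_le_one₀ ht0.le ht1.le)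
  have hElt {i j : ℕ} : c * t ^ i < c * t ^ j ↔ j < i := by
    rw [mul_lt_mul_iff_right₀ hc0, pow_lt_pow_iff_right_of_lt_one₀ ht0 ht1]
  have hcE : c ∈ X ∪ Set.range fun k : ℕ => c * t ^ k := Or.inr ⟨0, by simp⟩
  refine ⟨c, hc0, hcδ, ?_, ?_, ?_⟩
  · rintro x (hx | ⟨k, rfl⟩) hx0
    · refine hfin.subset ?_
      rintro y ⟨hy | ⟨j, rfl⟩, hxy⟩
      · exact hy
      · have := hXδ x hx hx0
        have := hEle j
        dsimp only at hxy
        linarith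
    · refine (hfin.union ((Set.finite_Iio k).image fun k : ℕ => c * t ^ k)).subset ?_
      rintro y ⟨hy | ⟨j, rfl⟩, hxy⟩
      · exact Or.inl hy
      · exact Or.inr ⟨j, hElt.1 hxy, rfl⟩
  · rintro x (hx | ⟨k, rfl⟩) hx0 hm
    · exact hX.2.1 x hx hx0 fun y hy => hm y (Or.inl hy)
    · have h1 : c * t ^ k = c := le_antisymm (hEle k) (hm c hcE hc0)
      dsimp only
      rw [h1]
      refine hctop fun x hx h0 => ?_
      have := hm x (Or.inl hx) h0
      have := hXδ x hx h0
      have := hEle k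
      linarith
  · rintro x (hx | ⟨i, rfl⟩) y (hy | ⟨j, rfl⟩) hy0 hyx hz
    · exact hX.2.2 x hx y hy hy0 hyx fun z hzX => hz z (Or.inl hzX)
    · have hx0 := hy0.trans hyx
      have hxδ := hXδ x hx hx0
      have hjc := hEle j
      dsimp only at hyx hz ⊢
      have h1 : c * t ^ j = c := by
        rcases hz c hcE with h | h
        · exact le_antisymm hjc h
        · linarith
      rw [h1]
      refine hcgap x hx hx0 fun z hzX hz0 => ?_
      rcases hz z (Or.inl hzX) with h | h
      · have := hXδ z hzX hz0
        linarith
      · exact h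
    · have := hXδ y hy hy0
      have := hEle i
      dsimp only at hyx
      linarith
    · dsimp only at hyx hz ⊢
      have hij := hElt.1 hyx
      have hji : j ≤ i + 1 := by
        by_contra! h
        rcases hz _ (Or.inr ⟨i + 1, rfl⟩) with h' | h'
        · exact absurd (hElt.2 h) h'.not_gt
        · exact absurd (hElt.2 (Nat.lt_succ_self i)) h'.not_gt
      obtain rfl : j = i + 1 := by omega
      exact ⟨0, by ring⟩

end IsHalfConfig

section Topology

variable {Γ : Type} {pts : Γ → Set ℝ}

/-- The configurations that coincide with `Y` outside `(-ε, ε)`. -/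
def configBall (pts : Γ → Set ℝ) (Y : Γ) (ε : ℝ) : Set Γ :=
  {Z | ∀ x : ℝ, ε ≤ |x| → (x ∈ pts Y ↔ x ∈ pts Z)}

theorem isOpen_configTop_iff {S : Set Γ} :
    IsOpen[configTop pts] S ↔ ∀ Z ∈ S, ∃ ε > 0, configBall pts Z ε ⊆ S := by
  constructor
  · intro h
    change TopologicalSpace.GenerateOpen _ S at h
    induction h with
    | basic s hs =>
      obtain ⟨Y, ε, hε, rfl⟩ := hs
      intro Z hZ
      exact ⟨ε, hε, fun W hW x hx => (hZ x hx).trans (hW x hx)⟩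
    | univ => exact fun Z _ => ⟨1, one_pos, Set.subset_univ _⟩
    | inter s u _ _ ihs ihu =>
      intro Z hZ
      obtain ⟨ε, hε, h1⟩ := ihs Z hZ.1
      obtain ⟨δ, hδ, h2⟩ := ihu Z hZ.2
      exact ⟨min ε δ, lt_min hε hδ, fun W hW =>
        ⟨h1 fun x hx => hW x ((min_le_left _ _).trans hx),
          h2 fun x hx => hW x ((min_le_right _ _).trans hx)⟩⟩
    | sUnion S _ ih =>
      rintro Z ⟨s, hs, hZ⟩
      obtain ⟨ε, hε, h⟩ := ih s hs Z hZ
      exact ⟨ε, hε, h.trans (Set.subset_sUnion_of_mem hs)⟩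
  · intro h
    let := configTop pts
    refine isOpen_iff_mem_nhds.2 fun Z hZ => ?_
    obtain ⟨ε, hε, hs⟩ := h Z hZ
    refine mem_of_superset (IsOpen.mem_nhds (s := configBall pts Z ε) ?_ fun x _ => Iff.rfl) hs
    exact TopologicalSpace.isOpen_generateFrom_of_mem ⟨Z, ε, hε, rfl⟩

theorem isOpen_configBall {Y : Γ} {ε : ℝ} (hε : 0 < ε) :
    IsOpen[configTop pts] (configBall pts Y ε) :=
  TopologicalSpace.isOpen_generateFrom_of_mem ⟨Y, ε, hε, rfl⟩

theorem mem_nhds_configTop_iff {Z : Γ} {S : Set Γ} :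
    S ∈ @nhds _ (configTop pts) Z ↔ ∃ ε > 0, configBall pts Z ε ⊆ S := by
  let := configTop pts
  constructor
  · intro h
    obtain ⟨s, hs, hso, hZ⟩ := mem_nhds_iff.1 h
    obtain ⟨ε, hε, h'⟩ := isOpen_configTop_iff.1 hso Z hZ
    exact ⟨ε, hε, h'.trans hs⟩
  · rintro ⟨ε, hε, h⟩
    exact mem_of_superset ((isOpen_configBall hε).mem_nhds fun x _ => Iff.rfl) h

theorem dense_configTop {S : Set Γ}
    (h : ∀ Z : Γ, ∀ ε > 0, ∃ W ∈ S, W ∈ configBall pts Z ε) : @Dense _ (configTop pts) S := by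
  let := configTop pts
  intro Z
  refine mem_closure_iff_nhds.2 fun s hs => ?_
  obtain ⟨ε, hε, hs'⟩ := mem_nhds_configTop_iff.1 hs
  obtain ⟨W, hWS, hW⟩ := h Z ε hε
  exact ⟨W, hs' hW, hWS⟩

end Topology

section Config

variable {q t ζp ζm : ℝ} {X : Set ℝ}

theorem IsConfig.of_local
    (h : ∀ δ > 0, ∃ Z, IsConfig q t ζp ζm Z ∧ ∀ x : ℝ, δ ≤ |x| → (x ∈ X ↔ x ∈ Z)) (h0 : (0 : ℝ) ∉ X) :
    IsConfig q t ζp ζm X := by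
  refine isConfig_iff.2 ⟨?_, h0, ?_, ?_⟩
  · choose! Z hZ hXZ using h
    refine (Set.countable_iUnion fun n : ℕ => (hZ (1 / ((n : ℝ) + 1)) (by positivity)).1).mono ?_
    intro x hx
    have hx0 : 0 < |x| := abs_pos.2 fun hx0 => h0 (hx0 ▸ hx)
    obtain ⟨n, hn⟩ := exists_nat_one_div_lt hx0
    exact Set.mem_iUnion.2 ⟨n, (hXZ _ (by positivity) x hn.le).1 hx⟩
  · refine IsHalfConfig.congr_of_local fun δ hδ => ?_
    obtain ⟨Z, hZ, hXZ⟩ := h δ hδ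
    exact ⟨Z, (isConfig_iff.1 hZ).2.2.1, fun x hx => hXZ x (hx.trans (le_abs_self x))⟩
  · refine IsHalfConfig.congr_of_local fun δ hδ => ?_
    obtain ⟨Z, hZ, hXZ⟩ := h δ hδ
    exact ⟨_, (isConfig_iff.1 hZ).2.2.2, fun x hx =>
      hXZ (-x) (by rw [abs_neg]; exact hx.trans (le_abs_self x))⟩

theorem IsConfig.exists_abs_le (hX : IsConfig q t ζp ζm X) : ∃ R, ∀ x ∈ X, |x| ≤ R := by
  obtain ⟨-, h0, hp, hm⟩ := isConfig_iff.1 hX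
  obtain ⟨R, hR⟩ := hp.exists_le
  obtain ⟨R', hR'⟩ := hm.exists_le
  refine ⟨max R R', fun x hx => ?_⟩
  rcases lt_trichotomy x 0 with h | rfl | h
  · rw [abs_of_neg h]
    exact le_max_of_le_right (hR' (-x) (by simpa using hx) (by linarith))
  · exact absurd hx h0
  · rw [abs_of_pos h]
    exact le_max_of_le_left (hR x hx h)

theorem IsConfig.exists_finite_positions (hq0 : 0 < q) (hq1 : q < 1) (ht0 : 0 < t) (ht1 : t < 1)
    (hζp : 0 < ζp) (hζm : ζm < 0) {δ : ℝ} (hδ : 0 < δ) (R : ℝ) :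
    ∃ K : Set ℝ, K.Finite ∧ ∀ X, IsConfig q t ζp ζm X → (∀ x ∈ X, |x| ≤ R) →
      ∀ x ∈ X, δ ≤ |x| → x ∈ K := by
  have hζm' : 0 < -ζm := by linarith
  refine ⟨_, (IsHalfConfig.finite_positions hq0 hq1 ht0 ht1 hζp hδ R).union
    ((IsHalfConfig.finite_positions hq0 hq1 ht0 ht1 hζm' hδ R).preimage
      (f := Neg.neg) neg_injective.injOn), fun X hX hR x hx hδx => ?_⟩
  obtain ⟨-, h0, hp, hm⟩ := isConfig_iff.1 hX
  rcases lt_trichotomy x 0 with h | rfl | h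
  · rw [abs_of_neg h] at hδx
    exact Or.inr (hm.mem_positions hq0 hq1 hζm' hδ
      (fun y hy _ => by simpa using (neg_le_abs _).trans (hR (-y) hy)) (by simpa using hx) hδx)
  · exact absurd hx h0
  · rw [abs_of_pos h] at hδx
    exact Or.inl (hp.mem_positions hq0 hq1 hζp hδ
      (fun y hy _ => (le_abs_self y).trans (hR y hy)) hx hδx)

theorem IsConfig.truncate (hX : IsConfig q t ζp ζm X) (δ : ℝ) :
    IsConfig q t ζp ζm {x ∈ X | δ ≤ |x|} := by
  obtain ⟨hc, h0, hp, hm⟩ := isConfig_iff.1 hX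
  refine isConfig_iff.2 ⟨hc.mono (Set.sep_subset _ _), fun h => h0 h.1, hp.truncate δ, ?_⟩
  simpa using hm.truncate δ

theorem IsConfig.finite_truncate (hq0 : 0 < q) (hq1 : q < 1) (ht0 : 0 < t) (ht1 : t < 1)
    (hζp : 0 < ζp) (hζm : ζm < 0) (hX : IsConfig q t ζp ζm X) {δ : ℝ} (hδ : 0 < δ) :
    {x ∈ X | δ ≤ |x|}.Finite := by
  obtain ⟨R, hR⟩ := hX.exists_abs_le
  obtain ⟨K, hK, hXK⟩ := IsConfig.exists_finite_positions hq0 hq1 ht0 ht1 hζp hζm hδ R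
  exact hK.subset fun x hx => hXK X hX hR x hx.1 hx.2

theorem IsConfig.exists_infinite (hq0 : 0 < q) (hq1 : q < 1) (ht0 : 0 < t) (ht1 : t < 1)
    (hζp : 0 < ζp) (hζm : ζm < 0) (hX : IsConfig q t ζp ζm X) {δ : ℝ} (hδ : 0 < δ) :
    ∃ Z, IsConfig q t ζp ζm Z ∧ Z.Infinite ∧ ∀ x : ℝ, δ ≤ |x| → (x ∈ X ↔ x ∈ Z) := by
  obtain ⟨hTc, hT0, hTp, hTm⟩ := isConfig_iff.1 (hX.truncate δ)
  obtain ⟨c, hc0, hcδ, hc⟩ := hTp.exists_extension hq0 hq1 ht0 ht1 hζp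
    (hX.finite_truncate hq0 hq1 ht0 ht1 hζp hζm hδ) hδ
    fun x hx hx0 => by simpa [abs_of_pos hx0] using hx.2
  have hEpos (k : ℕ) : 0 < c * t ^ k := by positivity
  have hEle (k : ℕ) : c * t ^ k ≤ c :=
    mul_le_of_le_one_right hc0.le (pow_le_one₀ ht0.le ht1.le)
  refine ⟨_, isConfig_iff.2 ⟨hTc.union (Set.countable_range _), ?_, hc, ?_⟩, ?_, ?_⟩
  · rintro (h | ⟨k, hk⟩)
    · exact hT0 h
    · exact (hEpos k).ne' hk
  · refine IsHalfConfig.congr_of_local fun ε hε => ⟨_, hTm, fun x hx => ⟨?_, Or.inl⟩⟩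
    rintro (h | ⟨k, hk⟩)
    · exact h
    · have := hEpos k
      dsimp only at hk
      linarith
  · refine Set.Infinite.mono Set.subset_union_right (Set.infinite_range_of_injective ?_)
    intro i j hij
    exact pow_right_injective₀ ht0 ht1.ne (mul_left_cancel₀ hc0.ne' hij)
  · refine fun x hx => ⟨fun h => Or.inl ⟨h, hx⟩, ?_⟩
    rintro (h | ⟨k, rfl⟩)
    · exact h.1
    · have := hEle k
      dsimp only at hx
      rw [abs_of_pos (hEpos k)] at hx
      linarith

theorem countable_finite_configs (hq0 : 0 < q) (hq1 : q < 1)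
    (hζp : 0 < ζp) (hζm : ζm < 0) :
    {X : OmegaTilde q t ζp ζm | X.1.Finite}.Countable := by
  let L : Set ℝ := (Set.range fun p : ℕ × ℤ => ζp * q ^ p.2 * t ^ p.1) ∪
    Set.range fun p : ℕ × ℤ => ζm * q ^ p.2 * t ^ p.1
  have hL : L.Countable := (Set.countable_range _).union (Set.countable_range _)
  refine ((Set.countable_ofPred_finite_subset hL).preimage Subtype.val_injective).mono ?_
  intro X hX
  refine ⟨hX, fun x hx => ?_⟩
  obtain ⟨-, h0, hp, hm⟩ := isConfig_iff.1 X.2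
  rcases lt_trichotomy x 0 with h | rfl | h
  · obtain ⟨R, hR⟩ := hm.exists_le
    obtain ⟨a, n, hx', -⟩ := hm.exists_eq_of_le hq0 hq1 (by linarith) hR
      (x := -x) (by simpa using hx) (by linarith)
    exact Or.inr ⟨(a, n), by dsimp only; linarith⟩
  · exact absurd hx h0
  · obtain ⟨R, hR⟩ := hp.exists_le
    obtain ⟨a, n, hx', -⟩ := hp.exists_eq_of_le hq0 hq1 hζp hR hx h
    exact Or.inl ⟨(a, n), hx'.symm⟩

theorem isCompact_configBall (hq0 : 0 < q) (hq1 : q < 1) (ht0 : 0 < t) (ht1 : t < 1)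
    (hζp : 0 < ζp) (hζm : ζm < 0) (Y : OmegaTilde q t ζp ζm) {ε : ℝ} (hε : 0 < ε) :
    @IsCompact _ (cylTop q t ζp ζm) (configBall (fun X : OmegaTilde q t ζp ζm => X.1) Y ε) := by
  let := cylTop q t ζp ζm
  refine isCompact_iff_ultrafilter_le_nhds.2 fun F hF => ?_
  have hF' : ∀ᶠ Z in (F : Filter (OmegaTilde q t ζp ζm)),
      Z ∈ configBall (fun X : OmegaTilde q t ζp ζm => X.1) Y ε := le_principal_iff.1 hF
  obtain ⟨R, hR⟩ := Y.2.exists_abs_le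
  have hbound : ∀ Z ∈ configBall (fun X : OmegaTilde q t ζp ζm => X.1) Y ε,
      ∀ x ∈ Z.1, |x| ≤ max R ε := fun Z hZ x hx => by
    rcases le_total ε |x| with h | h
    · exact le_max_of_le_left (hR x ((hZ x h).2 hx))
    · exact le_max_of_le_right h
  let X : Set ℝ := {x | ∀ᶠ Z in (F : Filter (OmegaTilde q t ζp ζm)), x ∈ Z.1}
  have hlim : ∀ δ > 0, ∀ᶠ Z in (F : Filter (OmegaTilde q t ζp ζm)),
      ∀ x : ℝ, δ ≤ |x| → (x ∈ X ↔ x ∈ Z.1) := fun δ hδ => by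
    obtain ⟨K, hK, hXK⟩ :=
      IsConfig.exists_finite_positions hq0 hq1 ht0 ht1 hζp hζm hδ (max R ε)
    have hKF : ∀ᶠ Z in (F : Filter (OmegaTilde q t ζp ζm)), ∀ x ∈ K, (x ∈ X ↔ x ∈ Z.1) := by
      refine (eventually_all_finite hK).2 fun x _ => ?_
      by_cases hx : x ∈ X
      · filter_upwards [hx] with Z hZ using iff_of_true hx hZ
      · filter_upwards [Ultrafilter.eventually_not.2 hx] with Z hZ using iff_of_false hx hZ
    filter_upwards [hKF, hF'] with Z hZ hZY x hx
    by_cases hxK : x ∈ K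
    · exact hZ x hxK
    · refine iff_of_false (fun hxX => ?_) fun hxZ => hxK (hXK _ Z.2 (hbound Z hZY) x hxZ hx)
      obtain ⟨W, hxW, hWY⟩ := (Eventually.and hxX hF').exists
      exact hxK (hXK _ W.2 (hbound W hWY) x hxW hx)
  have hX : IsConfig q t ζp ζm X := by
    refine IsConfig.of_local (fun δ hδ => ?_) fun h => ?_
    · obtain ⟨Z, hZ⟩ := (hlim δ hδ).exists
      exact ⟨Z.1, Z.2, hZ⟩
    · obtain ⟨Z, hZ⟩ := Eventually.exists h
      exact Z.2.2.1 hZ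
  refine ⟨⟨X, hX⟩, ?_, fun s hs => ?_⟩
  · obtain ⟨Z, hZX, hZY⟩ := ((hlim ε hε).and hF').exists
    exact fun x hx => (hZY x hx).trans (hZX x hx).symm
  · obtain ⟨δ, hδ, hs'⟩ := mem_nhds_configTop_iff.1 hs
    exact mem_of_superset (hlim δ hδ) hs'

end Config

/-- The configuration space `Ω̃` is a locally compact separable Hausdorff space, and both
the set `Ω_∞` of infinite configurations and the set of finite configurations are dense
in it. -/
theorem stmt18 (q t ζp ζm : ℝ) (hq0 : 0 < q) (hq1 : q < 1) (ht0 : 0 < t) (ht1 : t < 1)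
    (hζp : 0 < ζp) (hζm : ζm < 0) :
    @LocallyCompactSpace (OmegaTilde q t ζp ζm) (cylTop q t ζp ζm) ∧
    @T2Space (OmegaTilde q t ζp ζm) (cylTop q t ζp ζm) ∧
    @TopologicalSpace.SeparableSpace (OmegaTilde q t ζp ζm) (cylTop q t ζp ζm) ∧
    @Dense (OmegaTilde q t ζp ζm) (cylTop q t ζp ζm)
      {X : OmegaTilde q t ζp ζm | X.1.Infinite} ∧
    @Dense (OmegaTilde q t ζp ζm) (cylTop q t ζp ζm)
      {X : OmegaTilde q t ζp ζm | X.1.Finite} := by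
  let := cylTop q t ζp ζm
  have hfin : Dense {X : OmegaTilde q t ζp ζm | X.1.Finite} :=
    dense_configTop fun Z ε hε => ⟨⟨_, Z.2.truncate ε⟩,
      Z.2.finite_truncate hq0 hq1 ht0 ht1 hζp hζm hε,
      fun x hx => ⟨fun h => ⟨h, hx⟩, fun h => h.1⟩⟩
  refine ⟨⟨fun Z s hs => ?_⟩, ⟨fun X Y hXY => ?_⟩,
    ⟨_, countable_finite_configs hq0 hq1 hζp hζm, hfin⟩,
    dense_configTop fun Z ε hε => ?_, hfin⟩
  · obtain ⟨ε, hε, hs'⟩ := mem_nhds_configTop_iff.1 hs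
    exact ⟨_, (isOpen_configBall hε).mem_nhds fun x _ => Iff.rfl, hs',
      isCompact_configBall hq0 hq1 ht0 ht1 hζp hζm Z hε⟩
  · obtain ⟨x, hx⟩ : ∃ x, ¬ (x ∈ X.1 ↔ x ∈ Y.1) := by
      by_contra! h
      exact hXY (Subtype.ext (Set.ext h))
    have hx0 : 0 < |x| := abs_pos.2 fun h => hx (h ▸ iff_of_false X.2.2.1 Y.2.2.1)
    refine ⟨_, _, isOpen_configBall hx0, isOpen_configBall hx0, fun _ _ => Iff.rfl,
      fun _ _ => Iff.rfl, Set.disjoint_left.2 fun Z hZX hZY => hx ?_⟩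
    exact (hZX x le_rfl).trans (hZY x le_rfl).symm
  · obtain ⟨W, hW, hWi, h⟩ := Z.2.exists_infinite hq0 hq1 ht0 ht1 hζp hζm hε
    exact ⟨⟨W, hW⟩, hWi, h⟩
end
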